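/- Let f(X,Y) = aX^2 + bXY + cY^2 be a primitive positive definite integral binary quadratic form whose discriminant D = b^2 - 4ac satisfies D ≤ -4. If C is a real number such that B_f(x)·√(log x)/x → C as x → ∞, then (√|D|/2)·C > 2^{-3/2}·3^{1/4}·∏_{p prime, p ≡ 2 (mod 3)} (1 - p^{-2})^{-1/2}. -/

import Mathlib

open Filter Real

/-- The number of positive integers `n ≤ x` represented by the integral binary quadratic
form `a X² + b X Y + c Y²`. -/
noncomputable def Bcount (a b c : ℤ) (x : ℝ) : ℕ :=
  Set.ncard {n : ℕ | 0 < n ∧ (n : ℝ) ≤ x ∧ ∃ u v : ℤ, (n : ℤ) = a * u ^ 2 + b * u * v + c * v ^ 2}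

/-- The Erdős number of the hexagonal lattice:
`2^{-3/2}·3^{1/4}·∏_{p ≡ 2 mod 3} (1 - p^{-2})^{-1/2}`. -/
noncomputable def hexErdos : ℝ :=
  2 ^ (-(3 : ℝ) / 2) * 3 ^ ((1 : ℝ) / 4) *
    ∏' p : {p : ℕ // p.Prime ∧ p % 3 = 2}, (1 - (p.1 : ℝ) ^ (-(2 : ℝ))) ^ (-(1 : ℝ) / 2)

section

open Topology MeasureTheory

set_option linter.unusedSectionVars false

namespace QuadOrder

section Ring

variable {A σ : ℤ}

/-- The quadratic order `ℤ[ω]`, `ω² = A + σ ω`, of discriminant `σ² + 4 A`. -/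
local notation "𝓡" => QuadraticAlgebra ℤ A σ

lemma four_mul_norm (z : 𝓡) :
    4 * z.norm = (2 * z.re + σ * z.im) ^ 2 - (σ ^ 2 + 4 * A) * z.im ^ 2 := by
  rw [QuadraticAlgebra.norm_def]; ring

variable [hD : Fact (σ ^ 2 + 4 * A < 0)]

lemma norm_nonneg' (z : 𝓡) : 0 ≤ z.norm := by
  have h := four_mul_norm z
  nlinarith [hD.out, sq_nonneg (2 * z.re + σ * z.im), sq_nonneg z.im]

lemma norm_eq_zero' {z : 𝓡} : z.norm = 0 ↔ z = 0 := by
  refine ⟨fun h0 => ?_, fun h => by simp [h]⟩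
  have h := four_mul_norm z
  rw [h0] at h
  have him : z.im = 0 := by
    by_contra hne
    have : 0 < z.im ^ 2 := by positivity
    nlinarith [hD.out, sq_nonneg (2 * z.re + σ * z.im)]
  have hre : z.re = 0 := by
    simp only [him] at h
    nlinarith
  ext <;> simp [him, hre]

lemma norm_pos' {z : 𝓡} (hz : z ≠ 0) : 0 < z.norm :=
  lt_of_le_of_ne (norm_nonneg' z) fun h => hz (norm_eq_zero'.1 h.symm)

instance : IsDomain 𝓡 :=
  have : NoZeroDivisors 𝓡 := ⟨fun {x y} h => by
    have : x.norm * y.norm = 0 := by rw [← map_mul, h]; simp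
    rcases mul_eq_zero.1 this with h | h
    · exact Or.inl (norm_eq_zero'.1 h)
    · exact Or.inr (norm_eq_zero'.1 h)⟩
  NoZeroDivisors.to_isDomain _

instance : CharZero 𝓡 := ⟨fun m n h => by
  have := congrArg QuadraticAlgebra.re h
  simpa using this⟩

lemma intCast_dvd_iff {n : ℤ} {z : 𝓡} : (n : 𝓡) ∣ z ↔ n ∣ z.re ∧ n ∣ z.im := by
  constructor
  · rintro ⟨w, rfl⟩
    simp
  · rintro ⟨⟨x, hx⟩, ⟨y, hy⟩⟩
    exact ⟨⟨x, y⟩, by ext <;> simp [hx, hy]⟩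

lemma mul_star_eq_norm (z : 𝓡) : z * star z = (z.norm : 𝓡) := by
  rw [← QuadraticAlgebra.algebraMap_norm_eq_mul_star]; rfl

/-- Conjugation. -/
noncomputable def cj : 𝓡 ≃+* 𝓡 := starRingAut

lemma cj_apply (z : 𝓡) : cj z = star z := rfl

lemma cj_cj (z : 𝓡) : cj (cj z) = z := star_star z

lemma mem_map_cj {J : Ideal 𝓡} {z : 𝓡} : z ∈ J.map cj ↔ cj z ∈ J := by
  rw [Ideal.mem_map_of_equiv]
  constructor
  · rintro ⟨x, hx, rfl⟩
    rwa [cj_cj]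
  · exact fun h => ⟨_, h, cj_cj z⟩

lemma map_cj_map_cj (J : Ideal 𝓡) : (J.map cj).map cj = J := by
  ext z; rw [mem_map_cj, mem_map_cj, cj_cj]

lemma map_cj_span (z : 𝓡) : (Ideal.span {z}).map cj = Ideal.span {star z} := by
  rw [Ideal.map_span]; simp [cj_apply]

lemma map_cj_span_int (n : ℤ) : (Ideal.span {(n : 𝓡)}).map cj = Ideal.span {(n : 𝓡)} := by
  rw [map_cj_span]; simp

/-- A primitive form `m X² + (2 t + σ) X Y + C Y²` of discriminant `σ² + 4 A`. -/
structure Frm (A σ : ℤ) where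
  m : ℤ
  t : ℤ
  C : ℤ
  pos : 0 < m
  eq : m * C = t ^ 2 + σ * t - A
  prim : ∃ x y z : ℤ, x * m + y * (2 * t + σ) + z * C = 1

/-- The value of a form. -/
def Frm.val (f : Frm A σ) (u v : ℤ) : ℤ := f.m * u ^ 2 + (2 * f.t + σ) * u * v + f.C * v ^ 2

/-- The ideal attached to a form. -/
def Frm.idl (f : Frm A σ) : Ideal 𝓡 where
  carrier := {z | f.m ∣ z.re - f.t * z.im}
  zero_mem' := by simp
  add_mem' := by
    rintro a b ⟨x, hx⟩ ⟨y, hy⟩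
    refine ⟨x + y, ?_⟩
    simp only [QuadraticAlgebra.re_add, QuadraticAlgebra.im_add]
    linear_combination hx + hy
  smul_mem' := by
    intro w z hz
    simp only [Set.mem_ofPred_eq, smul_eq_mul, QuadraticAlgebra.re_mul,
      QuadraticAlgebra.im_mul] at hz ⊢
    obtain ⟨k, hk⟩ := hz
    refine ⟨w.re * k - w.im * f.t * k - w.im * z.im * f.C, ?_⟩
    linear_combination (w.re - w.im * f.t) * hk + w.im * z.im * f.eq

lemma Frm.mem_idl {f : Frm A σ} {z : 𝓡} : z ∈ f.idl ↔ f.m ∣ z.re - f.t * z.im := Iff.rfl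

/-- The element `m u + (t + ω) v` of the ideal attached to a form. -/
def Frm.elt (f : Frm A σ) (u v : ℤ) : 𝓡 := ⟨f.m * u + f.t * v, v⟩

lemma Frm.norm_elt (f : Frm A σ) (u v : ℤ) : (f.elt u v).norm = f.m * f.val u v := by
  rw [QuadraticAlgebra.norm_def, Frm.val, Frm.elt]
  linear_combination (-v ^ 2) * f.eq

lemma Frm.mem_idl_iff_exists {f : Frm A σ} {z : 𝓡} : z ∈ f.idl ↔ ∃ u v, z = f.elt u v := by
  rw [Frm.mem_idl]
  constructor
  · rintro ⟨u, hu⟩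
    refine ⟨u, z.im, ?_⟩
    ext
    · simp only [Frm.elt]; linarith
    · simp [Frm.elt]
  · rintro ⟨u, v, rfl⟩
    exact ⟨u, by simp only [Frm.elt]; ring⟩

lemma Frm.elt_mem (f : Frm A σ) (u v : ℤ) : f.elt u v ∈ f.idl :=
  Frm.mem_idl_iff_exists.2 ⟨u, v, rfl⟩

/-- The conjugate form. -/
def Frm.conj (f : Frm A σ) : Frm A σ where
  m := f.m
  t := -σ - f.t
  C := f.C
  pos := f.pos
  eq := by linear_combination f.eq
  prim := by
    obtain ⟨x, y, z, h⟩ := f.prim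
    exact ⟨x, -y, z, by linear_combination h⟩

lemma Frm.map_cj_idl (f : Frm A σ) : f.idl.map cj = f.conj.idl := by
  ext z
  rw [mem_map_cj, Frm.mem_idl, Frm.mem_idl]
  simp only [cj_apply, QuadraticAlgebra.re_star, QuadraticAlgebra.im_star, Frm.conj]
  ring_nf

lemma Frm.idl_mul_conj (f : Frm A σ) : f.idl * f.idl.map cj = Ideal.span {(f.m : 𝓡)} := by
  apply le_antisymm
  · rw [Ideal.mul_le]
    intro r hr s hs
    rw [mem_map_cj] at hs
    obtain ⟨u, v, rfl⟩ := Frm.mem_idl_iff_exists.1 hr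
    obtain ⟨u', v', h⟩ := Frm.mem_idl_iff_exists.1 hs
    obtain rfl : s = star (f.elt u' v') := by rw [← h, cj_apply, star_star]
    rw [Ideal.mem_span_singleton, intCast_dvd_iff]
    simp only [Frm.elt, QuadraticAlgebra.star_mk, QuadraticAlgebra.re_mul, QuadraticAlgebra.im_mul]
    constructor
    · refine ⟨f.m * u * u' + f.t * u * v' + σ * u * v' + f.t * v * u' + v * v' * f.C, ?_⟩
      linear_combination (-v * v') * f.eq
    · exact ⟨v * u' - u * v', by ring⟩
  · rw [Ideal.span_singleton_le_iff_mem]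
    obtain ⟨x, y, z, h⟩ := f.prim
    have key : ∀ u v u' v', f.elt u v * star (f.elt u' v') ∈ f.idl * f.idl.map cj := fun u v u' v' =>
      Ideal.mul_mem_mul (f.elt_mem u v) (mem_map_cj.2 (by
        rw [cj_apply, star_star]; exact f.elt_mem u' v'))
    have h1 := Ideal.mul_mem_left _ (x : 𝓡) (key 1 0 1 0)
    have h2 := Ideal.mul_mem_left _ (y : 𝓡) (add_mem (key 1 0 0 1) (key 0 1 1 0))
    have h3 := Ideal.mul_mem_left _ (z : 𝓡) (key 0 1 0 1)
    have e : (f.m : 𝓡) = x * (f.elt 1 0 * star (f.elt 1 0)) +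
        y * (f.elt 1 0 * star (f.elt 0 1) + f.elt 0 1 * star (f.elt 1 0)) +
        z * (f.elt 0 1 * star (f.elt 0 1)) := by
      ext
      · simp [Frm.elt]
        linear_combination (-f.m) * h + z * f.eq
      · simp [Frm.elt]
    rw [e]
    exact add_mem (add_mem h1 h2) h3

end Ring

section Structure

variable {A σ : ℤ} [hD : Fact (σ ^ 2 + 4 * A < 0)]

local notation "𝓡" => QuadraticAlgebra ℤ A σ

/-- The integers in an ideal. -/
def rePart (J : Ideal 𝓡) : Ideal ℤ := J.comap (algebraMap ℤ 𝓡)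

lemma mem_rePart {J : Ideal 𝓡} {x : ℤ} : x ∈ rePart J ↔ (⟨x, 0⟩ : 𝓡) ∈ J := by
  rw [rePart, Ideal.mem_comap]
  have : algebraMap ℤ 𝓡 x = ⟨x, 0⟩ := by ext <;> simp
  rw [this]

/-- The `ω`-coordinates of the elements of an ideal. -/
def imPart (J : Ideal 𝓡) : Ideal ℤ where
  carrier := {y | ∃ x, (⟨x, y⟩ : 𝓡) ∈ J}
  zero_mem' := ⟨0, J.zero_mem⟩
  add_mem' := by
    rintro a b ⟨x, hx⟩ ⟨y, hy⟩
    exact ⟨x + y, J.add_mem hx hy⟩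
  smul_mem' := by
    rintro c x ⟨y, hy⟩
    refine ⟨c * y, ?_⟩
    have := J.mul_mem_left (c : 𝓡) hy
    have e : (c : 𝓡) * ⟨y, x⟩ = ⟨c * y, c * x⟩ := by ext <;> simp
    rwa [e] at this

lemma mem_imPart {J : Ideal 𝓡} {y : ℤ} : y ∈ imPart J ↔ ∃ x, (⟨x, y⟩ : 𝓡) ∈ J := Iff.rfl

lemma intCast_eq_mk (n : ℤ) : (n : 𝓡) = ⟨n, 0⟩ := by ext <;> simp

lemma exists_pos_generator (I : Ideal ℤ) (hI : I ≠ ⊥) : ∃ g : ℤ, 0 < g ∧ ∀ x, x ∈ I ↔ g ∣ x := by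
  obtain ⟨g, hg⟩ := (IsPrincipalIdealRing.principal I).principal
  have hg0 : g ≠ 0 := by
    rintro rfl
    exact hI (by rw [hg]; simp)
  refine ⟨|g|, abs_pos.2 hg0, fun x => ?_⟩
  rw [hg, abs_dvd]
  exact Ideal.mem_span_singleton

lemma Frm.dvd_of_mem_mul_conj {m t C d : ℤ} (hm : (m : ℤ) * C = t ^ 2 + σ * t - A)
    (hd1 : d ∣ m) (hd2 : d ∣ 2 * t + σ) (hd3 : d ∣ C) (I : Ideal 𝓡)
    (hI : ∀ z, z ∈ I → ∃ u v : ℤ, z = ⟨m * u + t * v, v⟩) {z : 𝓡} (hz : z ∈ I * I.map cj) :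
    d * m ∣ z.re - t * z.im := by
  refine Submodule.mul_induction_on hz ?_ ?_
  · intro r hr s hs
    rw [mem_map_cj] at hs
    obtain ⟨u, v, rfl⟩ := hI _ hr
    obtain ⟨u', v', h⟩ := hI _ hs
    obtain rfl : s = star ⟨m * u' + t * v', v'⟩ := by rw [← h, cj_apply, star_star]
    obtain ⟨a, ha⟩ := hd1
    obtain ⟨b, hb⟩ := hd2
    obtain ⟨c, hc⟩ := hd3
    simp only [QuadraticAlgebra.star_mk, QuadraticAlgebra.re_mul, QuadraticAlgebra.im_mul]
    refine ⟨a * u * u' + b * u * v' + c * v * v', ?_⟩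
    linear_combination (m * u * u') * ha + (m * u * v') * hb + (m * v * v') * hc - (v * v') * hm
  · intro x y hx hy
    have := dvd_add hx hy
    simp only [QuadraticAlgebra.re_add, QuadraticAlgebra.im_add]
    rwa [show x.re + y.re - t * (x.im + y.im) = (x.re - t * x.im) + (y.re - t * y.im) by ring]

lemma exists_bezout_of_gcd {a b c : ℤ} (h : Int.gcd (Int.gcd a b) c = 1) :
    ∃ x y z : ℤ, x * a + y * b + z * c = 1 := by
  have b1 := Int.gcd_eq_gcd_ab (Int.gcd a b) c
  have b2 := Int.gcd_eq_gcd_ab a b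
  rw [h] at b1
  refine ⟨_, _, _, (?_ : Int.gcdA a b * Int.gcdA (Int.gcd a b) c * a +
    Int.gcdB a b * Int.gcdA (Int.gcd a b) c * b + Int.gcdB (Int.gcd a b) c * c = 1)⟩
  push_cast at b1
  linear_combination -b1 - Int.gcdA (Int.gcd a b) c * b2

lemma re_intCast_mul (n : ℤ) (z : 𝓡) : ((n : 𝓡) * z).re = n * z.re := by simp

lemma im_intCast_mul (n : ℤ) (z : 𝓡) : ((n : 𝓡) * z).im = n * z.im := by simp

/-- An invertible ideal is an integer multiple of the ideal of a primitive form. -/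
lemma exists_frm_of_mul_conj {J : Ideal 𝓡} {n : ℤ} (hn : 0 < n)
    (hJ : J * J.map cj = Ideal.span {(n : 𝓡)}) :
    ∃ (k : ℤ) (f : Frm A σ), 0 < k ∧ J = Ideal.span {(k : 𝓡)} * f.idl ∧ n = k ^ 2 * f.m := by
  have hnJ : (n : 𝓡) ∈ J := by
    have : (n : 𝓡) ∈ J * J.map cj := by rw [hJ]; exact Ideal.mem_span_singleton_self _
    exact Ideal.mul_le_left this
  have hnre : n ∈ rePart J := by
    rwa [mem_rePart, ← intCast_eq_mk]
  have hre_im : ∀ g, g ∈ rePart J → g ∈ imPart J := by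
    intro g hg
    refine mem_imPart.2 ⟨0, ?_⟩
    have := J.mul_mem_left ⟨0, 1⟩ (mem_rePart.1 hg)
    convert this using 1
    ext <;> simp
  obtain ⟨g, hg0, hg⟩ := exists_pos_generator (rePart J) (by
    intro h; rw [h] at hnre; simp at hnre; omega)
  obtain ⟨k, hk0, hk⟩ := exists_pos_generator (imPart J) (by
    intro h; have := hre_im _ hnre; rw [h] at this; simp at this; omega)
  obtain ⟨x0, hx0⟩ : k ∈ imPart J := (hk k).2 dvd_rfl
  obtain ⟨m, hm⟩ : k ∣ g := (hk g).1 (hre_im g ((hg g).2 dvd_rfl))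
  have hm0 : 0 < m := by
    by_contra h
    have : k * m ≤ 0 := mul_nonpos_of_nonneg_of_nonpos hk0.le (not_lt.1 h)
    omega
  obtain ⟨t, ht⟩ : k ∣ x0 := by
    have := J.mul_mem_left ⟨0, 1⟩ hx0
    have h2 : (k : ℤ) ∣ x0 + σ * k := (hk _).1 ⟨A * k, by
      convert this using 1
      ext <;> simp⟩
    exact (dvd_add_left (Dvd.intro_left σ rfl)).1 h2
  obtain ⟨C, hC⟩ : m ∣ t ^ 2 + σ * t - A := by
    have := J.mul_mem_left ⟨t + σ, -1⟩ hx0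
    have h2 : k * (t ^ 2 + σ * t - A) ∈ rePart J := by
      rw [mem_rePart]
      convert this using 1
      ext
      · simp [ht]; ring
      · simp [ht]; ring
    rw [hg, hm] at h2
    exact (mul_dvd_mul_iff_left hk0.ne').1 h2
  -- the primitive part
  have hJmem : ∀ z : 𝓡, z ∈ J ↔ ∃ u v : ℤ, z = (k : 𝓡) * ⟨m * u + t * v, v⟩ := by
    intro z
    constructor
    · intro hz
      obtain ⟨v, hv⟩ : k ∣ z.im := (hk _).1 ⟨z.re, hz⟩
      have h2 : z.re - v * x0 ∈ rePart J := by
        rw [mem_rePart]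
        have := J.sub_mem hz (J.mul_mem_left (v : 𝓡) hx0)
        convert this using 1
        ext <;> simp [hv]; ring
      obtain ⟨u, hu⟩ := (hg _).1 h2
      refine ⟨u, v, ?_⟩
      ext
      · simp; linear_combination hu + u * hm + v * ht
      · simp [hv]
    · rintro ⟨u, v, rfl⟩
      have h1 : (⟨g, 0⟩ : 𝓡) ∈ J := mem_rePart.1 ((hg g).2 dvd_rfl)
      have := J.add_mem (J.mul_mem_left (u : 𝓡) h1) (J.mul_mem_left (v : 𝓡) hx0)
      convert this using 1
      ext
      · simp; linear_combination (-u) * hm - v * ht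
      · simp; ring
  let d : ℤ := Int.gcd (Int.gcd m (2 * t + σ)) C
  let I : Ideal 𝓡 :=
    { carrier := {z | m ∣ z.re - t * z.im}
      zero_mem' := by simp
      add_mem' := by
        rintro a b ⟨x, hx⟩ ⟨y, hy⟩
        refine ⟨x + y, ?_⟩
        simp only [QuadraticAlgebra.re_add, QuadraticAlgebra.im_add]
        linear_combination hx + hy
      smul_mem' := by
        rintro w z ⟨j, hj⟩
        simp only [Set.mem_ofPred_eq, smul_eq_mul, QuadraticAlgebra.re_mul,
          QuadraticAlgebra.im_mul]
        refine ⟨w.re * j - w.im * t * j - w.im * z.im * C, ?_⟩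
        linear_combination (w.re - w.im * t) * hj - w.im * z.im * hC }
  have hImem : ∀ z : 𝓡, z ∈ I ↔ ∃ u v : ℤ, z = ⟨m * u + t * v, v⟩ := by
    intro z
    constructor
    · rintro ⟨u, hu⟩
      exact ⟨u, z.im, by ext <;> simp; linarith⟩
    · rintro ⟨u, v, rfl⟩
      exact ⟨u, by simp⟩
  have hJI : J = Ideal.span {(k : 𝓡)} * I := by
    ext z
    rw [hJmem, Ideal.mem_span_singleton_mul]
    constructor
    · rintro ⟨u, v, rfl⟩
      exact ⟨_, (hImem _).2 ⟨u, v, rfl⟩, rfl⟩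
    · rintro ⟨w, hw, rfl⟩
      obtain ⟨u, v, rfl⟩ := (hImem _).1 hw
      exact ⟨u, v, rfl⟩
  have hII : Ideal.span {(n : 𝓡)} = Ideal.span {((k ^ 2 : ℤ) : 𝓡)} * (I * I.map cj) := by
    rw [← hJ, hJI, Ideal.map_mul, map_cj_span_int]
    rw [show ((k ^ 2 : ℤ) : 𝓡) = (k : 𝓡) * (k : 𝓡) by push_cast; ring,
      ← Ideal.span_singleton_mul_span_singleton]
    ac_rfl
  obtain ⟨z, hz, hzn⟩ : ∃ z ∈ I * I.map cj, ((k ^ 2 : ℤ) : 𝓡) * z = n := by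
    rw [← Ideal.mem_span_singleton_mul, ← hII]
    exact Ideal.mem_span_singleton_self _
  have hzre : k ^ 2 * z.re = n := by
    rw [← re_intCast_mul, hzn]; simp
  have hzim : z.im = 0 := by
    have : k ^ 2 * z.im = 0 := by
      rw [← im_intCast_mul, hzn]; simp
    exact (mul_eq_zero.1 this).resolve_left (by positivity)
  have hd1 : d ∣ m := (Int.gcd_dvd_left _ _).trans (Int.gcd_dvd_left _ _)
  have hd2 : d ∣ 2 * t + σ := (Int.gcd_dvd_left _ _).trans (Int.gcd_dvd_right _ _)
  have hd3 : d ∣ C := Int.gcd_dvd_right _ _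
  have hdz := Frm.dvd_of_mem_mul_conj hC.symm hd1 hd2 hd3 I (fun z hz => (hImem z).1 hz) hz
  rw [hzim, mul_zero, sub_zero] at hdz
  have hzm : z.re ∣ m := by
    have h1 : (⟨m * 0 + t * 1, 1⟩ : 𝓡) * star (⟨m * 1 + t * 0, 0⟩ : 𝓡) ∈ I * I.map cj :=
      Ideal.mul_mem_mul ((hImem _).2 ⟨0, 1, rfl⟩)
        (mem_map_cj.2 (by rw [cj_apply, star_star]; exact (hImem _).2 ⟨1, 0, rfl⟩))
    have h2 : ((k ^ 2 : ℤ) : 𝓡) * ((⟨m * 0 + t * 1, 1⟩ : 𝓡) * star (⟨m * 1 + t * 0, 0⟩ : 𝓡))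
        ∈ Ideal.span {(n : 𝓡)} := by
      rw [hII]
      exact Ideal.mul_mem_mul (Ideal.mem_span_singleton_self _) h1
    rw [Ideal.mem_span_singleton, intCast_dvd_iff, im_intCast_mul] at h2
    have h3 : n ∣ k ^ 2 * m := by simpa using h2.2
    rw [← hzre] at h3
    exact (mul_dvd_mul_iff_left (by positivity)).1 h3
  have hdu : d ∣ 1 := by
    have : d * m ∣ 1 * m := by simpa using hdz.trans hzm
    exact (mul_dvd_mul_iff_right hm0.ne').1 this
  have hzpos : 0 < z.re := by
    by_contra h
    have : k ^ 2 * z.re ≤ 0 := mul_nonpos_of_nonneg_of_nonpos (by positivity) (not_lt.1 h)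
    omega
  have hzeq : z.re = m := Int.dvd_antisymm hzpos.le hm0.le hzm
    ((Dvd.intro_left d rfl).trans hdz)
  have hd_one : (d : ℤ) = 1 := Int.eq_one_of_dvd_one (by positivity) hdu
  refine ⟨k, ⟨m, t, C, hm0, hC.symm, ?_⟩, hk0, hJI, by rw [← hzre, hzeq]⟩
  exact exists_bezout_of_gcd (Int.natCast_inj.1 hd_one)

end Structure

section ClassGroup

variable {A σ : ℤ} [hD : Fact (σ ^ 2 + 4 * A < 0)]

local notation "𝓡" => QuadraticAlgebra ℤ A σ

/-- `J` is invertible of norm `n`. -/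
def HasNm (J : Ideal 𝓡) (n : ℤ) : Prop := 0 < n ∧ J * J.map cj = Ideal.span {(n : 𝓡)}

lemma span_intCast_mul (m n : ℤ) :
    Ideal.span {((m * n : ℤ) : 𝓡)} = Ideal.span {(m : 𝓡)} * Ideal.span {(n : 𝓡)} := by
  rw [Ideal.span_singleton_mul_span_singleton]; push_cast; rfl

lemma span_intCast_le {m n : ℤ} : Ideal.span {(m : 𝓡)} ≤ Ideal.span {(n : 𝓡)} ↔ n ∣ m := by
  rw [Ideal.span_singleton_le_span_singleton, intCast_dvd_iff]
  simp

lemma span_mul_cancel {z : 𝓡} (hz : z ≠ 0) {J K : Ideal 𝓡}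
    (h : Ideal.span {z} * J = Ideal.span {z} * K) : J = K :=
  (Ideal.span_singleton_mul_right_inj hz).1 h

lemma intCast_ne_zero' {n : ℤ} (hn : 0 < n) : (n : 𝓡) ≠ 0 := by
  exact_mod_cast hn.ne'

lemma HasNm.unique {J : Ideal 𝓡} {m n : ℤ} (h1 : HasNm J m) (h2 : HasNm J n) : m = n := by
  have h := h1.2.symm.trans h2.2
  exact Int.dvd_antisymm h1.1.le h2.1.le (span_intCast_le.1 h.ge) (span_intCast_le.1 h.le)

lemma HasNm.mul {I J : Ideal 𝓡} {m n : ℤ} (h1 : HasNm I m) (h2 : HasNm J n) :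
    HasNm (I * J) (m * n) := by
  refine ⟨mul_pos h1.1 h2.1, ?_⟩
  rw [span_intCast_mul, ← h1.2, ← h2.2, Ideal.map_mul]
  ac_rfl

lemma HasNm.conj {I : Ideal 𝓡} {m : ℤ} (h : HasNm I m) : HasNm (I.map cj) m :=
  ⟨h.1, by rw [map_cj_map_cj, mul_comm, h.2]⟩

lemma hasNm_span {z : 𝓡} (hz : z ≠ 0) : HasNm (Ideal.span {z}) z.norm :=
  ⟨norm_pos' hz, by
    rw [map_cj_span, Ideal.span_singleton_mul_span_singleton, mul_star_eq_norm]⟩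

lemma hasNm_span_int {n : ℤ} (hn : 0 < n) : HasNm (Ideal.span {(n : 𝓡)}) (n ^ 2) :=
  ⟨by positivity, by rw [map_cj_span_int, sq, span_intCast_mul]⟩

lemma hasNm_one : HasNm (1 : Ideal 𝓡) 1 :=
  ⟨one_pos, by rw [Ideal.one_eq_top, Ideal.map_top]; simp [Ideal.span_singleton_one]⟩

lemma Frm.hasNm (f : Frm A σ) : HasNm f.idl f.m := ⟨f.pos, f.idl_mul_conj⟩

lemma HasNm.cancel {I J K : Ideal 𝓡} {m : ℤ} (h : HasNm I m) (e : I * J = I * K) : J = K := by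
  apply span_mul_cancel (intCast_ne_zero' h.1)
  rw [← h.2, mul_assoc, mul_assoc, mul_comm (I.map cj) J, mul_comm (I.map cj) K, ← mul_assoc,
    ← mul_assoc, e]

lemma HasNm.dvd {I K : Ideal 𝓡} {m : ℤ} (h : HasNm I m) (hK : K ≤ I) : ∃ J, K = I * J := by
  let J : Ideal 𝓡 := Submodule.comap (LinearMap.mulLeft 𝓡 (m : 𝓡)) (K * I.map cj)
  have hJ : K * I.map cj = Ideal.span {(m : 𝓡)} * J := by
    ext z
    rw [Ideal.mem_span_singleton_mul]
    constructor
    · intro hz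
      have h2 : z ∈ Ideal.span {(m : 𝓡)} := by
        rw [← h.2]; exact Ideal.mul_mono_left hK hz
      obtain ⟨w, rfl⟩ := Ideal.mem_span_singleton.1 h2
      exact ⟨w, hz, rfl⟩
    · rintro ⟨w, hw, rfl⟩
      exact hw
  refine ⟨J, span_mul_cancel (intCast_ne_zero' h.1) ?_⟩
  rw [mul_comm I J, ← mul_assoc, ← hJ, ← h.2]
  ac_rfl

lemma HasNm.of_mul {I J : Ideal 𝓡} {m n : ℤ} (h : HasNm I m) (h2 : HasNm (I * J) n) :
    ∃ l, n = m * l ∧ HasNm J l := by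
  have e : Ideal.span {(m : 𝓡)} * (J * J.map cj) = Ideal.span {(n : 𝓡)} := by
    rw [← h.2, ← h2.2, Ideal.map_mul]; ac_rfl
  obtain ⟨l, hl⟩ : m ∣ n := span_intCast_le.1 (e ▸ Ideal.mul_le_left)
  refine ⟨l, hl, ?_, ?_⟩
  · subst hl
    exact (mul_pos_iff_of_pos_left h.1).1 h2.1
  · apply span_mul_cancel (intCast_ne_zero' h.1)
    rw [e, hl, span_intCast_mul]

variable (A σ) in
/-- The monoid of invertible ideals. -/
def InvI : Submonoid (Ideal 𝓡) where
  carrier := {J | ∃ n, HasNm J n}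
  one_mem' := ⟨1, hasNm_one⟩
  mul_mem' := by
    rintro I J ⟨m, hm⟩ ⟨n, hn⟩
    exact ⟨_, hm.mul hn⟩

variable (A σ) in
/-- Equivalence of invertible ideals. -/
def idealCon : Con (InvI A σ) where
  r J K := ∃ x y : 𝓡, x ≠ 0 ∧ y ≠ 0 ∧ Ideal.span {x} * J.1 = Ideal.span {y} * K.1
  iseqv := by
    refine ⟨fun J => ⟨1, 1, one_ne_zero, one_ne_zero, rfl⟩, ?_, ?_⟩
    · rintro J K ⟨x, y, hx, hy, h⟩
      exact ⟨y, x, hy, hx, h.symm⟩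
    · rintro J K L ⟨x, y, hx, hy, h⟩ ⟨x', y', hx', hy', h'⟩
      refine ⟨x * x', y * y', mul_ne_zero hx hx', mul_ne_zero hy hy', ?_⟩
      rw [← Ideal.span_singleton_mul_span_singleton, ← Ideal.span_singleton_mul_span_singleton,
        mul_comm (Ideal.span {x}), mul_assoc, h, mul_left_comm, h', mul_assoc]
  mul' := by
    rintro J K L M ⟨x, y, hx, hy, h⟩ ⟨x', y', hx', hy', h'⟩
    refine ⟨x * x', y * y', mul_ne_zero hx hx', mul_ne_zero hy hy', ?_⟩
    rw [← Ideal.span_singleton_mul_span_singleton, ← Ideal.span_singleton_mul_span_singleton,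
      Submonoid.coe_mul, Submonoid.coe_mul, mul_mul_mul_comm, h, h', mul_mul_mul_comm]

variable (A σ) in
/-- The class group. -/
abbrev Cl : Type := (idealCon A σ).Quotient

lemma HasNm.mem {J : Ideal 𝓡} {n : ℤ} (h : HasNm J n) : J ∈ InvI A σ := ⟨n, h⟩

/-- The class of an invertible ideal. -/
def HasNm.cl {J : Ideal 𝓡} {n : ℤ} (h : HasNm J n) : Cl A σ := ((⟨J, h.mem⟩ : InvI A σ) : Cl A σ)

lemma HasNm.cl_eq_iff {J K : Ideal 𝓡} {m n : ℤ} (h : HasNm J m) (h' : HasNm K n) :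
    h.cl = h'.cl ↔ ∃ x y : 𝓡, x ≠ 0 ∧ y ≠ 0 ∧ Ideal.span {x} * J = Ideal.span {y} * K :=
  (idealCon A σ).eq

lemma HasNm.cl_mul {J K : Ideal 𝓡} {m n : ℤ} (h : HasNm J m) (h' : HasNm K n) :
    (h.mul h').cl = h.cl * h'.cl := rfl

lemma HasNm.cl_congr {J K : Ideal 𝓡} {m n : ℤ} (h : HasNm J m) (h' : HasNm K n) (e : J = K) :
    h.cl = h'.cl := by subst e; rfl

lemma HasNm.cl_eq_one_iff {J : Ideal 𝓡} {m : ℤ} (h : HasNm J m) :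
    h.cl = 1 ↔ ∃ z : 𝓡, z ≠ 0 ∧ J = Ideal.span {z} := by
  rw [show (1 : Cl A σ) = (hasNm_one (A := A) (σ := σ)).cl from rfl, HasNm.cl_eq_iff]
  constructor
  · rintro ⟨x, y, hx, hy, e⟩
    rw [mul_one] at e
    obtain ⟨z, hz, hzy⟩ : ∃ z ∈ J, x * z = y := by
      rw [← Ideal.mem_span_singleton_mul, e]
      exact Ideal.mem_span_singleton_self y
    refine ⟨z, by rintro rfl; simp at hzy; exact hy hzy.symm, span_mul_cancel hx ?_⟩
    rw [e, Ideal.span_singleton_mul_span_singleton, hzy]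
  · rintro ⟨z, hz, rfl⟩
    exact ⟨1, z, one_ne_zero, hz, by rw [mul_one, Ideal.span_singleton_one, Ideal.top_mul]⟩

lemma HasNm.cl_mul_conj {J : Ideal 𝓡} {m : ℤ} (h : HasNm J m) : h.cl * h.conj.cl = 1 := by
  rw [← HasNm.cl_mul, HasNm.cl_eq_one_iff]
  exact ⟨m, intCast_ne_zero' h.1, h.2⟩

lemma exists_hasNm_cl (c : Cl A σ) : ∃ (J : Ideal 𝓡) (m : ℤ) (h : HasNm J m), h.cl = c := by
  induction c using Con.induction_on with
  | H x =>
    obtain ⟨J, m, hm⟩ := x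
    exact ⟨J, m, hm, rfl⟩

noncomputable instance : CommGroup (Cl A σ) :=
  commGroupOfIsUnit (M := Cl A σ) fun c => by
    obtain ⟨J, m, h, rfl⟩ := exists_hasNm_cl c
    exact IsUnit.of_mul_eq_one _ h.cl_mul_conj

lemma HasNm.cl_conj {J : Ideal 𝓡} {m : ℤ} (h : HasNm J m) : h.conj.cl = h.cl⁻¹ :=
  eq_inv_of_mul_eq_one_right h.cl_mul_conj

/-- The class of a form. -/
def Frm.cl (f : Frm A σ) : Cl A σ := f.hasNm.cl

lemma Frm.cl_conj (f : Frm A σ) : f.conj.cl = f.cl⁻¹ := by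
  rw [Frm.cl, Frm.cl, ← HasNm.cl_conj]
  exact HasNm.cl_congr _ _ f.map_cj_idl.symm

lemma HasNm.exists_frm {J : Ideal 𝓡} {n : ℤ} (h : HasNm J n) :
    ∃ (k : ℤ) (f : Frm A σ), 0 < k ∧ J = Ideal.span {(k : 𝓡)} * f.idl ∧ n = k ^ 2 * f.m ∧
      f.cl = h.cl := by
  obtain ⟨k, f, hk, hJ, hn⟩ := exists_frm_of_mul_conj h.1 h.2
  refine ⟨k, f, hk, hJ, hn, (HasNm.cl_eq_iff _ _).2 ⟨k, 1, intCast_ne_zero' hk, one_ne_zero, ?_⟩⟩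
  rw [← hJ, Ideal.span_singleton_one, Ideal.top_mul]

lemma exists_frm_cl (c : Cl A σ) : ∃ f : Frm A σ, f.cl = c := by
  obtain ⟨J, m, h, rfl⟩ := exists_hasNm_cl c
  obtain ⟨k, f, -, -, -, e⟩ := h.exists_frm
  exact ⟨f, e⟩

lemma HasNm.exists_of_mem {J : Ideal 𝓡} {n : ℤ} (h : HasNm J n) {z : 𝓡} (hz : z ∈ J)
    (hz0 : z ≠ 0) : ∃ (K : Ideal 𝓡) (l : ℤ) (hK : HasNm K l), Ideal.span {z} = J * K ∧
      z.norm = n * l ∧ hK.cl = h.cl⁻¹ := by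
  obtain ⟨K, hK⟩ := h.dvd ((Ideal.span_singleton_le_iff_mem _).2 hz)
  obtain ⟨l, hl, hKl⟩ := h.of_mul (hK ▸ hasNm_span hz0)
  refine ⟨K, l, hKl, hK, hl, eq_inv_of_mul_eq_one_right ?_⟩
  rw [← HasNm.cl_mul, HasNm.cl_eq_one_iff]
  exact ⟨z, hz0, hK.symm⟩

/-- Translation of the middle coefficient. -/
def Frm.shift (f : Frm A σ) (j : ℤ) : Frm A σ where
  m := f.m
  t := f.t + j * f.m
  C := f.C + j * (2 * f.t + σ) + j ^ 2 * f.m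
  pos := f.pos
  eq := by linear_combination f.eq
  prim := by
    obtain ⟨x, y, z, h⟩ := f.prim
    refine ⟨x - 2 * j * y + j ^ 2 * z, y - j * z, z, ?_⟩
    linear_combination h

lemma Frm.cl_shift (f : Frm A σ) (j : ℤ) : (f.shift j).cl = f.cl := by
  refine HasNm.cl_congr _ _ ?_
  ext z
  rw [Frm.mem_idl, Frm.mem_idl, Frm.shift]
  simp only
  rw [show z.re - (f.t + j * f.m) * z.im = z.re - f.t * z.im - f.m * (j * z.im) by ring]
  exact dvd_sub_left (Dvd.intro _ rfl)

lemma Frm.four_mul (f : Frm A σ) :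
    4 * (f.m * f.C) = (2 * f.t + σ) ^ 2 - (σ ^ 2 + 4 * A) := by
  linear_combination 4 * f.eq

lemma Frm.C_pos (f : Frm A σ) : 0 < f.C := by
  have h := f.four_mul
  have h2 : 0 < f.m * f.C := by nlinarith [hD.out, sq_nonneg (2 * f.t + σ)]
  exact (mul_pos_iff_of_pos_left f.pos).1 h2

/-- Exchange of the outer coefficients. -/
def Frm.swap (f : Frm A σ) : Frm A σ where
  m := f.C
  t := -σ - f.t
  C := f.m
  pos := f.C_pos
  eq := by linear_combination f.eq
  prim := by
    obtain ⟨x, y, z, h⟩ := f.prim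
    exact ⟨z, -y, x, by linear_combination h⟩

lemma Frm.cl_swap (f : Frm A σ) : f.swap.cl = f.cl := by
  refine ((HasNm.cl_eq_iff _ _).2 ⟨⟨f.t + σ, -1⟩, f.m, ?_, intCast_ne_zero' f.pos, ?_⟩).symm
  · intro h
    have := congrArg QuadraticAlgebra.im h
    simp at this
  · ext z
    rw [Ideal.mem_span_singleton_mul, Ideal.mem_span_singleton_mul]
    constructor
    · rintro ⟨w, hw, rfl⟩
      obtain ⟨u, v, rfl⟩ := Frm.mem_idl_iff_exists.1 hw
      refine ⟨_, f.swap.elt_mem v (-u), ?_⟩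
      ext
      · simp [Frm.elt, Frm.swap]; linear_combination v * f.eq
      · simp [Frm.elt, Frm.swap]
        ring
    · rintro ⟨w, hw, rfl⟩
      obtain ⟨u, v, rfl⟩ := Frm.mem_idl_iff_exists.1 hw
      refine ⟨_, f.elt_mem (-v) u, ?_⟩
      ext
      · simp [Frm.elt, Frm.swap]; linear_combination (-u) * f.eq
      · simp [Frm.elt, Frm.swap]
        ring

lemma exists_reduced (c : Cl A σ) : ∃ f : Frm A σ, f.cl = c ∧ |2 * f.t + σ| ≤ f.m ∧
    f.m ≤ -(σ ^ 2 + 4 * A) := by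
  classical
  have hex : ∃ n : ℕ, ∃ f : Frm A σ, f.cl = c ∧ f.m = n := by
    obtain ⟨f, hf⟩ := exists_frm_cl c
    exact ⟨f.m.toNat, f, hf, (Int.toNat_of_nonneg f.pos.le).symm⟩
  obtain ⟨f, hfc, hfm⟩ := Nat.find_spec hex
  have hmin : ∀ g : Frm A σ, g.cl = c → f.m ≤ g.m := by
    intro g hg
    rw [hfm]
    have := Nat.find_min' hex ⟨g, hg, (Int.toNat_of_nonneg g.pos.le).symm⟩
    have h2 := Int.toNat_of_nonneg g.pos.le
    omega
  obtain ⟨j, hj⟩ : ∃ j : ℤ, |2 * (f.t + j * f.m) + σ| ≤ f.m := by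
    refine ⟨-((2 * f.t + σ + f.m) / (2 * f.m)), ?_⟩
    have h1 := Int.emod_add_mul_ediv (2 * f.t + σ + f.m) (2 * f.m)
    have h2 := Int.emod_nonneg (2 * f.t + σ + f.m) (b := 2 * f.m) (by have := f.pos; omega)
    have h3 := Int.emod_lt_of_pos (2 * f.t + σ + f.m) (b := 2 * f.m) (by have := f.pos; omega)
    rw [abs_le]
    constructor <;> nlinarith
  refine ⟨f.shift j, (f.cl_shift j).trans hfc, hj, ?_⟩
  have h1 : f.m ≤ (f.shift j).C :=
    hmin (f.shift j).swap (by rw [Frm.cl_swap, Frm.cl_shift, hfc])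
  have h2 := (f.shift j).four_mul
  change |2 * (f.shift j).t + σ| ≤ (f.shift j).m at hj
  have h3 := sq_le_sq' (abs_le.1 hj).1 (abs_le.1 hj).2
  change f.m ≤ _
  have hm : (f.shift j).m = f.m := rfl
  rw [hm] at h2 h3
  have := f.pos
  nlinarith

lemma Frm.ext' {f g : Frm A σ} (h1 : f.m = g.m) (h2 : f.t = g.t) : f = g := by
  have hC : f.C = g.C := by
    have := f.eq
    rw [h1, h2, ← g.eq] at this
    exact mul_left_cancel₀ g.pos.ne' this
  cases f; cases g; simp_all

instance : Finite (Cl A σ) := by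
  set N := |σ ^ 2 + 4 * A| + |σ|
  let S : Set (Frm A σ) := {f | f.m ∈ Set.Icc (-N) N ∧ f.t ∈ Set.Icc (-N) N}
  have hS : S.Finite := by
    refine Set.Finite.of_injOn (f := fun f : Frm A σ => (f.m, f.t))
      (t := Set.Icc (-N) N ×ˢ Set.Icc (-N) N) (fun f hf => hf) ?_
      ((Set.finite_Icc _ _).prod (Set.finite_Icc _ _))
    intro f _ g _ h
    simp only [Prod.mk.injEq] at h
    exact Frm.ext' h.1 h.2
  have : Finite S := hS
  refine Finite.of_surjective (fun f : S => f.1.cl) fun c => ?_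
  obtain ⟨f, hf, h1, h2⟩ := exists_reduced c
  have hpos := f.pos
  have hσ := abs_le.1 (le_refl |σ|)
  have hd := abs_of_neg hD.out
  rw [abs_le] at h1
  refine ⟨⟨f, ⟨?_, ?_⟩, ⟨?_, ?_⟩⟩, hf⟩ <;> · simp only [N]; rw [hd]; omega

end ClassGroup

/-- Positive integers all of whose prime factors satisfy `P`. -/
def Smooth (P : ℕ → Prop) (n : ℕ) : Prop := n ≠ 0 ∧ ∀ p, p.Prime → p ∣ n → P p

lemma smooth_one (P : ℕ → Prop) : Smooth P 1 :=
  ⟨one_ne_zero, fun _ hp h => absurd (Nat.dvd_one.1 h) hp.one_lt.ne'⟩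

lemma Smooth.mul {P : ℕ → Prop} {m n : ℕ} (hm : Smooth P m) (hn : Smooth P n) :
    Smooth P (m * n) :=
  ⟨mul_ne_zero hm.1 hn.1, fun p hp h => (hp.dvd_mul.1 h).elim (hm.2 p hp) (hn.2 p hp)⟩

lemma Smooth.of_dvd {P : ℕ → Prop} {m n : ℕ} (hn : Smooth P n) (h : m ∣ n) : Smooth P m :=
  ⟨ne_zero_of_dvd_ne_zero hn.1 h, fun p hp hpm => hn.2 p hp (hpm.trans h)⟩

lemma smooth_prime {P : ℕ → Prop} {p : ℕ} (hp : p.Prime) (h : P p) : Smooth P p :=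
  ⟨hp.ne_zero, fun q hq hqp => by rwa [(Nat.prime_dvd_prime_iff_eq hq hp).1 hqp]⟩

/-- Induction on smooth numbers. -/
@[elab_as_elim]
lemma Smooth.induction {P : ℕ → Prop} {motive : (n : ℕ) → Smooth P n → Prop}
    (one : motive 1 (smooth_one P))
    (mul : ∀ (p m : ℕ) (hp : p.Prime) (h : P p) (hm : Smooth P m), motive m hm →
      motive (p * m) ((smooth_prime hp h).mul hm)) {n : ℕ} (hn : Smooth P n) : motive n hn := by
  induction n using induction_on_primes with
  | zero => exact absurd rfl hn.1
  | one => exact one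
  | prime_mul p m hp ih =>
    exact mul p m hp (hn.2 p hp (Dvd.intro m rfl)) (hn.of_dvd (Dvd.intro_left p rfl))
      (ih (hn.of_dvd (Dvd.intro_left p rfl)))

section Good

variable (A σ : ℤ)

/-- Primes which split in the order. -/
def SplitP (p : ℕ) : Prop :=
  p.Prime ∧ ¬ (p : ℤ) ∣ σ ^ 2 + 4 * A ∧ ∃ t : ℤ, (p : ℤ) ∣ t ^ 2 + σ * t - A

/-- Primes which are inert in the order. -/
def InertP (p : ℕ) : Prop :=
  p.Prime ∧ ¬ (p : ℤ) ∣ σ ^ 2 + 4 * A ∧ ¬ ∃ t : ℤ, (p : ℤ) ∣ t ^ 2 + σ * t - A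

variable [hD : Fact (σ ^ 2 + 4 * A < 0)]

local notation "𝓡" => QuadraticAlgebra ℤ A σ

variable {A σ}

lemma SplitP.exists_frm {p : ℕ} (h : SplitP A σ p) : ∃ f : Frm A σ, f.m = p := by
  obtain ⟨hp, hpD, t, C, ht⟩ := h
  refine ⟨⟨p, t, C, by exact_mod_cast hp.pos, ht.symm, ?_⟩, rfl⟩
  have hcop : IsCoprime (p : ℤ) (2 * t + σ) := by
    rw [Prime.coprime_iff_not_dvd (Nat.prime_iff_prime_int.1 hp)]
    rintro ⟨s, hs⟩
    exact hpD ⟨p * s ^ 2 - 4 * C, by linear_combination (p * s + 2 * t + σ) * hs - 4 * ht⟩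
  obtain ⟨x, y, h⟩ := hcop
  exact ⟨x, y, 0, by linear_combination h⟩

/-- A prime ideal above a split prime, as a form. -/
noncomputable def SplitP.frm {p : ℕ} (h : SplitP A σ p) : Frm A σ := h.exists_frm.choose

lemma SplitP.frm_m {p : ℕ} (h : SplitP A σ p) : h.frm.m = p := h.exists_frm.choose_spec

lemma Frm.mul_mem_idl_iff {f : Frm A σ} {z w : 𝓡} :
    z * w ∈ f.idl ↔ f.m ∣ (z.re - f.t * z.im) * (w.re - f.t * w.im) := by
  rw [Frm.mem_idl, ← dvd_add_left (Dvd.intro _ rfl : f.m ∣ f.m * (f.C * (z.im * w.im)))]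
  have e : (z * w).re - f.t * (z * w).im + f.m * (f.C * (z.im * w.im)) =
      (z.re - f.t * z.im) * (w.re - f.t * w.im) := by
    simp only [QuadraticAlgebra.re_mul, QuadraticAlgebra.im_mul]
    linear_combination z.im * w.im * f.eq
  rw [e]

lemma SplitP.isPrime {p : ℕ} (h : SplitP A σ p) : h.frm.idl.IsPrime := by
  have hp := Nat.prime_iff_prime_int.1 h.1
  refine ⟨?_, ?_⟩
  · rw [Ne, Ideal.eq_top_iff_one, Frm.mem_idl, h.frm_m]
    change ¬ (p : ℤ) ∣ 1 - _ * 0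
    simpa using hp.not_dvd_one
  · intro z w hzw
    rw [Frm.mul_mem_idl_iff, h.frm_m] at hzw
    rw [Frm.mem_idl, Frm.mem_idl, h.frm_m]
    exact hp.dvd_or_dvd hzw

open Classical in
/-- A prime ideal above `p`, when `p` splits. -/
noncomputable def primeI (p : ℕ) : InvI A σ :=
  if h : SplitP A σ p then ⟨h.frm.idl, h.frm.hasNm.mem⟩ else 1

lemma primeI_eq {p : ℕ} (h : SplitP A σ p) : (primeI p : InvI A σ).1 = h.frm.idl := by
  rw [primeI, dif_pos h]

variable (A σ) in
/-- The product of the chosen prime ideals above the prime factors of `n`. -/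
noncomputable def aI (n : ℕ) : InvI A σ := n.factorization.prod fun p k => primeI p ^ k

lemma aI_mul {m n : ℕ} (hm : m ≠ 0) (hn : n ≠ 0) : aI A σ (m * n) = aI A σ m * aI A σ n := by
  rw [aI, Nat.factorization_mul hm hn]
  exact Finsupp.prod_add_index' (fun p => pow_zero _) fun p => pow_add _

lemma aI_one : aI A σ 1 = 1 := by simp [aI]

lemma aI_prime {p : ℕ} (hp : p.Prime) : aI A σ p = primeI p := by
  rw [aI, hp.factorization]
  exact (Finsupp.prod_single_index (h := fun p k => primeI p ^ k) (pow_zero _)).trans (pow_one _)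

lemma coe_aI_mul {m n : ℕ} (hm : m ≠ 0) (hn : n ≠ 0) :
    (aI A σ (m * n)).1 = (aI A σ m).1 * (aI A σ n).1 := by rw [aI_mul hm hn]; rfl

lemma aI_split_mul {p m : ℕ} (h : SplitP A σ p) (hm : m ≠ 0) :
    (aI A σ (p * m)).1 = h.frm.idl * (aI A σ m).1 := by
  rw [coe_aI_mul h.1.ne_zero hm, aI_prime h.1, primeI_eq h]

lemma hasNm_aI {n : ℕ} (hn : Smooth (SplitP A σ) n) : HasNm (aI A σ n).1 n := by
  induction hn using Smooth.induction with
  | one => rw [aI_one]; exact_mod_cast hasNm_one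
  | mul p m hp h hm ih =>
    rw [aI_split_mul h hm.1]
    push_cast
    rw [← h.frm_m]
    exact h.frm.hasNm.mul ih

variable (A σ) in
/-- The class of `aI n`. -/
noncomputable def gam (n : ℕ) : Cl A σ := (aI A σ n : InvI A σ)

lemma gam_mul {m n : ℕ} (hm : m ≠ 0) (hn : n ≠ 0) : gam A σ (m * n) = gam A σ m * gam A σ n := by
  rw [gam, aI_mul hm hn]; rfl

/-- The ideal `𝔞(a) · conj 𝔞(b) · (k)`. -/
noncomputable def tripI (a b k : ℕ) : Ideal 𝓡 :=
  (aI A σ a).1 * ((aI A σ b).1.map cj * Ideal.span {((k : ℤ) : 𝓡)})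

lemma hasNm_tripI {a b k : ℕ} (ha : Smooth (SplitP A σ) a) (hb : Smooth (SplitP A σ) b)
    (hk : 0 < k) : HasNm (tripI a b k : Ideal 𝓡) ((a * b * k ^ 2 : ℕ) : ℤ) := by
  have := (hasNm_aI ha).mul ((hasNm_aI hb).conj.mul (hasNm_span_int (n := k) (by exact_mod_cast hk)))
  push_cast
  rw [mul_assoc]
  exact this

lemma cl_tripI {a b k : ℕ} (ha : Smooth (SplitP A σ) a) (hb : Smooth (SplitP A σ) b)
    (hk : 0 < k) : (hasNm_tripI ha hb hk).cl = gam A σ a * (gam A σ b)⁻¹ := by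
  have hk' : (0 : ℤ) < k := by exact_mod_cast hk
  have h1 := (hasNm_aI ha).cl_mul ((hasNm_aI hb).conj.mul (hasNm_span_int hk'))
  have h2 := (hasNm_aI hb).conj.cl_mul (hasNm_span_int hk')
  have h3 : (hasNm_span_int (A := A) (σ := σ) hk').cl = 1 :=
    (HasNm.cl_eq_one_iff _).2 ⟨_, intCast_ne_zero' hk', rfl⟩
  rw [h3, mul_one, (hasNm_aI hb).cl_conj] at h2
  rw [h2] at h1
  exact h1

lemma HasNm.dvd_of_le {I K : Ideal 𝓡} {m n : ℤ} (hI : HasNm I m) (hK : HasNm K n) (h : I ≤ K) :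
    n ∣ m := by
  obtain ⟨J, rfl⟩ := hK.dvd h
  obtain ⟨l, hl, -⟩ := hK.of_mul hI
  exact ⟨l, hl⟩

lemma SplitP.conj_not_le {p : ℕ} (h : SplitP A σ p) : ¬ h.frm.idl.map cj ≤ h.frm.idl := by
  intro hle
  rw [Frm.map_cj_idl] at hle
  have h1 := hle (h.frm.conj.elt_mem 0 1)
  rw [Frm.mem_idl, h.frm_m] at h1
  obtain ⟨s, hs⟩ := h1
  simp only [Frm.elt, Frm.conj] at hs
  have he := h.frm.eq
  rw [h.frm_m] at he
  exact h.2.1 ⟨p * s ^ 2 - 4 * h.frm.C, by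
    linear_combination (-2 * h.frm.t - σ + p * s) * hs + 4 * he⟩

lemma SplitP.eq_of_le {p q : ℕ} (h : SplitP A σ p) {J : Ideal 𝓡} (hJ : HasNm J q)
    (hq : q.Prime) (hle : J ≤ h.frm.idl) : q = p := by
  have := hJ.dvd_of_le h.frm.hasNm hle
  rw [h.frm_m] at this
  exact ((Nat.prime_dvd_prime_iff_eq h.1 hq).1 (by exact_mod_cast this)).symm

lemma SplitP.dvd_of_aI_le {p a : ℕ} (h : SplitP A σ p) (ha : Smooth (SplitP A σ) a)
    (hle : (aI A σ a).1 ≤ h.frm.idl) : p ∣ a := by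
  induction ha using Smooth.induction with
  | one =>
    rw [aI_one, Submonoid.coe_one, Ideal.one_eq_top] at hle
    exact absurd (top_le_iff.1 hle) h.isPrime.ne_top
  | mul q m hq hq' hm ih =>
    rw [aI_split_mul hq' hm.1, h.isPrime.mul_le] at hle
    rcases hle with hle | hle
    · rw [h.eq_of_le (hq'.frm_m ▸ hq'.frm.hasNm) hq hle]
      exact Dvd.intro _ rfl
    · exact (ih hle).mul_left _

lemma SplitP.not_aI_conj_le {p b : ℕ} (h : SplitP A σ p) (hb : Smooth (SplitP A σ) b) :
    ¬ (aI A σ b).1.map cj ≤ h.frm.idl := by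
  induction hb using Smooth.induction with
  | one =>
    rw [aI_one, Submonoid.coe_one, Ideal.one_eq_top, Ideal.map_top]
    exact fun hle => absurd (top_le_iff.1 hle) h.isPrime.ne_top
  | mul q m hq hq' hm ih =>
    rw [aI_split_mul hq' hm.1, Ideal.map_mul, h.isPrime.mul_le]
    rintro (hle | hle)
    · obtain rfl := h.eq_of_le (hq'.frm_m ▸ hq'.frm.hasNm.conj) hq hle
      exact h.conj_not_le hle
    · exact ih hle

lemma SplitP.dvd_of_tripI_le {p a b k : ℕ} (h : SplitP A σ p) (ha : Smooth (SplitP A σ) a)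
    (hb : Smooth (SplitP A σ) b) (hk : Smooth (InertP A σ) k)
    (hle : (tripI a b k : Ideal 𝓡) ≤ h.frm.idl) : p ∣ a := by
  rw [tripI, h.isPrime.mul_le, h.isPrime.mul_le] at hle
  rcases hle with hle | hle | hle
  · exact h.dvd_of_aI_le ha hle
  · exact absurd hle (h.not_aI_conj_le hb)
  · have h1 := (hasNm_span_int (A := A) (σ := σ) (n := k)
      (by exact_mod_cast Nat.pos_of_ne_zero hk.1)).dvd_of_le h.frm.hasNm hle
    rw [h.frm_m] at h1
    have h2 : p ∣ k := h.1.dvd_of_dvd_pow (n := 2) (by exact_mod_cast h1)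
    exact absurd h.2.2 (hk.2 p h.1 h2).2.2

lemma tripI_split_mul {p a b k : ℕ} (h : SplitP A σ p) (ha : a ≠ 0) :
    (tripI (p * a) b k : Ideal 𝓡) = h.frm.idl * tripI a b k := by
  rw [tripI, tripI, aI_split_mul h ha, mul_assoc]

lemma tripI_inj_left {a b k a' b' k' : ℕ} (ha : Smooth (SplitP A σ) a)
    (hb : Smooth (SplitP A σ) b) (hk : Smooth (InertP A σ) k) (ha' : Smooth (SplitP A σ) a')
    (hb' : Smooth (SplitP A σ) b') (hk' : Smooth (InertP A σ) k')
    (e : (tripI a b k : Ideal 𝓡) = tripI a' b' k') : a = a' := by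
  induction ha using Smooth.induction generalizing a' with
  | one =>
    by_contra hne
    obtain ⟨p, hp, hpa⟩ := Nat.exists_prime_and_dvd (Ne.symm hne)
    have h := ha'.2 p hp hpa
    obtain ⟨c, rfl⟩ := hpa
    rw [tripI_split_mul h (ha'.of_dvd (Dvd.intro_left p rfl)).1] at e
    have := h.dvd_of_tripI_le (smooth_one _) hb hk (e.le.trans Ideal.mul_le_left)
    exact hp.one_lt.ne' (Nat.dvd_one.1 this)
  | mul p m hp h hm ih =>
    rw [tripI_split_mul h hm.1] at e
    obtain ⟨c, rfl⟩ := h.dvd_of_tripI_le ha' hb' hk' (e.ge.trans Ideal.mul_le_left)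
    have hc := ha'.of_dvd (Dvd.intro_left p rfl)
    rw [tripI_split_mul h hc.1] at e
    rw [ih hc (h.frm.hasNm.cancel e)]

lemma tripI_inj {a b k a' b' k' : ℕ} (ha : Smooth (SplitP A σ) a)
    (hb : Smooth (SplitP A σ) b) (hk : Smooth (InertP A σ) k) (ha' : Smooth (SplitP A σ) a')
    (hb' : Smooth (SplitP A σ) b') (hk' : Smooth (InertP A σ) k')
    (e : (tripI a b k : Ideal 𝓡) = tripI a' b' k') : a = a' ∧ b = b' ∧ k = k' := by
  obtain rfl := tripI_inj_left ha hb hk ha' hb' hk' e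
  have e2 := (hasNm_aI ha).cancel e
  have e3 : (tripI b 1 k : Ideal 𝓡) = tripI b' 1 k' := by
    have := congrArg (fun J => J.map cj) e2
    simp only [Ideal.map_mul, map_cj_map_cj, map_cj_span_int] at this
    rw [tripI, tripI, aI_one, Submonoid.coe_one, Ideal.one_eq_top, Ideal.map_top, Ideal.top_mul,
      Ideal.top_mul, this]
  obtain rfl := tripI_inj_left hb (smooth_one _) hk hb' (smooth_one _) hk' e3
  have e4 := (hasNm_aI hb).conj.cancel e2
  refine ⟨rfl, rfl, ?_⟩
  have hk0 : (0 : ℤ) < k := by exact_mod_cast Nat.pos_of_ne_zero hk.1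
  have hk0' : (0 : ℤ) < k' := by exact_mod_cast Nat.pos_of_ne_zero hk'.1
  have := (hasNm_span_int (A := A) (σ := σ) hk0).unique (e4 ▸ hasNm_span_int hk0')
  exact_mod_cast (pow_left_inj₀ hk0.le hk0'.le two_ne_zero).1 this

lemma InertP.dvd {p : ℕ} (hp : InertP A σ p) {J : Ideal 𝓡} {n : ℤ} (hJ : HasNm J n)
    (h : (p : ℤ) ∣ n) : J ≤ Ideal.span {((p : ℤ) : 𝓡)} := by
  obtain ⟨k, f, hk, hJ', hn, -⟩ := hJ.exists_frm
  have hpp := Nat.prime_iff_prime_int.1 hp.1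
  have : (p : ℤ) ∣ k := by
    rw [hn] at h
    rcases hpp.dvd_or_dvd h with h | ⟨s, hs⟩
    · exact hpp.dvd_of_dvd_pow h
    · exact absurd ⟨f.t, s * f.C, by rw [← f.eq, hs]; ring⟩ hp.2.2
  rw [hJ']
  exact Ideal.mul_le_left.trans (span_intCast_le.2 this)

lemma SplitP.le_or_le {p : ℕ} (hp : SplitP A σ p) {J : Ideal 𝓡} {n : ℤ} (hJ : HasNm J n)
    (h : (p : ℤ) ∣ n) : J ≤ hp.frm.idl ∨ J ≤ hp.frm.idl.map cj := by
  obtain ⟨k, f, hk, hJ', hn, -⟩ := hJ.exists_frm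
  have hpp := Nat.prime_iff_prime_int.1 hp.1
  rw [hn] at h
  rcases hpp.dvd_or_dvd h with h | ⟨s, hs⟩
  · left
    rw [hJ']
    refine Ideal.mul_le_left.trans ((span_intCast_le.2 (hpp.dvd_of_dvd_pow h)).trans ?_)
    rw [← hp.frm_m, ← hp.frm.idl_mul_conj]
    exact Ideal.mul_le_left
  · have h1 : (p : ℤ) ∣ (f.t - hp.frm.t) * (f.t + hp.frm.t + σ) := by
      have e1 := f.eq
      have e2 := hp.frm.eq
      rw [hp.frm_m] at e2
      exact ⟨s * f.C - hp.frm.C, by rw [hs] at e1; linear_combination e2 - e1⟩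
    rw [hJ']
    rcases hpp.dvd_or_dvd h1 with ⟨r, hr⟩ | ⟨r, hr⟩
    · left
      refine Ideal.mul_le_right.trans fun z hz => ?_
      obtain ⟨u, hu⟩ := hz
      rw [Frm.mem_idl, hp.frm_m]
      exact ⟨s * u + r * z.im, by rw [hs] at hu; linear_combination hu + z.im * hr⟩
    · right
      rw [Frm.map_cj_idl]
      refine Ideal.mul_le_right.trans fun z hz => ?_
      obtain ⟨u, hu⟩ := hz
      rw [Frm.mem_idl, show hp.frm.conj.m = p from hp.frm_m]
      change _ ∣ z.re - (-σ - hp.frm.t) * z.im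
      exact ⟨s * u + r * z.im, by rw [hs] at hu; linear_combination hu + z.im * hr⟩

lemma exists_tripI {J : Ideal 𝓡} {n : ℕ} (hJ : HasNm J n)
    (hn : ∀ p : ℕ, p.Prime → (p : ℤ) ∣ σ ^ 2 + 4 * A → ¬ p ∣ n) :
    ∃ a b k, Smooth (SplitP A σ) a ∧ Smooth (SplitP A σ) b ∧ Smooth (InertP A σ) k ∧
      J = tripI a b k ∧ n = a * b * k ^ 2 := by
  induction n using Nat.strong_induction_on generalizing J with
  | _ n ih =>
  by_cases h1 : n = 1
  · subst h1
    refine ⟨1, 1, 1, smooth_one _, smooth_one _, smooth_one _, ?_, rfl⟩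
    rw [tripI, aI_one, Submonoid.coe_one, Ideal.one_eq_top, Ideal.map_top]
    have h2 := hJ.2
    simp only [Nat.cast_one, Int.cast_one, Ideal.span_singleton_one] at h2 ⊢
    rw [Ideal.top_mul, Ideal.top_mul]
    exact top_le_iff.1 (h2 ▸ Ideal.mul_le_left)
  have hn0 : n ≠ 0 := by have := hJ.1; omega
  obtain ⟨p, hp, hpn⟩ := Nat.exists_prime_and_dvd h1
  have hpD : ¬ (p : ℤ) ∣ σ ^ 2 + 4 * A := fun h => hn p hp h hpn
  have key : ∀ {I K : Ideal 𝓡} {m : ℕ}, HasNm I m → 1 < m → J = I * K →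
      ∃ l, n = m * l ∧ HasNm K l ∧ l < n ∧
      ∀ p : ℕ, p.Prime → (p : ℤ) ∣ σ ^ 2 + 4 * A → ¬ p ∣ l := by
    intro I K m hI hm hJK
    obtain ⟨l, hl, hK⟩ := hI.of_mul (hJK ▸ hJ)
    lift l to ℕ using hK.1.le
    have hl' : n = m * l := by exact_mod_cast hl
    refine ⟨l, hl', hK, ?_, fun q hq hqD hql => hn q hq hqD (hl' ▸ hql.mul_left m)⟩
    have : 0 < l := by exact_mod_cast hK.1
    nlinarith
  by_cases hs : SplitP A σ p
  · have hm : HasNm hs.frm.idl p := hs.frm_m ▸ hs.frm.hasNm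
    rcases hs.le_or_le hJ (by exact_mod_cast hpn) with hle | hle
    · obtain ⟨K, hK⟩ := hm.dvd hle
      obtain ⟨l, hnl, hKl, hln, hl⟩ := key hm hp.one_lt hK
      obtain ⟨a, b, k, ha, hb, hk, hKt, hlt⟩ := ih l hln hKl hl
      refine ⟨p * a, b, k, (smooth_prime hp hs).mul ha, hb, hk, ?_, ?_⟩
      · rw [hK, hKt, tripI_split_mul hs ha.1]
      · rw [hnl, hlt]; ring
    · obtain ⟨K, hK⟩ := hm.conj.dvd hle
      obtain ⟨l, hnl, hKl, hln, hl⟩ := key hm.conj hp.one_lt hK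
      obtain ⟨a, b, k, ha, hb, hk, hKt, hlt⟩ := ih l hln hKl hl
      refine ⟨a, p * b, k, ha, (smooth_prime hp hs).mul hb, hk, ?_, ?_⟩
      · rw [hK, hKt, tripI, tripI, aI_split_mul hs hb.1, Ideal.map_mul]; ac_rfl
      · rw [hnl, hlt]; ring
  · have hi : InertP A σ p := ⟨hp, hpD, fun ⟨t, ht⟩ => hs ⟨hp, hpD, t, ht⟩⟩
    have hm : HasNm (Ideal.span {((p : ℤ) : 𝓡)}) ((p ^ 2 : ℕ) : ℤ) := by
      push_cast; exact hasNm_span_int (by exact_mod_cast hp.pos)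
    obtain ⟨K, hK⟩ := hm.dvd (hi.dvd hJ (by exact_mod_cast hpn))
    obtain ⟨l, hnl, hKl, hln, hl⟩ := key hm (Nat.one_lt_pow two_ne_zero hp.one_lt) hK
    obtain ⟨a, b, k, ha, hb, hk, hKt, hlt⟩ := ih l hln hKl hl
    refine ⟨a, b, p * k, ha, hb, (smooth_prime hp hi).mul hk, ?_, ?_⟩
    · rw [hK, hKt, tripI, tripI]
      push_cast
      rw [← Ideal.span_singleton_mul_span_singleton]
      ac_rfl
    · rw [hnl, hlt]; ring

end Good

section Count

variable {A σ : ℤ} [hD : Fact (σ ^ 2 + 4 * A < 0)]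

local notation "𝓡" => QuadraticAlgebra ℤ A σ

variable (A σ) in
/-- Triples `(a, b, k)` of a given class. -/
def Trip (c : Cl A σ) : Set (ℕ × ℕ × ℕ) :=
  {T | Smooth (SplitP A σ) T.1 ∧ Smooth (SplitP A σ) T.2.1 ∧ Smooth (InertP A σ) T.2.2 ∧
    gam A σ T.1 * (gam A σ T.2.1)⁻¹ = c}

/-- The value `a b k²` of a triple. -/
def tval (T : ℕ × ℕ × ℕ) : ℕ := T.1 * T.2.1 * T.2.2 ^ 2

lemma norm_isUnit {z : 𝓡} (h : IsUnit z) : z.norm = 1 := by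
  have h1 : IsUnit z.norm := h.map QuadraticAlgebra.norm
  rcases Int.isUnit_iff.1 h1 with h | h
  · exact h
  · have := norm_nonneg' z; omega

lemma Frm.elt_injective (f : Frm A σ) : Function.Injective fun p : ℤ × ℤ => f.elt p.1 p.2 := by
  rintro ⟨u, v⟩ ⟨u', v'⟩ h
  have h1 : f.m * u + f.t * v = f.m * u' + f.t * v' := congrArg QuadraticAlgebra.re h
  have h2 : v = v' := congrArg QuadraticAlgebra.im h
  subst h2
  have h3 : u = u' := mul_left_cancel₀ f.pos.ne' (by linarith)
  rw [h3]

lemma Frm.exists_gen (f : Frm A σ) {T : ℕ × ℕ × ℕ} (hT : T ∈ Trip A σ f.cl⁻¹) :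
    ∃ z : 𝓡, z ≠ 0 ∧ f.idl * tripI T.1 T.2.1 T.2.2 = Ideal.span {z} := by
  obtain ⟨h1, h2, h3, h4⟩ := hT
  have := f.hasNm.mul (hasNm_tripI h1 h2 (Nat.pos_of_ne_zero h3.1))
  refine this.cl_eq_one_iff.1 ?_
  rw [HasNm.cl_mul f.hasNm (hasNm_tripI h1 h2 (Nat.pos_of_ne_zero h3.1)), cl_tripI h1 h2 (Nat.pos_of_ne_zero h3.1), h4]
  exact mul_inv_cancel f.cl

lemma Frm.norm_gen (f : Frm A σ) {T : ℕ × ℕ × ℕ} (hT : T ∈ Trip A σ f.cl⁻¹) {z : 𝓡} (hz : z ≠ 0)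
    (h : f.idl * tripI T.1 T.2.1 T.2.2 = Ideal.span {z}) : z.norm = f.m * tval T :=
  (hasNm_span hz).unique (h ▸ f.hasNm.mul (hasNm_tripI hT.1 hT.2.1 (Nat.pos_of_ne_zero hT.2.2.1.1)))

/-- The number of representations of `n` coprime to the discriminant. -/
lemma Frm.card_rep (f : Frm A σ) {n : ℕ} (hn0 : n ≠ 0)
    (hn : ∀ p : ℕ, p.Prime → (p : ℤ) ∣ σ ^ 2 + 4 * A → ¬ p ∣ n) :
    Nat.card {p : ℤ × ℤ // f.val p.1 p.2 = n} =
      Nat.card 𝓡ˣ * Nat.card {T : ℕ × ℕ × ℕ // T ∈ Trip A σ f.cl⁻¹ ∧ tval T = n} := by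
  let S := {z : 𝓡 // z ∈ f.idl ∧ z.norm = f.m * n}
  have e1 : Nat.card {p : ℤ × ℤ // f.val p.1 p.2 = n} = Nat.card S := by
    refine Nat.card_congr (Equiv.ofBijective
      (fun p => ⟨f.elt p.1.1 p.1.2, f.elt_mem _ _, by rw [f.norm_elt, p.2]⟩) ⟨?_, ?_⟩)
    · intro p q h
      exact Subtype.ext (f.elt_injective (congrArg Subtype.val h))
    · rintro ⟨z, hz, hzn⟩
      obtain ⟨u, v, rfl⟩ := Frm.mem_idl_iff_exists.1 hz
      rw [f.norm_elt] at hzn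
      exact ⟨⟨(u, v), mul_left_cancel₀ f.pos.ne' hzn⟩, rfl⟩
  rw [e1, ← Nat.card_prod]
  choose g hg0 hg using fun T : {T : ℕ × ℕ × ℕ // T ∈ Trip A σ f.cl⁻¹ ∧ tval T = n} =>
    f.exists_gen T.2.1
  have hgS : ∀ x : 𝓡ˣ × {T : ℕ × ℕ × ℕ // T ∈ Trip A σ f.cl⁻¹ ∧ tval T = n},
      g x.2 * x.1 ∈ f.idl ∧ (g x.2 * x.1).norm = f.m * n := fun x => by
    refine ⟨?_, by
      rw [map_mul, norm_isUnit x.1.isUnit, mul_one, f.norm_gen x.2.2.1 (hg0 _) (hg _), x.2.2.2]⟩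
    have : g x.2 ∈ f.idl * tripI x.2.1.1 x.2.1.2.1 x.2.1.2.2 := by
      rw [hg]; exact Ideal.mem_span_singleton_self _
    exact Ideal.mul_mem_right _ _ (Ideal.mul_le_left this)
  refine (Nat.card_congr (Equiv.ofBijective (fun x => (⟨g x.2 * x.1, hgS x⟩ : S)) ⟨?_, ?_⟩)).symm
  · rintro ⟨ε, T⟩ ⟨ε', T'⟩ h
    have h1 : g T * ε = g T' * ε' := congrArg Subtype.val h
    have h2 : Ideal.span {g T} = Ideal.span {g T'} := by
      rw [Ideal.span_singleton_eq_span_singleton]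
      exact ⟨ε * ε'⁻¹, by rw [Units.val_mul, ← mul_assoc, h1, mul_assoc, Units.mul_inv, mul_one]⟩
    rw [← hg, ← hg] at h2
    have h3 := f.hasNm.cancel h2
    obtain ⟨a1, a2, a3, -⟩ := T.2.1
    obtain ⟨b1, b2, b3, -⟩ := T'.2.1
    obtain ⟨c1, c2, c3⟩ := tripI_inj a1 a2 a3 b1 b2 b3 h3
    have hT : T = T' := Subtype.ext (Prod.ext c1 (Prod.ext c2 c3))
    subst hT
    have hε : ε = ε' := Units.ext (mul_left_cancel₀ (hg0 T) h1)
    rw [hε]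
  · rintro ⟨z, hz, hzn⟩
    have hz0 : z ≠ 0 := by
      rintro rfl
      rw [norm_eq_zero'.2 rfl] at hzn
      have := f.pos
      have : (n : ℤ) = 0 := by
        rcases mul_eq_zero.1 hzn.symm with h | h
        · omega
        · exact h
      exact hn0 (by exact_mod_cast this)
    obtain ⟨K, l, hK, hzK, hl, hc⟩ := f.hasNm.exists_of_mem hz hz0
    obtain rfl : l = n := mul_left_cancel₀ f.pos.ne' (hl.symm.trans hzn)
    obtain ⟨a, b, k, ha, hb, hk, hKt, hnt⟩ := exists_tripI hK hn
    have hT : ((a, b, k) : ℕ × ℕ × ℕ) ∈ Trip A σ f.cl⁻¹ := by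
      refine ⟨ha, hb, hk, ?_⟩
      rw [← cl_tripI ha hb (Nat.pos_of_ne_zero hk.1)]
      exact (HasNm.cl_congr _ _ hKt.symm).trans hc
    let T : {T : ℕ × ℕ × ℕ // T ∈ Trip A σ f.cl⁻¹ ∧ tval T = n} := ⟨(a, b, k), hT, hnt.symm⟩
    have h1 : Ideal.span {g T} = Ideal.span {z} := by rw [← hg T, hzK, hKt]
    obtain ⟨ε, hε⟩ := Ideal.span_singleton_eq_span_singleton.1 h1
    exact ⟨(ε, T), Subtype.ext hε⟩

lemma Frm.exists_val_of_trip (f : Frm A σ) {T : ℕ × ℕ × ℕ} (hT : T ∈ Trip A σ f.cl⁻¹) :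
    ∃ u v, f.val u v = tval T := by
  obtain ⟨z, hz, h⟩ := f.exists_gen hT
  have h1 := f.norm_gen hT hz h
  have h2 : z ∈ f.idl := Ideal.mul_le_left (h ▸ Ideal.mem_span_singleton_self z)
  obtain ⟨u, v, rfl⟩ := Frm.mem_idl_iff_exists.1 h2
  rw [f.norm_elt] at h1
  exact ⟨u, v, mul_left_cancel₀ f.pos.ne' h1⟩

/-- Every class contains a form whose first coefficient divides a given nonzero value of
a given form in the class. -/
lemma Frm.exists_m_dvd_val (f : Frm A σ) {u v : ℤ} (h : f.val u v ≠ 0) :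
    ∃ g : Frm A σ, g.cl = f.cl ∧ g.m ∣ f.val u v := by
  have hz0 : f.elt u v ≠ 0 := by
    intro h0
    have := f.norm_elt u v
    rw [h0, norm_eq_zero'.2 rfl] at this
    exact h ((mul_eq_zero.1 this.symm).resolve_left f.pos.ne')
  obtain ⟨K, l, hK, hzK, hl, hc⟩ := f.hasNm.exists_of_mem (f.elt_mem u v) hz0
  obtain rfl : f.val u v = l := mul_left_cancel₀ f.pos.ne' ((f.norm_elt u v).symm.trans hl)
  obtain ⟨k, g, -, -, hn, hg⟩ := hK.exists_frm
  refine ⟨g.conj, ?_, k ^ 2, by rw [hn]; simp [Frm.conj]; ring⟩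
  rw [Frm.cl_conj, hg, hc]
  exact inv_inv _

instance : Finite 𝓡ˣ := by
  refine Finite.of_injective (β := Set.Icc (-(σ ^ 2 + 8)) (σ ^ 2 + 8) ×ˢ Set.Icc (-2 : ℤ) 2)
    (fun z => ⟨(z.1.re, z.1.im), ?_⟩) ?_
  · have h := four_mul_norm z.1
    rw [norm_isUnit z.isUnit] at h
    have hi : z.1.im ^ 2 ≤ 2 ^ 2 := by
      nlinarith [sq_nonneg (2 * z.1.re + σ * z.1.im), sq_nonneg z.1.im, hD.out]
    have hi2 := abs_le.1 (abs_le_of_sq_le_sq hi (by norm_num))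
    have h2 : (2 * z.1.re + σ * z.1.im) ^ 2 ≤ 2 ^ 2 := by
      nlinarith [sq_nonneg z.1.im, hD.out]
    have h3 := abs_le.1 (abs_le_of_sq_le_sq h2 (by norm_num))
    refine ⟨⟨?_, ?_⟩, hi2⟩ <;> simp only <;>
      nlinarith [sq_nonneg (σ + z.1.im), sq_nonneg (σ - z.1.im), sq_nonneg σ]
  · intro z w h
    have := congrArg Subtype.val h
    simp only [Prod.mk.injEq] at this
    exact Units.ext (QuadraticAlgebra.ext this.1 this.2)

lemma card_units_pos : 0 < Nat.card 𝓡ˣ := Nat.card_pos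

lemma card_units_le_two (h : σ ^ 2 + 4 * A < -4) : Nat.card 𝓡ˣ ≤ 2 := by
  rw [← show Nat.card ({1, -1} : Finset ℤ) = 2 by rw [Nat.card_eq_fintype_card, Fintype.card_coe]; rfl]
  refine Nat.card_le_card_of_injective
    (fun z => (⟨z.1.re, ?_⟩ : ({1, -1} : Finset ℤ))) ?_ <;>
  have key : ∀ z : 𝓡ˣ, z.1.im = 0 := by
    intro z
    have h1 := four_mul_norm z.1
    rw [norm_isUnit z.isUnit] at h1
    by_contra h0
    have : 0 < z.1.im ^ 2 := by positivity
    nlinarith [sq_nonneg (2 * z.1.re + σ * z.1.im)]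
  · have h1 := four_mul_norm z.1
    rw [norm_isUnit z.isUnit, key] at h1
    have : z.1.re ^ 2 = 1 := by linarith
    rcases sq_eq_one_iff.1 this with h | h <;> simp [h]
  · intro z w h
    exact Units.ext (QuadraticAlgebra.ext (congrArg Subtype.val h) ((key z).trans (key w).symm))

lemma card_units_le_four (h : σ ^ 2 + 4 * A = -4) : Nat.card 𝓡ˣ ≤ 4 := by
  obtain ⟨τ, hτ⟩ : 2 ∣ σ := Int.prime_two.dvd_of_dvd_pow (n := 2) ⟨-2 - 2 * A, by linarith⟩
  have hcard : Nat.card ({(1, 0), (-1, 0), (0, 1), (0, -1)} : Finset (ℤ × ℤ)) = 4 := by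
    rw [Nat.card_eq_fintype_card, Fintype.card_coe]; rfl
  rw [← hcard]
  have key : ∀ z : 𝓡ˣ, (z.1.re + τ * z.1.im, z.1.im) ∈
      ({(1, 0), (-1, 0), (0, 1), (0, -1)} : Finset (ℤ × ℤ)) := by
    intro z
    have h1 := four_mul_norm z.1
    rw [norm_isUnit z.isUnit, h] at h1
    have h2 : (z.1.re + τ * z.1.im) ^ 2 + z.1.im ^ 2 = 1 := by
      have : 4 * ((z.1.re + τ * z.1.im) ^ 2 + z.1.im ^ 2) = 4 * 1 := by
        linear_combination -h1 - z.1.im * (4 * z.1.re + (2 * τ + σ) * z.1.im) * hτ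
      linarith
    have h3 := abs_le.1 (abs_le_of_sq_le_sq (a := z.1.im) (b := 1)
      (by nlinarith [sq_nonneg (z.1.re + τ * z.1.im)]) (by norm_num))
    have h4 := abs_le.1 (abs_le_of_sq_le_sq (a := z.1.re + τ * z.1.im) (b := 1)
      (by nlinarith [sq_nonneg z.1.im]) (by norm_num))
    generalize z.1.re + τ * z.1.im = x at *
    generalize z.1.im = y at *
    obtain ⟨h31, h32⟩ := h3
    obtain ⟨h41, h42⟩ := h4
    interval_cases y <;> interval_cases x <;> simp_all
  refine Nat.card_le_card_of_injective (fun z => ⟨_, key z⟩) fun z w h => ?_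
  have h1 := congrArg Subtype.val h
  simp only [Prod.mk.injEq] at h1
  refine Units.ext (QuadraticAlgebra.ext ?_ h1.2)
  have := h1.1
  rw [h1.2] at this
  linarith

end Count

section Ambiguous

variable {A σ : ℤ} [hD : Fact (σ ^ 2 + 4 * A < 0)]

local notation "𝓡" => QuadraticAlgebra ℤ A σ

lemma exists_self_conj {J : Ideal 𝓡} {n : ℤ} (hJ : HasNm J n) (h : hJ.cl ^ 2 = 1) :
    ∃ (K : Ideal 𝓡) (m : ℤ) (hK : HasNm K m), hK.cl = hJ.cl ∧ K.map cj = K := by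
  have hc : hJ.cl = hJ.conj.cl := by
    rw [hJ.cl_conj]; exact eq_inv_of_mul_eq_one_left (by rw [← sq, h])
  obtain ⟨x, y, hx, hy, e⟩ := (HasNm.cl_eq_iff _ _).1 hc
  by_cases hxy : x + y = 0
  · refine ⟨J, n, hJ, rfl, ?_⟩
    have : Ideal.span {x} = Ideal.span {y} := by
      rw [eq_neg_of_add_eq_zero_left hxy, Ideal.span_singleton_neg]
    rw [this] at e
    exact (span_mul_cancel hy e).symm
  have hN : x.norm = y.norm := by
    have h1 := (hasNm_span hx).mul hJ
    have h2 := (hasNm_span hy).mul hJ.conj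
    exact mul_right_cancel₀ hJ.1.ne' (h1.unique (e ▸ h2))
  have hδ : star y * (x + y) ≠ 0 := mul_ne_zero (by simpa using hy) hxy
  refine ⟨Ideal.span {star y * (x + y)} * J, _, (hasNm_span hδ).mul hJ, ?_, ?_⟩
  · rw [HasNm.cl_mul (hasNm_span hδ) hJ, (HasNm.cl_eq_one_iff (hasNm_span hδ)).2 ⟨_, hδ, rfl⟩,
      one_mul]
  · rw [Ideal.map_mul, map_cj_span]
    have e1 : star (star y * (x + y)) = (star x + star y) * y := by
      rw [star_mul, star_star, star_add]
    have e2 : star y * (x + y) = (star x + star y) * x := by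
      have h1 := mul_star_eq_norm x
      have h2 := mul_star_eq_norm y
      rw [hN] at h1
      linear_combination h2 - h1
    rw [e1, e2, ← Ideal.span_singleton_mul_span_singleton,
      ← Ideal.span_singleton_mul_span_singleton, mul_assoc, mul_assoc, e]

/-- Forms with middle coefficient zero, or equal to the first coefficient. -/
def Frm.IsAmb (f : Frm A σ) : Prop := 2 * f.t + σ = 0 ∨ 2 * f.t + σ = f.m

lemma exists_isAmb {c : Cl A σ} (hc : c ^ 2 = 1) : ∃ f : Frm A σ, f.cl = c ∧ f.IsAmb := by
  obtain ⟨J, n, hJ, rfl⟩ := exists_hasNm_cl c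
  obtain ⟨K, m, hK, hKJ, hconj⟩ := exists_self_conj hJ hc
  obtain ⟨k, f, hk, hKf, -, hf⟩ := hK.exists_frm
  have h1 : f.conj.idl = f.idl := by
    rw [hKf, Ideal.map_mul, map_cj_span_int, Frm.map_cj_idl] at hconj
    exact span_mul_cancel (intCast_ne_zero' hk) hconj
  obtain ⟨j, hj⟩ : f.m ∣ 2 * f.t + σ := by
    have h2 : f.elt 0 1 ∈ f.conj.idl := h1 ▸ f.elt_mem 0 1
    obtain ⟨s, hs⟩ := Frm.mem_idl.1 h2
    simp only [Frm.elt, Frm.conj] at hs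
    exact ⟨s, by linear_combination hs⟩
  refine ⟨f.shift (-(j / 2)), by rw [Frm.cl_shift, hf, hKJ], ?_⟩
  rcases Int.even_or_odd' j with ⟨i, rfl | rfl⟩
  · left
    rw [show 2 * i / 2 = i by omega]
    simp only [Frm.shift]
    linear_combination hj
  · right
    rw [show (2 * i + 1) / 2 = i by omega]
    simp only [Frm.shift]
    linear_combination hj

lemma Frm.coprime_of_zero {f : Frm A σ} (h : 2 * f.t + σ = 0) : IsCoprime f.m f.C := by
  obtain ⟨x, y, z, e⟩ := f.prim
  exact ⟨x, z, by rw [h] at e; linear_combination e⟩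

lemma Frm.coprime_of_eq {f : Frm A σ} (h : 2 * f.t + σ = f.m) : IsCoprime f.m f.C := by
  obtain ⟨x, y, z, e⟩ := f.prim
  exact ⟨x + y, z, by rw [h] at e; linear_combination e⟩

lemma exists_isAmb_ne (hD4 : σ ^ 2 + 4 * A < -4) {f : Frm A σ} (hf : f.IsAmb) :
    ∃ g : Frm A σ, g.cl = f.cl ∧ g.IsAmb ∧ g ≠ f := by
  have h4 := f.four_mul
  rcases hf with h | h
  · refine ⟨f.swap, f.cl_swap, Or.inl ?_, fun e => ?_⟩
    · simp only [Frm.swap]; linear_combination -h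
    · have e1 : f.C = f.m := congrArg Frm.m e
      have h1 := Frm.coprime_of_zero h
      rw [e1, isCoprime_self, Int.isUnit_iff] at h1
      rw [h, e1] at h4
      rcases h1 with h1 | h1 <;> rw [h1] at h4 <;> linarith
  · refine ⟨((f.swap.shift 1).swap.shift (-1)).swap, ?_, Or.inr ?_, fun e => ?_⟩
    · rw [Frm.cl_swap, Frm.cl_shift, Frm.cl_swap, Frm.cl_shift, Frm.cl_swap]
    · simp only [Frm.swap, Frm.shift]; linear_combination -h
    · have e1 := congrArg Frm.m e
      simp only [Frm.swap, Frm.shift] at e1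
      have e2 : f.m = 2 * f.C := by linarith
      have h1 := Frm.coprime_of_eq h
      have hC : IsUnit f.C := by
        rw [e2] at h1
        exact isCoprime_self.1 h1.of_mul_left_right
      have hC1 : f.C = 1 := by
        have := f.C_pos
        rcases Int.isUnit_iff.1 hC with h | h <;> omega
      rw [h, e2, hC1] at h4
      linarith

variable (A σ) in
/-- The set of ambiguous forms. -/
def ambSet : Set (Frm A σ) := {f | f.IsAmb}

lemma two_mul_card_le (hD4 : σ ^ 2 + 4 * A < -4) (hfin : (ambSet A σ).Finite) :
    2 * Nat.card {c : Cl A σ // c ^ 2 = 1} ≤ (ambSet A σ).ncard := by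
  choose f hfc hfa using fun c : {c : Cl A σ // c ^ 2 = 1} => exists_isAmb c.2
  choose g hgc hga hgf using fun c : {c : Cl A σ // c ^ 2 = 1} => exists_isAmb_ne hD4 (hfa c)
  have : Finite (ambSet A σ) := hfin
  have hb : Nat.card (Bool × {c : Cl A σ // c ^ 2 = 1}) = 2 * Nat.card {c : Cl A σ // c ^ 2 = 1} := by
    rw [Nat.card_prod]; simp
  rw [← hb, ← Nat.card_coe_set_eq]
  have hcl : ∀ c b, (if b = true then f c else g c : Frm A σ).cl = c.1 := by
    intro c b
    split_ifs
    · exact hfc c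
    · rw [hgc, hfc]
  refine Nat.card_le_card_of_injective (fun x : Bool × {c : Cl A σ // c ^ 2 = 1} =>
    (⟨if x.1 = true then f x.2 else g x.2, by split_ifs; exacts [hfa _, hga _]⟩ : ambSet A σ)) ?_
  rintro ⟨b, c⟩ ⟨b', c'⟩ h
  have h1 : (if b = true then f c else g c : Frm A σ) = if b' = true then f c' else g c' :=
    congrArg Subtype.val h
  have h2 : c = c' := Subtype.ext (by rw [← hcl c b, ← hcl c' b', h1])
  subst h2
  cases b <;> cases b' <;> simp only [Bool.false_eq_true, if_true, if_false] at h1 ⊢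
  · exact (hgf c h1).elim
  · exact (hgf c h1.symm).elim

lemma eq_prod_of_coprime {m k : ℕ} (hm : m ≠ 0) (h : m.Coprime k) :
    m = ∏ p ∈ m.primeFactors, p ^ (m * k).factorization p := by
  conv_lhs => rw [← Nat.prod_factorization_pow_eq_self hm]
  rw [Finsupp.prod, Nat.support_factorization]
  refine Finset.prod_congr rfl fun p hp => ?_
  rw [Nat.factorization_eq_of_coprime_left h (Nat.mem_primeFactors_iff_mem_primeFactorsList.1 hp)]

lemma ncard_le_of_unitary {α : Type*} {S : Set α} {N : ℕ} (hN : N ≠ 0) (φ : α → ℕ)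
    (hinj : Set.InjOn φ S) (h : ∀ f ∈ S, ∃ k, φ f * k = N ∧ (φ f).Coprime k) :
    S.Finite ∧ S.ncard ≤ 2 ^ N.primeFactors.card := by
  have hmaps : ∀ f ∈ S, (φ f).primeFactors ∈ (N.primeFactors.powerset : Set (Finset ℕ)) := by
    intro f hf
    obtain ⟨k, hk, -⟩ := h f hf
    simp only [Finset.coe_powerset, Set.mem_preimage, Set.mem_powerset_iff, Finset.coe_subset]
    exact Nat.primeFactors_mono (Dvd.intro k hk) hN
  have hinj' : Set.InjOn (fun f => (φ f).primeFactors) S := by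
    intro f hf g hg hfg
    obtain ⟨k, hk, hc⟩ := h f hf
    obtain ⟨l, hl, hc'⟩ := h g hg
    apply hinj hf hg
    rw [eq_prod_of_coprime (left_ne_zero_of_mul (hk ▸ hN)) hc,
      eq_prod_of_coprime (left_ne_zero_of_mul (hl ▸ hN)) hc', hk, hl]
    simp only at hfg
    rw [hfg]
  refine ⟨Set.Finite.of_injOn hmaps hinj' (Finset.finite_toSet _), ?_⟩
  have := Set.ncard_le_ncard_of_injOn _ hmaps hinj' (Finset.finite_toSet _)
  rwa [Set.ncard_coe_finset, Finset.card_powerset] at this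

lemma isCoprime_toNat {x y : ℤ} (hx : 0 ≤ x) (hy : 0 ≤ y) (h : IsCoprime x y) :
    x.toNat.Coprime y.toNat := by
  rw [← Nat.isCoprime_iff_coprime, Int.toNat_of_nonneg hx, Int.toNat_of_nonneg hy]
  exact h

lemma amb_odd {N : ℕ} (hN : σ ^ 2 + 4 * A = -N) (hodd : ¬ 2 ∣ N) :
    (ambSet A σ).Finite ∧ (ambSet A σ).ncard ≤ 2 ^ N.primeFactors.card := by
  have hσ : ¬ 2 ∣ σ := by
    rintro ⟨s, hs⟩
    refine hodd (Int.natCast_dvd_natCast.1 ⟨-2 * s ^ 2 - 2 * A, ?_⟩)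
    push_cast
    rw [hs] at hN
    linarith
  have hty : ∀ f ∈ ambSet A σ, 2 * f.t + σ = f.m := by
    rintro f (h | h)
    · exact absurd ⟨-f.t, by linarith⟩ hσ
    · exact h
  refine ncard_le_of_unitary (by rintro rfl; simp at hodd) (fun f => f.m.toNat) ?_ ?_
  · intro f hf g hg h
    have h1 : f.m = g.m := by
      have := f.pos; have := g.pos; simp only at h; omega
    have h2 := hty f hf
    have h3 := hty g hg
    exact Frm.ext' h1 (by linarith)
  · intro f hf
    have hm := hty f hf
    have h4 := f.four_mul
    rw [hm, hN] at h4
    have hpos := f.pos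
    have hk : 0 < 4 * f.C - f.m := by
      have : 0 < f.m * (4 * f.C - f.m) := by
        have : (0 : ℤ) < N := by have := hD.out; omega
        nlinarith
      exact (mul_pos_iff_of_pos_left hpos).1 this
    refine ⟨(4 * f.C - f.m).toNat, ?_, isCoprime_toNat hpos.le hk.le ?_⟩
    · zify
      rw [Int.toNat_of_nonneg hpos.le, Int.toNat_of_nonneg hk.le]
      linarith
    · have hm2 : IsCoprime f.m 4 := by
        have : IsCoprime f.m 2 := by
          rw [isCoprime_comm, Prime.coprime_iff_not_dvd Int.prime_two]
          rintro ⟨s, hs⟩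
          exact hσ ⟨s - f.t, by linarith⟩
        simpa using this.mul_right this
      have := hm2.mul_right (Frm.coprime_of_eq hm)
      rw [sub_eq_add_neg]
      simpa using (IsCoprime.add_mul_left_right_iff (z := -1)).2 this

lemma amb_even {n : ℕ} (hn : σ ^ 2 + 4 * A = -(4 * n)) :
    (ambSet A σ).Finite ∧
      (ambSet A σ).ncard ≤ 2 ^ n.primeFactors.card * if n % 4 = 1 ∨ 8 ∣ n then 2 else 1 := by
  have hn0 : n ≠ 0 := by rintro rfl; have := hD.out; simp at hn; omega
  set S0 : Set (Frm A σ) := {f | 2 * f.t + σ = 0}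
  set S1 : Set (Frm A σ) := {f | 2 * f.t + σ = f.m}
  have hS : ambSet A σ = S0 ∪ S1 := rfl
  have h0 : S0.Finite ∧ S0.ncard ≤ 2 ^ n.primeFactors.card := by
    refine ncard_le_of_unitary hn0 (fun f => f.m.toNat) ?_ ?_
    · intro f hf g hg h
      have h1 : f.m = g.m := by
        have := f.pos; have := g.pos; simp only at h; omega
      have h2 : 2 * f.t + σ = 0 := hf
      have h3 : 2 * g.t + σ = 0 := hg
      exact Frm.ext' h1 (by linarith)
    · intro f hf
      have h4 := f.four_mul
      rw [show 2 * f.t + σ = 0 from hf, hn] at h4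
      refine ⟨f.C.toNat, ?_, isCoprime_toNat f.pos.le f.C_pos.le (Frm.coprime_of_zero hf)⟩
      zify
      rw [Int.toNat_of_nonneg f.pos.le, Int.toNat_of_nonneg f.C_pos.le]
      linarith
  have hS1 : ∀ f ∈ S1, ∃ μ, f.m = 2 * μ ∧ μ * (2 * f.C - μ) = n ∧ 0 < μ ∧ 0 < 2 * f.C - μ ∧
      ¬ 2 ∣ f.C ∧ IsCoprime μ f.C := by
    intro f hf
    have h4 := f.four_mul
    rw [show 2 * f.t + σ = f.m from hf, hn] at h4
    obtain ⟨μ, hμ⟩ : 2 ∣ f.m :=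
      Int.prime_two.dvd_of_dvd_pow (n := 2) ⟨2 * f.m * f.C - 2 * n, by linarith⟩
    have hc := Frm.coprime_of_eq hf
    rw [hμ] at hc h4
    have hpos := f.pos
    have hμ0 : 0 < μ := by omega
    have hval : μ * (2 * f.C - μ) = n := by linarith
    refine ⟨μ, hμ, hval, hμ0, ?_, ?_, hc.of_mul_left_right⟩
    · refine (mul_pos_iff_of_pos_left hμ0).1 ?_
      rw [hval]; exact_mod_cast Nat.pos_of_ne_zero hn0
    · exact (Int.prime_two.coprime_iff_not_dvd).1 hc.of_mul_left_left
  have hinjm : ∀ f ∈ S1, ∀ g ∈ S1, f.m = g.m → f = g := by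
    intro f hf g hg h1
    have h2 : 2 * f.t + σ = f.m := hf
    have h3 : 2 * g.t + σ = g.m := hg
    exact Frm.ext' h1 (by linarith)
  have hodd : ∀ f ∈ S1, ∀ μ, μ * (2 * f.C - μ) = n → ¬ 2 ∣ f.C → ¬ 2 ∣ μ → n % 4 = 1 := by
    intro f _ μ h1 h2 h3
    obtain ⟨c, hc⟩ : Odd f.C := Int.not_even_iff_odd.1 (by rwa [even_iff_two_dvd])
    obtain ⟨s, hs⟩ : Odd μ := Int.not_even_iff_odd.1 (by rwa [even_iff_two_dvd])
    have : (n : ℤ) = 4 * (s + 2 * c * s + c - s ^ 2 - s) + 1 := by rw [← h1, hc, hs]; ring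
    omega
  have heven : ∀ f ∈ S1, ∀ μ, μ * (2 * f.C - μ) = n → ¬ 2 ∣ f.C → 2 ∣ μ → 8 ∣ n := by
    rintro f _ μ h1 h2 ⟨s, hs⟩
    have h3 : (2 : ℤ) ∣ s * (f.C - s) := by
      obtain ⟨c, hc⟩ : Odd f.C := Int.not_even_iff_odd.1 (by rwa [even_iff_two_dvd])
      rcases Int.even_or_odd' s with ⟨r, hr | hr⟩
      · exact ⟨r * (f.C - s), by rw [hr]; ring⟩
      · exact ⟨s * (c - r), by rw [hr, hc]; ring⟩
    obtain ⟨r, hr⟩ := h3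
    have : (n : ℤ) = 8 * r := by rw [← h1, hs]; linear_combination 4 * hr
    omega
  have h1 : S1.Finite ∧ S1.ncard ≤ 2 ^ n.primeFactors.card *
      (if n % 4 = 1 ∨ 8 ∣ n then 1 else 0) := by
    split_ifs with hcond
    · rw [mul_one]
      by_cases h4 : n % 4 = 1
      · refine ncard_le_of_unitary hn0 (fun f => (f.m / 2).toNat) ?_ ?_
        · intro f hf g hg h
          obtain ⟨μ, hμ, -, h0, -⟩ := hS1 f hf
          obtain ⟨ν, hν, -, h0', -⟩ := hS1 g hg
          exact hinjm f hf g hg (by simp only at h; omega)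
        · intro f hf
          obtain ⟨μ, hμ, hv, hμ0, hk0, hC, hcop⟩ := hS1 f hf
          rw [show f.m / 2 = μ by omega]
          have hμ2 : ¬ 2 ∣ μ := fun h => by have := heven f hf μ hv hC h; omega
          refine ⟨(2 * f.C - μ).toNat, ?_, isCoprime_toNat hμ0.le hk0.le ?_⟩
          · zify
            rw [Int.toNat_of_nonneg hμ0.le, Int.toNat_of_nonneg hk0.le, hv]
          · have h2 : IsCoprime μ 2 :=
              ((Int.prime_two.coprime_iff_not_dvd).2 hμ2).symm
            rw [sub_eq_add_neg]
            simpa using (IsCoprime.add_mul_left_right_iff (z := -1)).2 (h2.mul_right hcop)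
      · obtain ⟨r, hr⟩ : 8 ∣ n := hcond.resolve_left h4
        have hω : n.primeFactors = (2 * r).primeFactors := by
          have hr0 : r ≠ 0 := by omega
          rw [hr, show 8 * r = 2 ^ 3 * r by ring, Nat.primeFactors_mul (by norm_num) hr0,
            Nat.primeFactors_mul (by norm_num) hr0, Nat.primeFactors_pow _ (by norm_num)]
        rw [hω]
        have hkey : ∀ f ∈ S1, ∃ s, f.m = 4 * s ∧ s * (f.C - s) = 2 * r ∧ 0 < s ∧ 0 < f.C - s ∧
            IsCoprime s f.C := by
          intro f hf
          obtain ⟨μ, hμ, hv, hμ0, hk0, hC, hcop⟩ := hS1 f hf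
          have hμ2 : 2 ∣ μ := by
            by_contra h
            exact h4 (hodd f hf μ hv hC h)
          obtain ⟨s, rfl⟩ := hμ2
          refine ⟨s, by omega, ?_, by omega, by omega, hcop.of_mul_left_right⟩
          rw [hr] at hv
          push_cast at hv
          linarith
        refine ncard_le_of_unitary (by omega) (fun f => (f.m / 4).toNat) ?_ ?_
        · intro f hf g hg h
          obtain ⟨μ, hμ, -, h0, -⟩ := hkey f hf
          obtain ⟨ν, hν, -, h0', -⟩ := hkey g hg
          exact hinjm f hf g hg (by simp only at h; omega)
        · intro f hf
          obtain ⟨s, hs, hv, hs0, hk0, hcop⟩ := hkey f hf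
          rw [show f.m / 4 = s by omega]
          refine ⟨(f.C - s).toNat, ?_, isCoprime_toNat hs0.le hk0.le ?_⟩
          · zify
            rw [Int.toNat_of_nonneg hs0.le, Int.toNat_of_nonneg hk0.le, hv]
          · rw [sub_eq_add_neg]
            simpa using (IsCoprime.add_mul_left_right_iff (z := -1)).2 hcop
    · have : S1 = ∅ := by
        rw [Set.eq_empty_iff_forall_notMem]
        intro f hf
        obtain ⟨μ, hμ, hv, hμ0, hk0, hC, hcop⟩ := hS1 f hf
        by_cases h : 2 ∣ μ
        · exact hcond (Or.inr (heven f hf μ hv hC h))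
        · exact hcond (Or.inl (hodd f hf μ hv hC h))
      rw [this]
      simp
  refine ⟨hS ▸ h0.1.union h1.1, ?_⟩
  rw [hS]
  refine (Set.ncard_union_le _ _).trans ((add_le_add h0.2 h1.2).trans ?_)
  split_ifs <;> omega

lemma Frm.cl_eq_one_of_m {f : Frm A σ} (h : f.m = 1) : f.cl = 1 := by
  rw [Frm.cl, HasNm.cl_eq_one_iff]
  refine ⟨1, one_ne_zero, ?_⟩
  rw [Ideal.span_singleton_one, Ideal.eq_top_iff_one, Frm.mem_idl, h]
  exact one_dvd _

lemma card_two_torsion_of_neg_four (h : σ ^ 2 + 4 * A = -4) :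
    Nat.card {c : Cl A σ // c ^ 2 = 1} ≤ 1 := by
  have : Subsingleton {c : Cl A σ // c ^ 2 = 1} := by
    have key : ∀ c : {c : Cl A σ // c ^ 2 = 1}, c.1 = 1 := by
      intro c
      obtain ⟨f, hf, hfa⟩ := exists_isAmb c.2
      rw [← hf]
      have h4 := f.four_mul
      have hm := f.pos
      have hC := f.C_pos
      rw [h] at h4
      rcases hfa with h0 | h0
      · rw [h0] at h4
        exact Frm.cl_eq_one_of_m (by nlinarith)
      · rw [h0] at h4
        rw [← Frm.cl_swap]
        refine Frm.cl_eq_one_of_m ?_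
        change f.C = 1
        have : f.m ≤ 4 := by
          have : 0 < 4 * f.C - f.m := by
            refine (mul_pos_iff_of_pos_left hm).1 ?_
            linarith
          nlinarith
        generalize f.m = m at *
        generalize f.C = C at *
        interval_cases m <;> omega
    exact ⟨fun c d => Subtype.ext ((key c).trans (key d).symm)⟩
  exact Finite.card_le_one_iff_subsingleton.2 this

end Ambiguous

/-- The Dirichlet mass `∑_{n ∈ E} n^{-s}`. -/
noncomputable def dm (s : ℝ) (E : Set ℕ) : ℝ := ∑' n : E, ((n : ℕ) : ℝ) ^ (-s)

section DirichletMass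

variable {s : ℝ}

lemma summable_rpow_neg (hs : 1 < s) : Summable fun n : ℕ => (n : ℝ) ^ (-s) :=
  Real.summable_nat_rpow.2 (by linarith)

lemma summable_dm (hs : 1 < s) (E : Set ℕ) : Summable fun n : E => ((n : ℕ) : ℝ) ^ (-s) :=
  (summable_rpow_neg hs).subtype E

lemma dm_nonneg (s : ℝ) (E : Set ℕ) : 0 ≤ dm s E := tsum_nonneg fun _ => by positivity

lemma dm_mono (hs : 1 < s) {E F : Set ℕ} (h : E ⊆ F) : dm s E ≤ dm s F :=
  Summable.tsum_le_tsum_of_inj (Set.inclusion h) (Set.inclusion_injective h)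
    (fun _ _ => by positivity) (fun _ => le_rfl) (summable_dm hs E) (summable_dm hs F)

lemma dm_union (hs : 1 < s) {E F : Set ℕ} (h : Disjoint E F) :
    dm s (E ∪ F) = dm s E + dm s F :=
  Summable.tsum_union_disjoint (f := fun n : ℕ => (n : ℝ) ^ (-s)) h (summable_dm hs E)
    (summable_dm hs F)

lemma dm_union_le (hs : 1 < s) (E F : Set ℕ) : dm s (E ∪ F) ≤ dm s E + dm s F := by
  rw [← Set.union_sdiff_self, dm_union hs Set.disjoint_sdiff_right]
  gcongr
  exact dm_mono hs Set.sdiff_subset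

lemma dm_biUnion_le (hs : 1 < s) {ι : Type*} (I : Finset ι) (E : ι → Set ℕ) :
    dm s (⋃ i ∈ I, E i) ≤ ∑ i ∈ I, dm s (E i) := by
  classical
  induction I using Finset.induction with
  | empty => simp [dm]
  | insert i I hi ih =>
    rw [Finset.set_biUnion_insert, Finset.sum_insert hi]
    exact (dm_union_le hs _ _).trans (by gcongr)

lemma dm_biUnion (hs : 1 < s) {ι : Type*} (I : Finset ι) {E : ι → Set ℕ}
    (h : Pairwise (Function.onFun Disjoint E)) :
    dm s (⋃ i ∈ I, E i) = ∑ i ∈ I, dm s (E i) := by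
  classical
  induction I using Finset.induction with
  | empty => simp [dm]
  | insert i I hi ih =>
    rw [Finset.set_biUnion_insert, Finset.sum_insert hi, dm_union hs, ih]
    rw [Set.disjoint_iUnion₂_right]
    exact fun j hj => h (by rintro rfl; exact hi hj)

lemma dm_image_mul {p : ℕ} (hp : p ≠ 0) (E : Set ℕ) :
    dm s ((p * ·) '' E) = (p : ℝ) ^ (-s) * dm s E := by
  have := tsum_image (g := (p * ·)) (fun n : ℕ => (n : ℝ) ^ (-s))
    (s := E) (fun a _ b _ h => Nat.eq_of_mul_eq_mul_left (Nat.pos_of_ne_zero hp) h)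
  rw [dm, dm, this, ← tsum_mul_left]
  refine tsum_congr fun n => ?_
  push_cast
  rw [Real.mul_rpow (by positivity) (by positivity)]

lemma summable_dm_prod (hs : 1 < s) (E F : Set ℕ) :
    Summable fun x : E × F => ((x.1 : ℕ) : ℝ) ^ (-s) * ((x.2 : ℕ) : ℝ) ^ (-s) :=
  (summable_dm hs E).mul_of_nonneg (summable_dm hs F) (fun _ => by positivity)
    (fun _ => by positivity)

lemma dm_le_mul (hs : 1 < s) {E F G : Set ℕ} (h : ∀ n ∈ E, ∃ a ∈ F, ∃ b ∈ G, n = a * b) :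
    dm s E ≤ dm s F * dm s G := by
  choose a ha b hb hab using h
  rw [dm, dm, dm, (summable_dm hs F).tsum_mul_tsum (summable_dm hs G) (summable_dm_prod hs F G)]
  refine Summable.tsum_le_tsum_of_inj
    (fun n : E => ((⟨a n n.2, ha n n.2⟩, ⟨b n n.2, hb n n.2⟩) : F × G)) ?_
    (fun _ _ => by positivity) (fun n => ?_) (summable_dm hs E) (summable_dm_prod hs F G)
  · intro m n h
    simp only [Prod.mk.injEq, Subtype.mk.injEq] at h
    exact Subtype.ext (by rw [hab m m.2, hab n n.2, h.1, h.2])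
  · rw [← Real.mul_rpow (by positivity) (by positivity), ← Nat.cast_mul, ← hab n n.2]

end DirichletMass

section Core

variable {G : Type*} [CommGroup G] {P : ℕ → Prop} {γ : ℕ → G}

/-- The `P`-smooth numbers without prime factors in `F`. -/
def smoothSet (P : ℕ → Prop) (F : Finset ℕ) : Set ℕ := {a | Smooth P a ∧ ∀ p ∈ F, ¬ p ∣ a}

lemma smoothSet_insert_union (hP : ∀ p, P p → p.Prime) {F : Finset ℕ} {p : ℕ} (hp : P p)
    (hpF : p ∉ F) (hF : ∀ q ∈ F, P q) (g : G)
    (hγ : ∀ m n, m ≠ 0 → n ≠ 0 → γ (m * n) = γ m * γ n) :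
    smoothSet P F ∩ γ ⁻¹' {g} = (smoothSet P (insert p F) ∩ γ ⁻¹' {g}) ∪
      ((p * ·) '' (smoothSet P F ∩ γ ⁻¹' {g * (γ p)⁻¹})) := by
  have hp' := hP p hp
  ext a
  simp only [smoothSet, Set.mem_inter_iff, Set.mem_ofPred_eq, Set.mem_preimage,
    Set.mem_singleton_iff, Set.mem_union, Set.mem_image, Finset.mem_insert, forall_eq_or_imp]
  constructor
  · rintro ⟨⟨ha, hF'⟩, rfl⟩
    by_cases hpa : p ∣ a
    · obtain ⟨b, rfl⟩ := hpa
      refine Or.inr ⟨b, ⟨⟨ha.of_dvd (Dvd.intro_left p rfl), fun q hq h =>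
        hF' q hq (h.mul_left p)⟩, ?_⟩, rfl⟩
      rw [hγ p b hp'.ne_zero (right_ne_zero_of_mul ha.1)]
      group
      rw [mul_assoc, mul_comm (γ b), ← mul_assoc]
      simp
    · exact Or.inl ⟨⟨ha, hpa, hF'⟩, rfl⟩
  · rintro (⟨⟨ha, -, hF'⟩, rfl⟩ | ⟨b, ⟨⟨hb, hF'⟩, hg⟩, rfl⟩)
    · exact ⟨⟨ha, hF'⟩, rfl⟩
    · refine ⟨⟨(smooth_prime hp' hp).mul hb, fun q hq h => ?_⟩, ?_⟩
      · rcases (hP q (hF q hq)).dvd_mul.1 h with h | h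
        · exact hpF ((Nat.prime_dvd_prime_iff_eq (hP q (hF q hq)) hp').1 h ▸ hq)
        · exact hF' q hq h
      · rw [hγ p b hp'.ne_zero hb.1, hg]
        rw [mul_comm, inv_mul_cancel_right]

lemma dm_smoothSet_insert (hP : ∀ p, P p → p.Prime) {F : Finset ℕ} {p : ℕ} (hp : P p)
    (hpF : p ∉ F) (hF : ∀ q ∈ F, P q) (g : G)
    (hγ : ∀ m n, m ≠ 0 → n ≠ 0 → γ (m * n) = γ m * γ n) {s : ℝ} (hs : 1 < s) :
    dm s (smoothSet P (insert p F) ∩ γ ⁻¹' {g}) = dm s (smoothSet P F ∩ γ ⁻¹' {g}) -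
      (p : ℝ) ^ (-s) * dm s (smoothSet P F ∩ γ ⁻¹' {g * (γ p)⁻¹}) := by
  rw [smoothSet_insert_union hP hp hpF hF g hγ, dm_union hs, dm_image_mul (hP p hp).ne_zero]
  · ring
  · rw [Set.disjoint_left]
    rintro a ⟨⟨-, h⟩, -⟩ ⟨b, -, rfl⟩
    exact h p (Finset.mem_insert_self _ _) (Dvd.intro b rfl)

end Core

/-- Functions on a finite group whose autocorrelations tend to a constant are asymptotically
constant. -/
lemma tendsto_of_autocorrelation {G ι : Type*} [CommGroup G] [Fintype G] {l : Filter ι}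
    {r : G → ι → ℝ} (hr : ∀ g i, 0 ≤ r g i) {κ : ℝ}
    (h : ∀ c, Tendsto (fun i => ∑ g, r (c * g) i * r g i) l (𝓝 κ)) (g : G) :
    Tendsto (r g) l (𝓝 (√(κ / Fintype.card G))) := by
  set n : ℝ := ((Fintype.card G : ℕ) : ℝ) with hn
  have hn0 : 0 < n := by rw [hn]; exact_mod_cast Fintype.card_pos
  have hS2 : Tendsto (fun i => (∑ g, r g i) ^ 2) l (𝓝 (n * κ)) := by
    have := tendsto_finsetSum Finset.univ fun c _ => h c
    rw [Finset.sum_const, Finset.card_univ, nsmul_eq_mul] at this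
    refine this.congr fun i => ?_
    rw [Finset.sum_comm, sq, Finset.sum_mul_sum]
    refine Finset.sum_congr rfl fun g _ => ?_
    exact Fintype.sum_equiv (Equiv.mulRight g) _ _ fun c => mul_comm _ _
  have hS : Tendsto (fun i => ∑ g, r g i) l (𝓝 (√(n * κ))) := by
    refine (hS2.sqrt).congr fun i => ?_
    exact Real.sqrt_sq (Finset.sum_nonneg fun g _ => hr g i)
  have hV : Tendsto (fun i => ∑ g, (r g i - (∑ g, r g i) / n) ^ 2) l (𝓝 0) := by
    have h1 := (h 1).sub (hS2.div_const n)
    rw [mul_div_cancel_left₀ _ hn0.ne', sub_self] at h1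
    refine h1.congr fun i => ?_
    set S := ∑ g, r g i
    have : ∀ g, (r g i - S / n) ^ 2 = r (1 * g) i * r g i - (2 * S / n) * r g i + (S / n) ^ 2 := by
      intro g; rw [one_mul]; ring
    simp_rw [this]
    rw [Finset.sum_add_distrib, Finset.sum_sub_distrib, ← Finset.mul_sum, Finset.sum_const,
      Finset.card_univ, nsmul_eq_mul, ← hn]
    change _ = _ - 2 * S / n * S + _
    field_simp
    ring
  have hd : Tendsto (fun i => (r g i - (∑ g, r g i) / n) ^ 2) l (𝓝 0) :=
    squeeze_zero (fun i => sq_nonneg _)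
      (fun i => Finset.single_le_sum (f := fun g => (r g i - (∑ g, r g i) / n) ^ 2)
        (fun g _ => sq_nonneg _) (Finset.mem_univ g)) hV
  have hd' : Tendsto (fun i => r g i - (∑ g, r g i) / n) l (𝓝 0) := by
    have := hd.sqrt
    rw [Real.sqrt_zero] at this
    rw [tendsto_zero_iff_abs_tendsto_zero]
    exact this.congr fun i => Real.sqrt_sq_eq_abs _
  have := hd'.add (hS.div_const n)
  rw [zero_add] at this
  have e : √(n * κ) / n = √(κ / n) := by
    rw [div_eq_iff hn0.ne', Real.sqrt_mul hn0.le, Real.sqrt_div' _ hn0.le]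
    field_simp
    rw [Real.sq_sqrt hn0.le]; ring
  rw [e] at this
  exact this.congr fun i => by ring

section Core

variable {G : Type*} [CommGroup G] {P Q : ℕ → Prop} {γ : ℕ → G}

/-- Triples `(a, b, k)` with `a`, `b` smooth over `P`, `k` smooth over `Q` and `γ(a) γ(b)⁻¹ = c`. -/
def tripSet (P Q : ℕ → Prop) (γ : ℕ → G) (c : G) : Set (ℕ × ℕ × ℕ) :=
  {T | Smooth P T.1 ∧ Smooth P T.2.1 ∧ Smooth Q T.2.2 ∧ γ T.1 * (γ T.2.1)⁻¹ = c}

/-- The normalising factor `√((s - 1) ∑_{k ∈ ⟨Q⟩} k^{-2 s})`. -/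
noncomputable def rho (Q : ℕ → Prop) (s : ℝ) : ℝ := √((s - 1) * dm (2 * s) {k | Smooth Q k})

lemma hasSum_dm {s : ℝ} (hs : 1 < s) (E : Set ℕ) :
    HasSum (E.indicator fun n : ℕ => (n : ℝ) ^ (-s)) (dm s E) :=
  (hasSum_subtype_iff_indicator (f := fun n : ℕ => (n : ℝ) ^ (-s))).1 (summable_dm hs E).hasSum

lemma smoothSet_empty (P : ℕ → Prop) : smoothSet P ∅ = {a | Smooth P a} := by
  simp [smoothSet]

lemma hasSum_tripSet [Fintype G] (c : G) {s : ℝ} (hs : 1 < s) :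
    HasSum (fun T : tripSet P Q γ c => (tval T.1 : ℝ) ^ (-s))
      (dm (2 * s) {k | Smooth Q k} * ∑ g, dm s (smoothSet P ∅ ∩ γ ⁻¹' {c * g}) *
        dm s (smoothSet P ∅ ∩ γ ⁻¹' {g})) := by
  classical
  have h2s : 1 < 2 * s := by linarith
  have nn : ∀ (t : ℝ) (E : Set ℕ) (n : ℕ), 0 ≤ E.indicator (fun n : ℕ => (n : ℝ) ^ (-t)) n :=
    fun t E n => Set.indicator_nonneg (fun _ _ => by positivity) n
  have key : ∀ g : G, HasSum (fun T : ℕ × ℕ × ℕ =>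
      (smoothSet P ∅ ∩ γ ⁻¹' {c * g}).indicator (fun n : ℕ => (n : ℝ) ^ (-s)) T.1 *
      ((smoothSet P ∅ ∩ γ ⁻¹' {g}).indicator (fun n : ℕ => (n : ℝ) ^ (-s)) T.2.1 *
      ({k | Smooth Q k}).indicator (fun n : ℕ => (n : ℝ) ^ (-(2 * s))) T.2.2))
      (dm s (smoothSet P ∅ ∩ γ ⁻¹' {c * g}) * (dm s (smoothSet P ∅ ∩ γ ⁻¹' {g}) *
        dm (2 * s) {k | Smooth Q k})) := by
    intro g
    have hB := hasSum_dm hs (smoothSet P ∅ ∩ γ ⁻¹' {g})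
    have hC := hasSum_dm h2s {k | Smooth Q k}
    have hBC := hB.mul hC (hB.summable.mul_of_nonneg hC.summable (nn _ _) (nn _ _))
    have hA := hasSum_dm hs (smoothSet P ∅ ∩ γ ⁻¹' {c * g})
    exact hA.mul hBC (hA.summable.mul_of_nonneg hBC.summable (nn _ _)
      (fun T => mul_nonneg (nn _ _ _) (nn _ _ _)))
  have := hasSum_sum (s := Finset.univ) fun g _ => key g
  rw [Finset.mul_sum]
  refine (hasSum_subtype_iff_indicator (s := tripSet P Q γ c)
    (f := fun T => (tval T : ℝ) ^ (-s))).2 ?_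
  convert this using 1
  · ext ⟨a, b, k⟩
    simp only [smoothSet_empty]
    by_cases hT : (a, b, k) ∈ tripSet P Q γ c
    · obtain ⟨ha, hb, hk, hc⟩ := id hT
      dsimp only at ha hb hk hc
      rw [Set.indicator_of_mem hT, Finset.sum_eq_single (γ b)]
      · rw [Set.indicator_of_mem (a := a) (show a ∈ {a | Smooth P a} ∩ γ ⁻¹' {c * γ b} from ⟨ha, by simp [← hc]⟩),
          Set.indicator_of_mem (a := b) (show b ∈ {a | Smooth P a} ∩ γ ⁻¹' {γ b} from ⟨hb, rfl⟩),
          Set.indicator_of_mem (by exact hk), tval]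
        push_cast
        rw [Real.mul_rpow (by positivity) (by positivity),
          Real.mul_rpow (by positivity) (by positivity), ← Real.rpow_natCast, ← Real.rpow_mul
          (by positivity)]
        push_cast
        rw [mul_neg]; ring
      · intro g _ hg
        rw [Set.indicator_of_notMem (a := b) fun h => hg h.2.symm]
        ring
      · simp
    · rw [Set.indicator_of_notMem hT, eq_comm]
      refine Finset.sum_eq_zero fun g _ => ?_
      by_contra hne
      have h1 := Set.mem_of_indicator_ne_zero (left_ne_zero_of_mul hne)
      have h2 := Set.mem_of_indicator_ne_zero (left_ne_zero_of_mul (right_ne_zero_of_mul hne))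
      have h3 := Set.mem_of_indicator_ne_zero (right_ne_zero_of_mul (right_ne_zero_of_mul hne))
      refine hT ⟨h1.1, h2.1, h3, ?_⟩
      have e1 : γ a = c * g := h1.2
      have e2 : γ b = g := h2.2
      simp [e1, e2]
  · exact Finset.sum_congr rfl fun g _ => by ring

/-- The standing hypothesis: the class zeta functions all have the same residue. -/
structure Equi (P Q : ℕ → Prop) (γ : ℕ → G) (κ : ℝ) : Prop where
  primeP : ∀ p, P p → p.Prime
  disj : ∀ p, P p → ¬ Q p
  mul : ∀ m n, m ≠ 0 → n ≠ 0 → γ (m * n) = γ m * γ n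
  pos : 0 < κ
  res : ∀ c, Tendsto (fun s : ℝ => (s - 1) * ∑' T : tripSet P Q γ c, (tval T.1 : ℝ) ^ (-s))
    (𝓝[>] 1) (𝓝 κ)

variable {κ : ℝ} [Fintype G]

lemma rho_nonneg (Q : ℕ → Prop) (s : ℝ) : 0 ≤ rho Q s := Real.sqrt_nonneg _

lemma eventually_one_lt : ∀ᶠ s : ℝ in 𝓝[>] 1, 1 < s := eventually_mem_nhdsWithin

lemma Equi.tendsto_class (E : Equi P Q γ κ) (g : G) :
    Tendsto (fun s => rho Q s * dm s (smoothSet P ∅ ∩ γ ⁻¹' {g})) (𝓝[>] 1)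
      (𝓝 (√(κ / Fintype.card G))) := by
  refine tendsto_of_autocorrelation
    (r := fun g s => rho Q s * dm s (smoothSet P ∅ ∩ γ ⁻¹' {g}))
    (fun g s => mul_nonneg (rho_nonneg _ _) (dm_nonneg _ _)) (fun c => ?_) g
  refine (E.res c).congr' ?_
  filter_upwards [eventually_one_lt] with s hs
  rw [(hasSum_tripSet c hs).tsum_eq, Finset.mul_sum, Finset.mul_sum]
  refine Finset.sum_congr rfl fun g _ => ?_
  have : rho Q s * rho Q s = (s - 1) * dm (2 * s) {k | Smooth Q k} :=
    Real.mul_self_sqrt (mul_nonneg (by linarith) (dm_nonneg _ _))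
  linear_combination (-dm s (smoothSet P ∅ ∩ γ ⁻¹' {c * g}) *
        dm s (smoothSet P ∅ ∩ γ ⁻¹' {g})) * this

lemma tendsto_rpow_neg_one {p : ℕ} (hp : p ≠ 0) :
    Tendsto (fun s : ℝ => (p : ℝ) ^ (-s)) (𝓝[>] 1) (𝓝 (p : ℝ)⁻¹) := by
  have : ContinuousAt (fun s : ℝ => (p : ℝ) ^ (-s)) 1 := by
    refine ContinuousAt.rpow continuousAt_const continuousAt_id.neg (Or.inl ?_)
    exact_mod_cast hp
  have h := this.tendsto
  rw [Real.rpow_neg_one] at h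
  exact h.mono_left nhdsWithin_le_nhds

lemma Equi.tendsto_avoid (E : Equi P Q γ κ) (F : Finset ℕ) (hF : ∀ p ∈ F, P p) (g : G) :
    Tendsto (fun s => rho Q s * dm s (smoothSet P F ∩ γ ⁻¹' {g})) (𝓝[>] 1)
      (𝓝 (√(κ / Fintype.card G) * ∏ p ∈ F, (1 - (p : ℝ)⁻¹))) := by
  induction F using Finset.induction generalizing g with
  | empty => simpa using E.tendsto_class g
  | insert p F hp ih =>
    have hF' : ∀ q ∈ F, P q := fun q hq => hF q (Finset.mem_insert_of_mem hq)
    have hPp := hF p (Finset.mem_insert_self _ _)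
    rw [Finset.prod_insert hp]
    have h1 := (ih hF' g).sub ((tendsto_rpow_neg_one (E.primeP p hPp).ne_zero).mul
      (ih hF' (g * (γ p)⁻¹)))
    have e : √(κ / Fintype.card G) * ((1 - (p : ℝ)⁻¹) * ∏ p ∈ F, (1 - (p : ℝ)⁻¹)) =
      √(κ / Fintype.card G) * ∏ p ∈ F, (1 - (p : ℝ)⁻¹) - (p : ℝ)⁻¹ *
      (√(κ / Fintype.card G) * ∏ p ∈ F, (1 - (p : ℝ)⁻¹)) := by ring
    rw [e]
    refine h1.congr' ?_
    filter_upwards [eventually_one_lt] with s hs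
    rw [dm_smoothSet_insert E.primeP hPp hp hF' g E.mul hs]
    ring

lemma dm_eq_sum_class {s : ℝ} (hs : 1 < s) (E : Set ℕ) (γ : ℕ → G) (I : Finset G) :
    dm s (E ∩ {a | γ a ∈ I}) = ∑ g ∈ I, dm s (E ∩ γ ⁻¹' {g}) := by
  rw [← dm_biUnion hs I]
  · congr 1
    ext a
    simp
  · intro g h hgh
    rw [Function.onFun, Set.disjoint_left]
    rintro a ⟨-, h1⟩ ⟨-, h2⟩
    exact hgh (Eq.trans (Eq.symm h1) h2)

lemma Equi.tendsto_avoid_sum (E : Equi P Q γ κ) (F : Finset ℕ) (hF : ∀ p ∈ F, P p)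
    (I : Finset G) :
    Tendsto (fun s => rho Q s * dm s (smoothSet P F ∩ {a | γ a ∈ I})) (𝓝[>] 1)
      (𝓝 (I.card * (√(κ / Fintype.card G) * ∏ p ∈ F, (1 - (p : ℝ)⁻¹)))) := by
  have := tendsto_finsetSum I fun g _ => E.tendsto_avoid F hF g
  rw [Finset.sum_const, nsmul_eq_mul] at this
  refine this.congr' ?_
  filter_upwards [eventually_one_lt] with s hs
  rw [dm_eq_sum_class hs, Finset.mul_sum]

end Core

section Core

variable {G : Type*} [CommGroup G] {P Q : ℕ → Prop} {γ : ℕ → G} {κ : ℝ} [Fintype G]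

/-- The `P`-smooth numbers without a divisor of class `h` supported on the primes in `F`. -/
def noDivisorSet (P : ℕ → Prop) (γ : ℕ → G) (F : Finset ℕ) (h : G) : Set ℕ :=
  {a | Smooth P a ∧ ¬ ∃ d, d ∣ a ∧ (∀ p, p.Prime → p ∣ d → p ∈ F) ∧ γ d = h}

/-- The class `h` is realised by a divisor of almost every smooth number, with divisor supported
on finitely many primes that can be chosen away from any given finite set. -/
def Common (P Q : ℕ → Prop) (γ : ℕ → G) (h : G) : Prop :=
  ∀ ε : ℝ, 0 < ε → ∀ F₀ : Finset ℕ, ∃ F : Finset ℕ, Disjoint F₀ F ∧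
    ∀ᶠ s in 𝓝[>] 1, rho Q s * dm s (noDivisorSet P γ F h) ≤ ε

lemma Equi.map_one (E : Equi P Q γ κ) : γ 1 = 1 := by
  have := E.mul 1 1 one_ne_zero one_ne_zero
  simpa using this

lemma Equi.common_one (E : Equi P Q γ κ) : Common P Q γ 1 := by
  intro ε hε F₀
  refine ⟨∅, by simp, Eventually.of_forall fun s => ?_⟩
  have : noDivisorSet P γ ∅ (1 : G) = ∅ := by
    rw [Set.eq_empty_iff_forall_notMem]
    rintro a ⟨-, h⟩
    exact h ⟨1, one_dvd _, fun p hp h => absurd (Nat.dvd_one.1 h) hp.one_lt.ne', E.map_one⟩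
  rw [this]
  simp [dm, hε.le]

lemma Equi.common_mul (E : Equi P Q γ κ) {h₁ h₂ : G} (H₁ : Common P Q γ h₁)
    (H₂ : Common P Q γ h₂) : Common P Q γ (h₁ * h₂) := by
  classical
  intro ε hε F₀
  obtain ⟨F₁, hd₁, hF₁⟩ := H₁ (ε / 2) (by positivity) F₀
  obtain ⟨F₂, hd₂, hF₂⟩ := H₂ (ε / 2) (by positivity) (F₀ ∪ F₁)
  rw [Finset.disjoint_union_left] at hd₂
  refine ⟨F₁ ∪ F₂, Finset.disjoint_union_right.2 ⟨hd₁, hd₂.1⟩, ?_⟩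
  have hsub : noDivisorSet P γ (F₁ ∪ F₂) (h₁ * h₂) ⊆ noDivisorSet P γ F₁ h₁ ∪ noDivisorSet P γ F₂ h₂ := by
    rintro a ⟨ha, hn⟩
    by_contra hcon
    simp only [Set.mem_union, not_or, noDivisorSet, Set.mem_ofPred_eq, not_and, not_not] at hcon
    obtain ⟨d, hd, hdF, rfl⟩ := hcon.1 ha
    obtain ⟨e, he, heF, rfl⟩ := hcon.2 ha
    have hc : d.Coprime e := Nat.Coprime.symm (Nat.coprime_of_dvd fun p hp h1 h2 =>
      Finset.disjoint_left.1 hd₂.2 (hdF p hp h2) (heF p hp h1))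
    refine hn ⟨d * e, hc.mul_dvd_of_dvd_of_dvd hd he, fun p hp h => ?_,
      E.mul d e (ne_zero_of_dvd_ne_zero ha.1 hd) (ne_zero_of_dvd_ne_zero ha.1 he)⟩
    rcases hp.dvd_mul.1 h with h | h
    · exact Finset.mem_union_left _ (hdF p hp h)
    · exact Finset.mem_union_right _ (heF p hp h)
  filter_upwards [hF₁, hF₂, eventually_one_lt] with s h1 h2 hs
  calc _ ≤ rho Q s * (dm s (noDivisorSet P γ F₁ h₁) + dm s (noDivisorSet P γ F₂ h₂)) := by
        gcongr
        · exact rho_nonneg _ _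
        · exact (dm_mono hs hsub).trans (dm_union_le hs _ _)
    _ ≤ ε := by rw [mul_add]; linarith

lemma exists_finset_sum_gt {S : Set ℕ} (h : ¬ Summable fun p : S => ((p : ℕ) : ℝ)⁻¹)
    (F₀ : Finset ℕ) (M : ℝ) :
    ∃ F : Finset ℕ, (∀ p ∈ F, p ∈ S) ∧ Disjoint F₀ F ∧ M < ∑ p ∈ F, (p : ℝ)⁻¹ := by
  classical
  by_contra hcon
  push Not at hcon
  refine h (summable_of_sum_le (c := M + ∑ p ∈ F₀, (p : ℝ)⁻¹) (fun _ => by positivity) fun u => ?_)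
  have e : ∑ p ∈ u, ((p : ℕ) : ℝ)⁻¹ = ∑ p ∈ u.map (Function.Embedding.subtype _), (p : ℝ)⁻¹ := by
    simp
  rw [e, ← Finset.sdiff_union_inter (u.map (Function.Embedding.subtype _)) F₀,
    Finset.sum_union (Finset.disjoint_sdiff_inter _ _)]
  refine add_le_add (hcon _ (fun p hp => ?_) ?_) ?_
  · have := (Finset.mem_sdiff.1 hp).1
    simp only [Finset.mem_map, Function.Embedding.subtype_apply, Subtype.exists] at this
    obtain ⟨q, hq, -, rfl⟩ := this
    exact hq
  · exact Finset.disjoint_sdiff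
  · exact Finset.sum_le_sum_of_subset_of_nonneg Finset.inter_subset_right
      fun _ _ _ => by positivity

lemma prod_one_sub_le (F : Finset ℕ) (hF : ∀ p ∈ F, p ≠ 0) :
    ∏ p ∈ F, (1 - (p : ℝ)⁻¹) ≤ Real.exp (-∑ p ∈ F, (p : ℝ)⁻¹) := by
  rw [← Finset.sum_neg_distrib, Real.exp_sum]
  refine Finset.prod_le_prod (fun p hp => ?_) fun p hp => ?_
  · rw [sub_nonneg]
    exact inv_le_one_of_one_le₀ (by exact_mod_cast Nat.one_le_iff_ne_zero.2 (hF p hp))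
  · have := Real.add_one_le_exp (-(p : ℝ)⁻¹)
    linarith

lemma Equi.common_of_not_summable (E : Equi P Q γ κ) {g : G}
    (h : ¬ Summable fun p : {p | P p ∧ γ p = g} => ((p : ℕ) : ℝ)⁻¹) : Common P Q γ g := by
  classical
  intro ε hε F₀
  set n : ℝ := ((Fintype.card G : ℕ) : ℝ) with hn
  set lam := √(κ / n) with hl
  have hlim : Tendsto (fun M : ℝ => n * (lam * Real.exp (-M))) atTop (𝓝 (n * (lam * 0))) :=
    ((Real.tendsto_exp_neg_atTop_nhds_zero).const_mul _).const_mul _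
  rw [mul_zero, mul_zero] at hlim
  obtain ⟨M, hM⟩ := (hlim.eventually (gt_mem_nhds hε)).exists
  obtain ⟨F, hFS, hdis, hsum⟩ := exists_finset_sum_gt h F₀ M
  refine ⟨F, hdis, ?_⟩
  have hlt := E.tendsto_avoid_sum F (fun p hp => (hFS p hp).1) Finset.univ
  have hle : n * (lam * ∏ p ∈ F, (1 - (p : ℝ)⁻¹)) < ε := by
    refine lt_of_le_of_lt ?_ hM
    gcongr
    refine (prod_one_sub_le F fun p hp => (E.primeP p (hFS p hp).1).ne_zero).trans ?_
    gcongr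
  rw [Finset.card_univ] at hlt
  filter_upwards [hlt.eventually (gt_mem_nhds hle), eventually_one_lt] with s h1 hs
  refine le_trans ?_ h1.le
  gcongr
  · exact rho_nonneg _ _
  · refine dm_mono hs ?_
    rintro a ⟨ha, hno⟩
    refine ⟨⟨ha, fun p hp hpa => hno ⟨p, hpa, fun q hq hqp => ?_, (hFS p hp).2⟩⟩,
      Finset.mem_univ _⟩
    rwa [(Nat.prime_dvd_prime_iff_eq hq (E.primeP p (hFS p hp).1)).1 hqp]

/-- The subgroup of common classes. -/
def Equi.commonSubgroup (E : Equi P Q γ κ) : Subgroup G where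
  carrier := {h | Common P Q γ h}
  mul_mem' := E.common_mul
  one_mem' := E.common_one
  inv_mem' := by
    intro h hh
    have hpow : ∀ k : ℕ, Common P Q γ (h ^ k) := by
      intro k
      induction k with
      | zero => rw [pow_zero]; exact E.common_one
      | succ k ih => rw [pow_succ]; exact E.common_mul ih hh
    have : h⁻¹ = h ^ (Fintype.card G - 1) := by
      rw [inv_eq_iff_mul_eq_one, ← pow_succ', Nat.sub_add_cancel Fintype.card_pos, pow_card_eq_one]
    rw [Set.mem_ofPred_eq, this]
    exact hpow _

lemma Equi.map_mem (E : Equi P Q γ κ) (H : Subgroup G) {a : ℕ} (ha : Smooth P a)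
    (h : ∀ p, p.Prime → p ∣ a → γ p ∈ H) : γ a ∈ H := by
  induction ha using Smooth.induction with
  | one => rw [E.map_one]; exact H.one_mem
  | mul p m hp hPp hm ih =>
    rw [E.mul p m hp.ne_zero hm.1]
    exact H.mul_mem (h p hp (Dvd.intro _ rfl)) (ih fun q hq hqm => h q hq (hqm.mul_left p))

lemma Equi.commonSubgroup_eq_top (E : Equi P Q γ κ) : E.commonSubgroup = ⊤ := by
  classical
  by_contra hne
  set H := E.commonSubgroup with hH
  have hS : Summable fun p : {p | P p ∧ γ p ∉ H} => ((p : ℕ) : ℝ)⁻¹ := by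
    have e : ({p | P p ∧ γ p ∉ H} : Set ℕ).indicator (fun p : ℕ => (p : ℝ)⁻¹) =
        fun p => ∑ g ∈ Finset.univ.filter (· ∉ H),
          ({p | P p ∧ γ p = g} : Set ℕ).indicator (fun p : ℕ => (p : ℝ)⁻¹) p := by
      ext p
      by_cases hp : P p ∧ γ p ∉ H
      · rw [Set.indicator_of_mem (show p ∈ {q | P q ∧ γ q ∉ H} from hp),
          Finset.sum_eq_single (γ p)]
        · rw [Set.indicator_of_mem (show p ∈ {q | P q ∧ γ q = γ p} from ⟨hp.1, rfl⟩)]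
        · intro g _ hg
          exact Set.indicator_of_notMem (fun h => hg h.2.symm) _
        · intro h
          simp [hp.2] at h
      · rw [Set.indicator_of_notMem (show p ∉ {q | P q ∧ γ q ∉ H} from hp), eq_comm]
        refine Finset.sum_eq_zero fun g hg => Set.indicator_of_notMem (fun h => hp ⟨h.1, ?_⟩) _
        rw [h.2]
        exact (Finset.mem_filter.1 hg).2
    refine (summable_subtype_iff_indicator (f := fun p : ℕ => (p : ℝ)⁻¹)).2 ?_
    rw [e]
    refine summable_sum fun g hg => ?_
    refine (summable_subtype_iff_indicator (f := fun p : ℕ => (p : ℝ)⁻¹)).1 ?_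
    by_contra hns
    exact (Finset.mem_filter.1 hg).2 (E.common_of_not_summable hns)
  obtain ⟨F, hF⟩ := ((tendsto_order.1 (tendsto_tsum_compl_atTop_zero
    (fun p : {p | P p ∧ γ p ∉ H} => ((p : ℕ) : ℝ)⁻¹))).2 (1 / 4) (by norm_num)).exists
  set F' : Finset ℕ := F.map (Function.Embedding.subtype _) with hF'
  have hF'P : ∀ p ∈ F', P p ∧ γ p ∉ H := by
    intro p hp
    simp only [hF', Finset.mem_map, Function.Embedding.subtype_apply, Subtype.exists] at hp
    obtain ⟨q, hq, -, rfl⟩ := hp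
    exact hq
  set R : Set ℕ := {p | (P p ∧ γ p ∉ H) ∧ p ∉ F'} with hR
  have hdmR : ∀ s : ℝ, 1 < s → dm s R ≤ 1 / 4 := by
    intro s hs
    refine le_trans ?_ hF.le
    have hinj : Function.Injective (fun p : R => (⟨⟨p.1, p.2.1⟩, fun hp => p.2.2 (by
      rw [hF', Finset.mem_map]; exact ⟨_, hp, rfl⟩)⟩ :
        {x : {p | P p ∧ γ p ∉ H} // x ∉ F})) := by
      intro p q hpq
      simp only [Subtype.mk.injEq] at hpq
      exact Subtype.ext hpq
    refine Summable.tsum_le_tsum_of_inj _ hinj (fun _ _ => by positivity) (fun p => ?_)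
      (summable_dm hs R) (hS.comp_injective Subtype.val_injective)
    have : 1 ≤ ((p : ℕ) : ℝ) := by exact_mod_cast (E.primeP _ p.2.1.1).one_lt.le
    change _ ≤ ((p : ℕ) : ℝ)⁻¹
    rw [← Real.rpow_neg_one]
    exact Real.rpow_le_rpow_of_exponent_le this (by linarith)
  set I : Finset G := Finset.univ.filter (· ∉ H) with hI
  have hbad : ∀ s : ℝ, 1 < s → rho Q s * dm s (smoothSet P F' ∩ {a | γ a ∈ I}) ≤
      1 / 4 * (rho Q s * dm s (smoothSet P F' ∩ {a | γ a ∈ (Finset.univ : Finset G)})) := by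
    intro s hs
    have : dm s (smoothSet P F' ∩ {a | γ a ∈ I}) ≤ dm s R *
        dm s (smoothSet P F' ∩ {a | γ a ∈ (Finset.univ : Finset G)}) := by
      refine dm_le_mul hs ?_
      rintro a ⟨⟨ha, haF⟩, haI⟩
      have haI' : γ a ∉ H := (Finset.mem_filter.1 haI).2
      have : ∃ p, p.Prime ∧ p ∣ a ∧ γ p ∉ H := by
        by_contra hcon
        push Not at hcon
        exact haI' (E.map_mem H ha hcon)
      obtain ⟨p, hp, ⟨b, rfl⟩, hpH⟩ := this
      exact ⟨p, ⟨⟨ha.2 p hp (Dvd.intro _ rfl), hpH⟩, fun h => haF p h (Dvd.intro _ rfl)⟩, b,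
        ⟨⟨ha.of_dvd (Dvd.intro_left p rfl), fun q hq h => haF q hq (h.mul_left p)⟩,
          Finset.mem_univ _⟩, rfl⟩
    calc _ ≤ rho Q s * (1 / 4 * dm s (smoothSet P F' ∩ {a | γ a ∈ (Finset.univ : Finset G)})) := by
          refine mul_le_mul_of_nonneg_left (this.trans ?_) (rho_nonneg _ _)
          exact mul_le_mul_of_nonneg_right (hdmR s hs) (dm_nonneg _ _)
      _ = _ := by ring
  have h1 := E.tendsto_avoid_sum F' (fun p hp => (hF'P p hp).1) I
  have h2 := (E.tendsto_avoid_sum F' (fun p hp => (hF'P p hp).1) Finset.univ).const_mul (1 / 4)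
  have hle := le_of_tendsto_of_tendsto h1 h2 (by
    filter_upwards [eventually_one_lt] with s hs using hbad s hs)
  have hpos : 0 < √(κ / Fintype.card G) * ∏ p ∈ F', (1 - (p : ℝ)⁻¹) := by
    refine mul_pos (Real.sqrt_pos.2 (div_pos E.pos (by exact_mod_cast Fintype.card_pos)))
      (Finset.prod_pos fun p hp => ?_)
    rw [sub_pos]
    exact inv_lt_one_of_one_lt₀ (by exact_mod_cast (E.primeP p (hF'P p hp).1).one_lt)
  rw [← mul_assoc (1 / 4 : ℝ), mul_le_mul_iff_of_pos_right hpos, Finset.card_univ] at hle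
  have hcard : (Finset.univ.filter (· ∈ H)).card + I.card = Fintype.card G := by
    rw [hI, Finset.card_filter_add_card_filter_not, Finset.card_univ]
  have hHI : (Finset.univ.filter (· ∈ H)).card ≤ I.card := by
    obtain ⟨x, hx⟩ : ∃ x, x ∉ H := by
      by_contra hcon
      push Not at hcon
      exact hne (Subgroup.eq_top_iff' _ |>.2 hcon)
    refine Finset.card_le_card_of_injOn (x * ·) (fun h hh => ?_) (fun a _ b _ h => by simpa using h)
    have hh' : h ∈ H := by simpa using hh
    simp [hI, H.mul_mem_cancel_right hh', hx]
  have h4 : 4 * I.card ≤ Fintype.card G := by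
    have : (4 : ℝ) * I.card ≤ Fintype.card G := by linarith
    exact_mod_cast this
  have := Fintype.card_pos (α := G)
  omega

end Core

section Core

variable {G : Type*} [CommGroup G] {P Q : ℕ → Prop} {γ : ℕ → G} {κ : ℝ} [Fintype G]

lemma smooth_mul_sq_inj (hPQ : ∀ p, P p → ¬ Q p) {a k b l : ℕ} (ha : Smooth P a)
    (hk : Smooth Q k) (hb : Smooth P b) (hl : Smooth Q l) (h : a * k ^ 2 = b * l ^ 2) :
    a = b ∧ k = l := by
  have hc : ∀ {a k : ℕ}, Smooth P a → Smooth Q k → a.Coprime (k ^ 2) := by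
    intro a k ha hk
    exact Nat.Coprime.pow_right 2 (Nat.coprime_of_dvd fun p hp h1 h2 =>
      hPQ p (ha.2 p hp h1) (hk.2 p hp h2))
  have hab : a = b := Nat.dvd_antisymm
    ((hc ha hl).dvd_of_dvd_mul_right (h ▸ Dvd.intro _ rfl))
    ((hc hb hk).dvd_of_dvd_mul_right (h ▸ Dvd.intro _ rfl))
  subst hab
  exact ⟨rfl, Nat.pow_left_injective two_ne_zero
    (Nat.eq_of_mul_eq_mul_left (Nat.pos_of_ne_zero ha.1) h)⟩

lemma dm_mul_le {s : ℝ} (hs : 1 < s) {N K A : Set ℕ} (hA : ∀ a ∈ N, ∀ k ∈ K, a * k ^ 2 ∈ A)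
    (hinj : ∀ a ∈ N, ∀ k ∈ K, ∀ b ∈ N, ∀ l ∈ K, a * k ^ 2 = b * l ^ 2 → a = b ∧ k = l) :
    dm s N * dm (2 * s) K ≤ dm s A := by
  have h2s : 1 < 2 * s := by linarith
  have hp : Summable fun x : N × K => ((x.1 : ℕ) : ℝ) ^ (-s) * ((x.2 : ℕ) : ℝ) ^ (-(2 * s)) :=
    (summable_dm hs N).mul_of_nonneg (summable_dm h2s K) (fun _ => by positivity)
      (fun _ => by positivity)
  rw [dm, dm, dm, (summable_dm hs N).tsum_mul_tsum (summable_dm h2s K) hp]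
  refine Summable.tsum_le_tsum_of_inj
    (fun x : N × K => (⟨x.1 * x.2 ^ 2, hA _ x.1.2 _ x.2.2⟩ : A)) ?_
    (fun _ _ => by positivity) (fun x => le_of_eq ?_) hp (summable_dm hs A)
  · rintro ⟨a, k⟩ ⟨b, l⟩ h
    have := hinj a a.2 k k.2 b b.2 l l.2 (congrArg Subtype.val h)
    exact Prod.ext (Subtype.ext this.1) (Subtype.ext this.2)
  · push_cast
    rw [Real.mul_rpow (by positivity) (by positivity), ← Real.rpow_natCast, ← Real.rpow_mul
      (by positivity)]
    push_cast
    rw [mul_neg]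

/-- The smooth numbers `a = a₁ a₂` with `γ(a₁) γ(a₂)⁻¹ = c`. -/
def splitSet (P : ℕ → Prop) (γ : ℕ → G) (c : G) : Set ℕ :=
  {a | ∃ x y, Smooth P x ∧ Smooth P y ∧ a = x * y ∧ γ x * (γ y)⁻¹ = c}

lemma one_le_dm_smooth {s : ℝ} (hs : 1 < s) (Q : ℕ → Prop) : 1 ≤ dm s {k | Smooth Q k} := by
  have h : dm s {1} ≤ dm s {k | Smooth Q k} :=
    dm_mono hs (by rintro _ rfl; exact smooth_one Q)
  have e : dm s {1} = 1 := by
    rw [dm]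
    simp
  linarith

theorem Equi.eventually_le [DecidableEq G] (E : Equi P Q γ κ) (c : G) {δ : ℝ}
    (hδ : δ < (Finset.univ.image fun h : G => h ^ 2).card * √(κ / Fintype.card G)) :
    ∀ᶠ s in 𝓝[>] 1, δ ≤ √(s - 1) * dm s (tval '' tripSet P Q γ c) := by
  set I : Finset G := Finset.univ.image fun h : G => c * h ^ 2 with hI
  have hIcard : I.card = (Finset.univ.image fun h : G => h ^ 2).card := by
    rw [hI, show (fun h : G => c * h ^ 2) = (c * ·) ∘ fun h => h ^ 2 from rfl, ← Finset.image_image,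
      Finset.card_image_of_injective _ (mul_right_injective c)]
  set lim : ℝ := (Finset.univ.image fun h : G => h ^ 2).card * √(κ / Fintype.card G) with hlim
  have h1 := E.tendsto_avoid_sum ∅ (by simp) I
  rw [Finset.prod_empty, mul_one, hIcard, ← hlim] at h1
  set n : ℝ := ((Fintype.card G : ℕ) : ℝ) with hn
  have hn0 : 0 < n := by rw [hn]; exact_mod_cast Fintype.card_pos
  set ε := (lim - δ) / 2 / n with hε
  have hε0 : 0 < ε := by
    have : 0 < lim - δ := by linarith
    positivity
  have hcom : ∀ h, Common P Q γ h := fun h => by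
    have : h ∈ E.commonSubgroup := by rw [E.commonSubgroup_eq_top]; trivial
    exact this
  choose F hF using fun h => hcom h ε hε0 ∅
  have hev := eventually_all.2 fun h => (hF h).2
  filter_upwards [hev, h1.eventually (lt_mem_nhds (show (lim + δ) / 2 < lim by linarith)),
    eventually_one_lt] with s hj h2 hs
  have h2s : 1 < 2 * s := by linarith
  have hsub : smoothSet P ∅ ∩ {a | γ a ∈ I} ⊆
      splitSet P γ c ∪ ⋃ h ∈ (Finset.univ : Finset G), noDivisorSet P γ (F h) h := by
    rintro a ⟨⟨ha, -⟩, haI⟩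
    obtain ⟨h, -, hh⟩ := Finset.mem_image.1 haI
    by_cases hjk : a ∈ noDivisorSet P γ (F h) h
    · exact Or.inr (Set.mem_iUnion₂.2 ⟨h, Finset.mem_univ _, hjk⟩)
    · left
      simp only [noDivisorSet, Set.mem_ofPred_eq, not_and, not_not] at hjk
      obtain ⟨d, ⟨e, rfl⟩, -, rfl⟩ := hjk ha
      have hd := ha.of_dvd (Dvd.intro _ rfl)
      have he := ha.of_dvd (Dvd.intro_left _ rfl)
      refine ⟨e, d, he, hd, mul_comm _ _, ?_⟩
      rw [E.mul d e hd.1 he.1, sq, ← mul_assoc, mul_comm (γ d) (γ e)] at hh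
      rw [← mul_right_cancel hh, mul_inv_cancel_right]
  have hle : rho Q s * dm s (smoothSet P ∅ ∩ {a | γ a ∈ I}) ≤
      rho Q s * dm s (splitSet P γ c) + n * ε := by
    calc _ ≤ rho Q s * (dm s (splitSet P γ c) + ∑ h : G, dm s (noDivisorSet P γ (F h) h)) := by
          refine mul_le_mul_of_nonneg_left ?_ (rho_nonneg _ _)
          exact (dm_mono hs hsub).trans ((dm_union_le hs _ _).trans
            (by gcongr; exact dm_biUnion_le hs _ _))
      _ = rho Q s * dm s (splitSet P γ c) + ∑ h : G, rho Q s * dm s (noDivisorSet P γ (F h) h) := by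
          rw [mul_add, Finset.mul_sum]
      _ ≤ rho Q s * dm s (splitSet P γ c) + ∑ h : G, ε := by gcongr with h _; exact hj h
      _ = _ := by rw [Finset.sum_const, Finset.card_univ, nsmul_eq_mul]
  have hnε : n * ε = (lim - δ) / 2 := by rw [hε]; field_simp
  have hA : dm s (splitSet P γ c) * dm (2 * s) {k | Smooth Q k} ≤
      dm s (tval '' tripSet P Q γ c) := by
    refine dm_mul_le hs ?_ ?_
    · rintro a ⟨x, y, hx, hy, rfl, hc⟩ k hk
      exact ⟨(x, y, k), ⟨hx, hy, hk, hc⟩, rfl⟩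
    · rintro a ⟨x, y, hx, hy, rfl, -⟩ k hk b ⟨x', y', hx', hy', rfl, -⟩ l hl h
      exact smooth_mul_sq_inj E.disj (hx.mul hy) hk (hx'.mul hy') hl h
  have hK := one_le_dm_smooth h2s Q
  have hrho : rho Q s ≤ √(s - 1) * dm (2 * s) {k | Smooth Q k} := by
    rw [rho, Real.sqrt_mul (by linarith)]
    gcongr
    rw [Real.sqrt_le_left (by linarith)]
    nlinarith
  calc δ ≤ rho Q s * dm s (splitSet P γ c) := by linarith
    _ ≤ √(s - 1) * dm (2 * s) {k | Smooth Q k} * dm s (splitSet P γ c) :=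
        mul_le_mul_of_nonneg_right hrho (dm_nonneg _ _)
    _ = √(s - 1) * (dm s (splitSet P γ c) * dm (2 * s) {k | Smooth Q k}) := by ring
    _ ≤ _ := mul_le_mul_of_nonneg_left hA (Real.sqrt_nonneg _)

lemma card_image_sq_mul [DecidableEq G] :
    (Finset.univ.image fun h : G => h ^ 2).card * Nat.card {h : G // h ^ 2 = 1} =
      Fintype.card G := by
  have h1 := Subgroup.card_eq_card_quotient_mul_card_subgroup (powMonoidHom 2 : G →* G).ker
  rw [Nat.card_congr (QuotientGroup.quotientKerEquivRange (powMonoidHom 2 : G →* G)).toEquiv,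
    Nat.card_eq_fintype_card] at h1
  rw [h1]
  congr 1
  · rw [← Nat.card_eq_finsetCard]
    refine Nat.card_congr (Equiv.subtypeEquivRight fun x => ?_)
    simp

theorem Equi.eventually_le' (E : Equi P Q γ κ) (c : G) {δ : ℝ}
    (hδ : δ < √(κ / Nat.card {h : G // h ^ 2 = 1})) :
    ∀ᶠ s in 𝓝[>] 1, δ ≤ √(s - 1) * dm s (tval '' tripSet P Q γ c) := by
  classical
  refine E.eventually_le c (hδ.trans_le ?_)
  have h := card_image_sq_mul (G := G)
  have hpos := Fintype.card_pos (α := G)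
  set r := (Finset.univ.image fun h : G => h ^ 2).card
  set t := Nat.card {h : G // h ^ 2 = 1}
  have hr : 1 ≤ r := Nat.one_le_iff_ne_zero.2 (by rintro h0; rw [h0] at h; omega)
  have ht : 0 < t := Nat.pos_of_ne_zero (by rintro h0; rw [h0] at h; omega)
  rw [← h]
  refine Real.sqrt_le_iff.2 ⟨by positivity, ?_⟩
  have hr' : (1 : ℝ) ≤ r := by exact_mod_cast hr
  have ht' : (0 : ℝ) < t := by exact_mod_cast ht
  have hκ := E.pos
  rw [mul_pow, Real.sq_sqrt (by positivity)]
  push_cast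
  rw [show (r : ℝ) ^ 2 * (κ / (r * t)) = r * (κ / t) by field_simp]
  exact le_mul_of_one_le_left (by positivity) hr'

end Core

section Abel

variable {s : ℝ}

lemma integral_exp_Ioi_log (hs : 0 < s) {n : ℕ} (hn : n ≠ 0) :
    IntegrableOn (fun t => s * (Set.Ici (Real.log n)).indicator (fun t => Real.exp (-s * t)) t)
      (Set.Ioi 0) ∧
    ∫ t in Set.Ioi 0, s * (Set.Ici (Real.log n)).indicator (fun t => Real.exp (-s * t)) t =
      (n : ℝ) ^ (-s) := by
  have hn' : (0 : ℝ) < n := by exact_mod_cast Nat.pos_of_ne_zero hn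
  have hlog : 0 ≤ Real.log n := Real.log_natCast_nonneg n
  have hexp : IntegrableOn (fun t => Real.exp (-s * t)) (Set.Ioi 0) :=
    integrableOn_exp_mul_Ioi (by linarith) 0
  refine ⟨(hexp.indicator measurableSet_Ici).const_mul s, ?_⟩
  rw [integral_const_mul, setIntegral_indicator measurableSet_Ici]
  have : ∫ t in Set.Ioi 0 ∩ Set.Ici (Real.log n), Real.exp (-s * t) =
      ∫ t in Set.Ioi (Real.log n), Real.exp (-s * t) := by
    refine setIntegral_congr_set ?_
    have h1 : (Set.Ioi 0 ∩ Set.Ici (Real.log n) : Set ℝ) =ᵐ[volume]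
        (Set.Ici 0 ∩ Set.Ici (Real.log n) : Set ℝ) :=
      Ioi_ae_eq_Ici.inter (ae_eq_refl _)
    refine h1.trans ?_
    rw [Set.inter_eq_right.2 (Set.Ici_subset_Ici.2 hlog)]
    exact Ioi_ae_eq_Ici.symm
  rw [this, integral_exp_mul_Ioi (by linarith), Real.rpow_def_of_pos hn', mul_comm (Real.log n)]
  field_simp

lemma integral_gamma_half {r : ℝ} (hr : 0 < r) :
    IntegrableOn (fun t : ℝ => t ^ ((1 / 2 : ℝ) - 1) * Real.exp (-(r * t))) (Set.Ioi 0) ∧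
    ∫ t in Set.Ioi 0, t ^ ((1 / 2 : ℝ) - 1) * Real.exp (-(r * t)) = √π / √r := by
  have h : ∫ t in Set.Ioi 0, t ^ ((1 / 2 : ℝ) - 1) * Real.exp (-(r * t)) = √π / √r := by
    rw [Real.integral_rpow_mul_exp_neg_mul_Ioi (by norm_num) hr, Real.Gamma_one_half_eq,
      ← Real.sqrt_eq_rpow, Real.sqrt_div' _ hr.le, Real.sqrt_one]
    ring
  refine ⟨Integrable.of_integral_ne_zero ?_, h⟩
  rw [h]
  positivity

/-- Abelian estimate: a counting function bounded by `M + C e^t t^{-1/2}` gives a bound for the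
Dirichlet mass. -/
lemma dm_le_of_count_le (hs : 1 < s) {S : Set ℕ} (hS : ∀ n ∈ S, n ≠ 0) {M C : ℝ}
    (h : ∀ t : ℝ, 0 < t → (Set.ncard {n : ℕ | n ∈ S ∧ (n : ℝ) ≤ Real.exp t} : ℝ) ≤
      M + C * (Real.exp t * t ^ ((1 / 2 : ℝ) - 1))) :
    dm s S ≤ M + s * C * (√π / √(s - 1)) := by
  have hs0 : 0 < s := by linarith
  refine (summable_dm hs S).tsum_le_of_sum_le fun u => ?_
  have hu : ∀ n ∈ u, ((n : ℕ) : ℝ) ^ (-s) = ∫ t in Set.Ioi 0,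
      s * (Set.Ici (Real.log (n : ℕ))).indicator (fun t => Real.exp (-s * t)) t :=
    fun n _ => (integral_exp_Ioi_log hs0 (hS n n.2)).2.symm
  have hi : ∀ n ∈ u, IntegrableOn (fun t => s * (Set.Ici (Real.log (n : ℕ))).indicator
      (fun t => Real.exp (-s * t)) t) (Set.Ioi 0) :=
    fun n _ => (integral_exp_Ioi_log hs0 (hS n n.2)).1
  rw [Finset.sum_congr rfl hu, ← integral_finsetSum _ hi]
  obtain ⟨hg1, hg2⟩ := integral_gamma_half (r := s - 1) (by linarith)
  have he1 : IntegrableOn (fun t => Real.exp (-s * t)) (Set.Ioi 0) :=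
    integrableOn_exp_mul_Ioi (by linarith) 0
  have he2 : ∫ t in Set.Ioi 0, Real.exp (-s * t) = 1 / s := by
    rw [integral_exp_mul_Ioi (by linarith)]
    simp
  have hmaj : ∫ t in Set.Ioi 0, (s * M * Real.exp (-s * t) +
      s * C * (t ^ ((1 / 2 : ℝ) - 1) * Real.exp (-((s - 1) * t)))) =
      M + s * C * (√π / √(s - 1)) := by
    rw [integral_add (he1.const_mul _) (hg1.const_mul _), integral_const_mul, integral_const_mul,
      he2, hg2]
    field_simp
  rw [← hmaj]
  refine setIntegral_mono_on (integrable_finsetSum _ hi) ((he1.const_mul _).add (hg1.const_mul _))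
    measurableSet_Ioi fun t ht => ?_
  have ht : 0 < t := ht
  classical
  have hfin : {n : ℕ | n ∈ S ∧ (n : ℝ) ≤ Real.exp t}.Finite :=
    (Set.finite_Iic ⌊Real.exp t⌋₊).subset fun n hn => Nat.le_floor hn.2
  have hcount : ∑ n ∈ u, s * (Set.Ici (Real.log (n : ℕ))).indicator
      (fun t => Real.exp (-s * t)) t =
      s * Real.exp (-s * t) * (u.filter fun n : S => Real.log (n : ℕ) ≤ t).card := by
    rw [Finset.card_filter, Nat.cast_sum, Finset.mul_sum]
    refine Finset.sum_congr rfl fun n _ => ?_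
    by_cases hn : Real.log (n : ℕ) ≤ t
    · rw [Set.indicator_of_mem (show t ∈ Set.Ici _ from hn)]; simp [hn]
    · rw [Set.indicator_of_notMem (show t ∉ Set.Ici _ from hn)]; simp [hn]
  have hcard : ((u.filter fun n : S => Real.log (n : ℕ) ≤ t).card : ℝ) ≤
      M + C * (Real.exp t * t ^ ((1 / 2 : ℝ) - 1)) := by
    refine le_trans ?_ (h t ht)
    rw [← Finset.card_map (Function.Embedding.subtype _), ← Set.ncard_coe_finset]
    refine Nat.cast_le.2 (Set.ncard_le_ncard (fun n hn => ?_) hfin)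
    · simp only [Finset.coe_map, Function.Embedding.subtype_apply, Set.mem_image,
        Finset.mem_coe, Finset.mem_filter] at hn
      obtain ⟨m, ⟨-, hm⟩, rfl⟩ := hn
      exact ⟨m.2, (Real.log_le_iff_le_exp (by
        exact_mod_cast Nat.pos_of_ne_zero (hS m m.2))).1 hm⟩
  rw [hcount]
  calc _ ≤ s * Real.exp (-s * t) * (M + C * (Real.exp t * t ^ ((1 / 2 : ℝ) - 1))) :=
        mul_le_mul_of_nonneg_left hcard (by positivity)
    _ = _ := by
        rw [show -((s - 1) * t) = -s * t + t by ring, Real.exp_add]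
        ring

theorem le_of_eventually_le_dm {S : Set ℕ} (hS : ∀ n ∈ S, n ≠ 0) {C δ : ℝ}
    (hC : Tendsto (fun x : ℝ => (Set.ncard {n : ℕ | n ∈ S ∧ (n : ℝ) ≤ x} : ℝ) *
      √(Real.log x) / x) atTop (𝓝 C))
    (hδ : ∀ᶠ s in 𝓝[>] 1, δ ≤ √(s - 1) * dm s S) : δ ≤ C * √π := by
  have hfin : ∀ x : ℝ, {n : ℕ | n ∈ S ∧ (n : ℝ) ≤ x}.Finite := fun x =>
    (Set.finite_Iic ⌊x⌋₊).subset fun n hn => Nat.le_floor hn.2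
  have hC0 : 0 ≤ C := ge_of_tendsto hC (by
    filter_upwards [eventually_gt_atTop 0] with x hx
    positivity)
  have key : ∀ C' : ℝ, C < C' → δ ≤ C' * √π := by
    intro C' hC'
    have hC'0 : 0 < C' := hC0.trans_lt hC'
    obtain ⟨x₀, hx₀⟩ := eventually_atTop.1 ((hC.eventually (gt_mem_nhds hC')).and
      (eventually_gt_atTop 1))
    set M : ℝ := ((Set.ncard {n : ℕ | n ∈ S ∧ (n : ℝ) ≤ x₀} : ℕ) : ℝ) with hM
    have hcount : ∀ t : ℝ, 0 < t → (Set.ncard {n : ℕ | n ∈ S ∧ (n : ℝ) ≤ Real.exp t} : ℝ) ≤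
        M + C' * (Real.exp t * t ^ ((1 / 2 : ℝ) - 1)) := by
      intro t ht
      have hpos : 0 ≤ C' * (Real.exp t * t ^ ((1 / 2 : ℝ) - 1)) := by positivity
      rcases le_total x₀ (Real.exp t) with hx | hx
      · have h1 := (hx₀ _ hx).1
        rw [Real.log_exp, div_lt_iff₀ (Real.exp_pos t)] at h1
        have h2 : t ^ ((1 / 2 : ℝ) - 1) = (√t)⁻¹ := by
          rw [show ((1 / 2 : ℝ) - 1) = -(1 / 2) by norm_num, Real.rpow_neg ht.le,
            ← Real.sqrt_eq_rpow]
        have h3 : (Set.ncard {n : ℕ | n ∈ S ∧ (n : ℝ) ≤ Real.exp t} : ℝ) ≤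
            C' * (Real.exp t * t ^ ((1 / 2 : ℝ) - 1)) := by
          rw [h2, ← mul_assoc, ← div_eq_mul_inv, le_div_iff₀ (Real.sqrt_pos.2 ht)]
          exact h1.le
        have : 0 ≤ M := by positivity
        linarith
      · have : (Set.ncard {n : ℕ | n ∈ S ∧ (n : ℝ) ≤ Real.exp t} : ℝ) ≤ M := by
          rw [hM]
          exact Nat.cast_le.2 (Set.ncard_le_ncard (fun n hn => ⟨hn.1, hn.2.trans hx⟩) (hfin _))
        linarith
    have hlim : Tendsto (fun s : ℝ => √(s - 1) * M + s * C' * √π) (𝓝[>] 1)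
        (𝓝 (√(1 - 1) * M + 1 * C' * √π)) := by
      refine Tendsto.mono_left ?_ nhdsWithin_le_nhds
      exact Continuous.tendsto (by fun_prop) 1
    rw [sub_self, Real.sqrt_zero, zero_mul, zero_add, one_mul] at hlim
    refine ge_of_tendsto hlim ?_
    filter_upwards [hδ, eventually_one_lt] with s h1 hs
    refine h1.trans ?_
    have hpos : 0 < √(s - 1) := Real.sqrt_pos.2 (by linarith)
    calc _ ≤ √(s - 1) * (M + s * C' * (√π / √(s - 1))) :=
          mul_le_mul_of_nonneg_left (dm_le_of_count_le hs hS hcount) hpos.le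
      _ = _ := by field_simp
  have hlim : Tendsto (fun C' : ℝ => C' * √π) (𝓝[>] C) (𝓝 (C * √π)) :=
    Tendsto.mono_left (Continuous.tendsto (by fun_prop) C) nhdsWithin_le_nhds
  exact ge_of_tendsto hlim (by filter_upwards [self_mem_nhdsWithin] with C' hC' using key C' hC')

end Abel

section Lattice

/-- The basis of `ℂ` whose integral span carries the form `a X² + b X Y + c Y²`. -/
lemma exists_basis_normSq (a b c : ℤ) (ha : 0 < a) (hD : b ^ 2 - 4 * a * c < 0) :
    ∃ B : Module.Basis (Fin 2) ℝ ℂ,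
      (∀ u v : ℤ, ‖(u : ℝ) • B 0 + (v : ℝ) • B 1‖ ^ 2 = ((a * u ^ 2 + b * u * v + c * v ^ 2 : ℤ) : ℝ)) ∧
      |Complex.basisOneI.det B| = √((4 * a * c - b ^ 2 : ℤ) : ℝ) / 2 := by
  have haR : (0 : ℝ) < a := by exact_mod_cast ha
  have hDR : (0 : ℝ) < ((4 * a * c - b ^ 2 : ℤ) : ℝ) := by exact_mod_cast (by linarith)
  obtain ⟨r, hr0, hr⟩ : ∃ r : ℝ, 0 < r ∧ r ^ 2 = a := ⟨√a, by positivity, Real.sq_sqrt haR.le⟩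
  obtain ⟨s, hs0, hs, hs'⟩ : ∃ s : ℝ, 0 < s ∧ s ^ 2 = ((4 * a * c - b ^ 2 : ℤ) : ℝ) ∧
      √((4 * a * c - b ^ 2 : ℤ) : ℝ) = s := ⟨_, by positivity, Real.sq_sqrt hDR.le, rfl⟩
  let v : Fin 2 → ℂ := ![⟨r, 0⟩, ⟨b / (2 * r), s / (2 * r)⟩]
  have hdet : Complex.basisOneI.det v = s / 2 := by
    rw [Module.Basis.det_apply, Matrix.det_fin_two]
    simp [Module.Basis.toMatrix_apply, v]
    field_simp
  have hu : IsUnit (Complex.basisOneI.det v) := by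
    rw [hdet]; exact (by positivity : s / 2 ≠ 0).isUnit
  rw [← Module.Basis.is_basis_iff_det] at hu
  refine ⟨Module.Basis.mk hu.1 hu.2.ge, fun x y => ?_, ?_⟩
  · simp only [Module.Basis.mk_apply, v, Complex.sq_norm, Complex.normSq_apply]
    simp
    push_cast at hs
    field_simp
    rw [← hr] at hs ⊢
    linear_combination (y : ℝ) ^ 2 * hs
  · rw [show ⇑(Module.Basis.mk hu.1 hu.2.ge) = v from Module.Basis.coe_mk _ _, hdet, hs',
      abs_of_pos (by positivity)]

lemma tendsto_card_form_le (a b c : ℤ) (ha : 0 < a) (hD : b ^ 2 - 4 * a * c < 0) :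
    Tendsto (fun x : ℝ => (Nat.card {p : ℤ × ℤ //
        ((a * p.1 ^ 2 + b * p.1 * p.2 + c * p.2 ^ 2 : ℤ) : ℝ) ≤ x} : ℝ) / x) atTop
      (𝓝 (2 * π / √((4 * a * c - b ^ 2 : ℤ) : ℝ))) := by
  obtain ⟨B, hB, hdet⟩ := exists_basis_normSq a b c ha hD
  have hset : {x : ℂ | x ∈ (Set.univ : Set ℂ) ∧ ‖x‖ ^ 2 ≤ 1} = Metric.closedBall 0 1 := by
    ext x
    simp
  have := ZLattice.covolume.tendsto_card_le_div' (Submodule.span ℤ (Set.range B))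
    (X := Set.univ) (F := fun z : ℂ => ‖z‖ ^ 2) (by simp)
    (by
      intro x r hr
      simp [mul_pow, Complex.finrank_real_complex])
    (by rw [hset]; exact Metric.isBounded_closedBall)
    (by rw [hset]; exact measurableSet_closedBall)
    (by
      rw [hset, frontier_closedBall _ one_ne_zero]
      exact Measure.addHaar_sphere _ _ _)
  rw [hset] at this
  have hcov : ZLattice.covolume (Submodule.span ℤ (Set.range B)) =
      √((4 * a * c - b ^ 2 : ℤ) : ℝ) / 2 := by
    rw [ZLattice.covolume_eq_measure_fundamentalDomain _ _ (ZSpan.isAddFundamentalDomain B volume),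
      ZSpan.measureReal_fundamentalDomain _ _ Complex.basisOneI, hdet,
      measureReal_congr (ZSpan.fundamentalDomain_ae_parallelepiped _ _), measureReal_def,
      ← Complex.toBasis_orthonormalBasisOneI, OrthonormalBasis.coe_toBasis,
      OrthonormalBasis.volume_parallelepiped]
    simp
  have hvol : volume.real (Metric.closedBall (0 : ℂ) 1) = π := by
    simp [measureReal_def, Complex.volume_closedBall]
  rw [hcov, hvol, show π / (√((4 * a * c - b ^ 2 : ℤ) : ℝ) / 2) =
    2 * π / √((4 * a * c - b ^ 2 : ℤ) : ℝ) by field_simp] at this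
  refine this.congr fun x => ?_
  have hmem (u v : ℤ) : (u : ℝ) • B 0 + (v : ℝ) • B 1 ∈ Submodule.span ℤ (Set.range B) := by
    rw [Int.cast_smul_eq_zsmul, Int.cast_smul_eq_zsmul]
    exact add_mem (Submodule.smul_mem _ _ (Submodule.subset_span ⟨0, rfl⟩))
      (Submodule.smul_mem _ _ (Submodule.subset_span ⟨1, rfl⟩))
  congr 2
  refine (Nat.card_congr (Equiv.ofBijective
    (fun p => ⟨(p.1.1 : ℝ) • B 0 + (p.1.2 : ℝ) • B 1, ⟨trivial, (hB _ _).trans_le p.2⟩, hmem _ _⟩)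
    ⟨?_, ?_⟩)).symm
  · rintro ⟨⟨u, v⟩, h⟩ ⟨⟨u', v'⟩, h'⟩ he
    have he : B.repr ((u : ℝ) • B 0 + (v : ℝ) • B 1) =
        B.repr ((u' : ℝ) • B 0 + (v' : ℝ) • B 1) := congrArg (fun z => B.repr z.1) he
    simp only [map_add, map_smul, Module.Basis.repr_self] at he
    have h0 := DFunLike.congr_fun he 0
    have h1 := DFunLike.congr_fun he 1
    simp at h0 h1
    simp [h0, h1]
  · rintro ⟨z, ⟨-, hz⟩, hL⟩
    rw [SetLike.mem_coe, Module.Basis.mem_span_iff_repr_mem] at hL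
    obtain ⟨u, hu⟩ := hL 0
    obtain ⟨v, hv⟩ := hL 1
    have hz' : (u : ℝ) • B 0 + (v : ℝ) • B 1 = z := by
      rw [← B.sum_repr z, Fin.sum_univ_two, ← hu, ← hv]
      rfl
    refine ⟨⟨(u, v), ?_⟩, Subtype.ext hz'⟩
    rw [← hB, hz']
    exact hz

end Lattice

section Sieve

/-- The form `a X² + b X Y + c Y²` as a function on pairs. -/
def qf (a b c : ℤ) (p : ℤ × ℤ) : ℤ := a * p.1 ^ 2 + b * p.1 * p.2 + c * p.2 ^ 2

variable {a b c : ℤ}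

lemma finite_qf_le (ha : 0 < a) (hD : b ^ 2 - 4 * a * c < 0) (x : ℝ) :
    {p : ℤ × ℤ | (qf a b c p : ℝ) ≤ x}.Finite := by
  set N : ℤ := 4 * a * ⌊x⌋
  have hsq {k : ℤ} (h : k ^ 2 ≤ N) : k ∈ Set.Icc (-N) N := by
    constructor <;> nlinarith [sq_nonneg k, sq_nonneg (k - 1), sq_nonneg (k + 1)]
  refine Set.Finite.of_finite_image (f := fun p : ℤ × ℤ => (2 * a * p.1 + b * p.2, p.2))
    (((Set.finite_Icc (-N) N).prod (Set.finite_Icc (-N) N)).subset ?_) ?_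
  · rintro _ ⟨⟨u, v⟩, h, rfl⟩
    have h : qf a b c (u, v) ≤ ⌊x⌋ := Int.le_floor.2 h
    simp only [qf] at h
    have h4 : (2 * a * u + b * v) ^ 2 - (b ^ 2 - 4 * a * c) * v ^ 2 ≤ N := by
      nlinarith
    refine ⟨hsq ?_, hsq ?_⟩ <;> simp only <;>
      nlinarith [sq_nonneg v, sq_nonneg (2 * a * u + b * v)]
  · rintro ⟨u, v⟩ - ⟨u', v'⟩ - h
    simp only [Prod.mk.injEq] at h
    obtain ⟨h, rfl⟩ := h
    have : a * (u - u') = 0 := by linarith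
    rcases mul_eq_zero.1 this with h | h
    · omega
    · simp [sub_eq_zero.1 h]

lemma tendsto_card_qf_dvd (ha : 0 < a) (hD : b ^ 2 - 4 * a * c < 0) (τ : ℤ)
    {d : ℕ} (hd : d ≠ 0) (hcop : IsCoprime a (d : ℤ)) :
    Tendsto (fun x : ℝ => (Set.ncard {p : ℤ × ℤ | (qf a b c p : ℝ) ≤ x ∧
        (d : ℤ) ∣ a * p.1 + τ * p.2} : ℝ) / x) atTop
      (𝓝 (2 * π / √((4 * a * c - b ^ 2 : ℤ) : ℝ) / d)) := by
  obtain ⟨i, j, hij⟩ := hcop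
  set e := -(i * τ)
  have hdpos : 0 < (d : ℤ) := by positivity
  have hD' : (2 * a * d * e + d * b) ^ 2 - 4 * (a * d ^ 2) * (a * e ^ 2 + b * e + c) < 0 := by
    have : (2 * a * d * e + d * b) ^ 2 - 4 * (a * d ^ 2) * (a * e ^ 2 + b * e + c) =
      d ^ 2 * (b ^ 2 - 4 * a * c) := by ring
    rw [this]
    exact mul_neg_of_pos_of_neg (by positivity) hD
  have h := tendsto_card_form_le (a * d ^ 2) (2 * a * d * e + d * b) (a * e ^ 2 + b * e + c)
    (by positivity) hD'
  have hs : √((4 * (a * d ^ 2) * (a * e ^ 2 + b * e + c) - (2 * a * d * e + d * b) ^ 2 : ℤ) : ℝ) =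
      d * √((4 * a * c - b ^ 2 : ℤ) : ℝ) := by
    rw [← Real.sqrt_sq (x := (d : ℝ)) (by positivity), ← Real.sqrt_mul (by positivity)]
    congr 1
    push_cast
    ring
  rw [hs, mul_comm (d : ℝ), ← div_div] at h
  refine h.congr fun x => ?_
  congr 2
  rw [← Nat.card_coe_set_eq]
  have hval (p : ℤ × ℤ) : a * d ^ 2 * p.1 ^ 2 + (2 * a * d * e + d * b) * p.1 * p.2 +
      (a * e ^ 2 + b * e + c) * p.2 ^ 2 = qf a b c (e * p.2 + d * p.1, p.2) := by
    simp only [qf]; ring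
  refine Nat.card_congr (Equiv.ofBijective (fun p => ⟨(e * p.1.2 + d * p.1.1, p.1.2), ?_, ?_⟩)
    ⟨?_, ?_⟩)
  · simpa only [hval] using p.2
  · refine ⟨a * p.1.1 + j * τ * p.1.2, ?_⟩
    simp only [e]
    linear_combination -(τ * p.1.2) * hij
  · rintro ⟨⟨u, v⟩, h⟩ ⟨⟨u', v'⟩, h'⟩ he
    simp only [Subtype.mk.injEq, Prod.mk.injEq] at he
    obtain ⟨he, rfl⟩ := he
    have : (d : ℤ) * u = d * u' := by linarith
    simp [mul_left_cancel₀ hdpos.ne' this]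
  · rintro ⟨⟨u, v⟩, h, k, hk⟩
    have hu : u = e * v + d * (i * k + j * u) := by
      simp only [e]
      linear_combination i * hk - u * hij
    refine ⟨⟨(i * k + j * u, v), ?_⟩, ?_⟩
    · rw [hval (i * k + j * u, v), ← hu]
      exact h
    · ext
      · exact hu.symm
      · rfl

lemma tendsto_card_qf_sieve (ha : 0 < a) (hD : b ^ 2 - 4 * a * c < 0)
    (τ : ℤ) (S : Finset ℕ) : ∀ {d : ℕ}, d ≠ 0 → IsCoprime a (d : ℤ) →
    (∀ p ∈ S, p.Prime ∧ ¬ p ∣ d ∧ IsCoprime a (p : ℤ)) →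
    Tendsto (fun x : ℝ => (Set.ncard {p : ℤ × ℤ | (qf a b c p : ℝ) ≤ x ∧
        (d : ℤ) ∣ a * p.1 + τ * p.2 ∧ ∀ q ∈ S, ¬ (q : ℤ) ∣ a * p.1 + τ * p.2} : ℝ) / x) atTop
      (𝓝 (2 * π / √((4 * a * c - b ^ 2 : ℤ) : ℝ) / d * ∏ q ∈ S, (1 - (q : ℝ)⁻¹))) := by
  classical
  induction S using Finset.induction_on with
  | empty =>
    intro d hd hcop _
    simpa using tendsto_card_qf_dvd ha hD τ hd hcop
  | insert q S hq ih =>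
    intro d hd hcop hS
    obtain ⟨hqp, hqd, hqa⟩ := hS q (Finset.mem_insert_self _ _)
    have h1 := ih hd hcop fun p hp => hS p (Finset.mem_insert_of_mem hp)
    have h2 := ih (d := d * q) (mul_ne_zero hd hqp.ne_zero)
      (by push_cast; exact hcop.mul_right hqa) fun p hp => by
        obtain ⟨h, h', h''⟩ := hS p (Finset.mem_insert_of_mem hp)
        refine ⟨h, fun hdvd => ?_, h''⟩
        rcases h.dvd_mul.1 hdvd with hdvd | hdvd
        · exact h' hdvd
        · exact hq ((Nat.prime_dvd_prime_iff_eq h hqp).1 hdvd ▸ hp)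
    have h3 := h1.sub h2
    have hqd' : IsCoprime (d : ℤ) (q : ℤ) :=
      Nat.isCoprime_iff_coprime.2 ((Nat.Prime.coprime_iff_not_dvd hqp).2 hqd).symm
    convert! h3 using 2 with x
    · rw [← sub_div]
      congr 1
      rw [eq_sub_iff_add_eq, ← Nat.cast_add, ← Set.ncard_union_eq ?_
        ((finite_qf_le ha hD x).subset fun p hp => hp.1)
        ((finite_qf_le ha hD x).subset fun p hp => hp.1)]
      · congr 2
        ext p
        simp only [Set.mem_union, Set.mem_ofPred_eq, Finset.mem_insert, forall_eq_or_imp]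
        have hdq : (((d * q : ℕ) : ℤ) ∣ a * p.1 + τ * p.2) ↔
            (d : ℤ) ∣ a * p.1 + τ * p.2 ∧ (q : ℤ) ∣ a * p.1 + τ * p.2 := by
          push_cast
          exact ⟨fun h => ⟨(dvd_mul_right _ _).trans h, (dvd_mul_left _ _).trans h⟩,
            fun h => hqd'.mul_dvd h.1 h.2⟩
        rw [hdq]
        tauto
      · rw [Set.disjoint_left]
        rintro p ⟨-, -, h⟩ ⟨-, h', -⟩
        refine h q (Finset.mem_insert_self _ _) (dvd_trans ?_ h')
        push_cast
        exact dvd_mul_left _ _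
    · rw [Finset.prod_insert hq]
      push_cast
      field_simp

end Sieve

section Coprime

variable {A σ : ℤ} [hD : Fact (σ ^ 2 + 4 * A < 0)]

variable (A σ) in
lemma exists_prime_dvd_disc : ∃ p : ℕ, p.Prime ∧ (p : ℤ) ∣ σ ^ 2 + 4 * A := by
  have h1 : (σ ^ 2 + 4 * A).natAbs ≠ 1 := by
    intro h
    have hneg := hD.out
    have : σ ^ 2 + 4 * A = -1 := by omega
    rcases Int.even_or_odd' σ with ⟨s, rfl | rfl⟩ <;> ring_nf at this <;> omega
  obtain ⟨p, hp, h⟩ := Nat.exists_prime_and_dvd h1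
  exact ⟨p, hp, Int.natCast_dvd.2 h⟩

lemma Frm.exists_dvd_val_iff (f : Frm A σ) : ∃ τ : ℤ, ∀ p : ℕ, p.Prime →
    (p : ℤ) ∣ σ ^ 2 + 4 * A → ¬ (p : ℤ) ∣ f.m → ∀ u v,
    ((p : ℤ) ∣ f.val u v ↔ (p : ℤ) ∣ f.m * u + τ * v) := by
  have hodd (τ : ℤ) (p : ℕ) (hp : p.Prime) (hτ : (p : ℤ) ∣ 2 * τ - (2 * f.t + σ))
      (hp2 : ¬ (p : ℤ) ∣ 2) (hpD : (p : ℤ) ∣ σ ^ 2 + 4 * A) (hpm : ¬ (p : ℤ) ∣ f.m) (u v : ℤ) :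
      ((p : ℤ) ∣ f.val u v ↔ (p : ℤ) ∣ f.m * u + τ * v) := by
    have hpp := Nat.prime_iff_prime_int.1 hp
    have h4 : 4 * f.m * f.val u v = (2 * f.m * u + (2 * f.t + σ) * v) ^ 2 -
        (σ ^ 2 + 4 * A) * v ^ 2 := by
      have := f.four_mul
      simp only [Frm.val]
      linear_combination v ^ 2 * this
    have h1 : (p : ℤ) ∣ f.val u v ↔ (p : ℤ) ∣ 2 * f.m * u + (2 * f.t + σ) * v := by
      constructor
      · intro h
        refine hpp.dvd_of_dvd_pow (n := 2) ?_
        rw [show (2 * f.m * u + (2 * f.t + σ) * v) ^ 2 = 4 * f.m * f.val u v +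
          (σ ^ 2 + 4 * A) * v ^ 2 by linarith]
        exact dvd_add (h.mul_left _) (hpD.mul_right _)
      · intro h
        have : (p : ℤ) ∣ 2 * (2 * (f.m * f.val u v)) := by
          rw [show 2 * (2 * (f.m * f.val u v)) = 4 * f.m * f.val u v by ring, h4]
          exact dvd_sub (h.pow two_ne_zero) (hpD.mul_right _)
        have := ((hpp.dvd_or_dvd this).resolve_left hp2)
        exact (hpp.dvd_or_dvd ((hpp.dvd_or_dvd this).resolve_left hp2)).resolve_left hpm
    rw [h1, show 2 * f.m * u + (2 * f.t + σ) * v = 2 * (f.m * u + τ * v) -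
      (2 * τ - (2 * f.t + σ)) * v by ring, dvd_sub_left (hτ.mul_right v),
      hpp.dvd_mul, or_iff_right hp2]
  have hp2 {p : ℕ} (hp : p.Prime) (h : (p : ℤ) ∣ 2) : p = 2 :=
    (Nat.prime_dvd_prime_iff_eq hp Nat.prime_two).1 (by exact_mod_cast h)
  rcases Int.even_or_odd' σ with ⟨s, hs | hs⟩
  · refine ⟨f.t + s + (s ^ 2 + A), fun p hp hpD hpm u v => ?_⟩
    by_cases h2 : (p : ℤ) ∣ 2
    · obtain rfl := hp2 hp h2
      have hpp := Nat.prime_iff_prime_int.1 hp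
      rw [← or_iff_right (a := ((2 : ℕ) : ℤ) ∣ f.m) (b := _ ∣ f.val u v) hpm, ← hpp.dvd_mul]
      have h : f.m * f.val u v = f.m * u + (f.t + s + (s ^ 2 + A)) * v +
          ((f.m * u + f.t * v - 1) * (f.m * u + f.t * v - 1 + 1) +
            2 * (s * (f.m * u + f.t * v) * v) - A * (v * (v + 1)) - (s * (s + 1)) * v) := by
        simp only [Frm.val]
        linear_combination v ^ 2 * f.eq + (f.m * u * v + f.t * v ^ 2) * hs
      rw [h]
      refine (dvd_add_left ?_)
      have hev (x : ℤ) : ((2 : ℕ) : ℤ) ∣ x * (x + 1) := (Int.even_mul_succ_self x).two_dvd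
      exact dvd_sub (dvd_sub (dvd_add (hev _) (dvd_mul_right _ _)) ((hev _).mul_left _))
        ((hev _).mul_right _)
    · have hpp := Nat.prime_iff_prime_int.1 hp
      refine hodd _ p hp ?_ h2 hpD hpm u v
      rw [show σ ^ 2 + 4 * A = 2 * (2 * (s ^ 2 + A)) by rw [hs]; ring, hpp.dvd_mul,
        or_iff_right h2] at hpD
      rwa [show 2 * (f.t + s + (s ^ 2 + A)) - (2 * f.t + σ) = 2 * (s ^ 2 + A) by
        linear_combination -hs]
  · refine ⟨f.t + σ * (2 * (s ^ 2 + s + A) + 1), fun p hp hpD hpm u v => ?_⟩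
    refine hodd _ p hp ?_ (fun h2 => ?_) hpD hpm u v
    · rw [show 2 * (f.t + σ * (2 * (s ^ 2 + s + A) + 1)) - (2 * f.t + σ) =
        σ * (σ ^ 2 + 4 * A) by linear_combination -(σ * (σ + 2 * s + 1)) * hs]
      exact hpD.mul_left _
    · rw [hp2 hp h2, hs, show (2 * s + 1) ^ 2 + 4 * A = 2 * (2 * (s ^ 2 + s + A)) + 1 by ring] at hpD
      omega

/-- Every class contains a form whose first coefficient is coprime to the discriminant. -/
lemma exists_frm_cl_coprime (c : Cl A σ) : ∃ f : Frm A σ, f.cl = c ∧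
    ∀ p : ℕ, p.Prime → (p : ℤ) ∣ σ ^ 2 + 4 * A → ¬ (p : ℤ) ∣ f.m := by
  obtain ⟨f, rfl⟩ := exists_frm_cl c
  set S := (σ ^ 2 + 4 * A).natAbs.primeFactors with hS
  have hmem {p : ℕ} : p ∈ S ↔ p.Prime ∧ (p : ℤ) ∣ σ ^ 2 + 4 * A := by
    rw [hS, Nat.mem_primeFactors, ← Int.natCast_dvd,
      and_iff_left (Int.natAbs_ne_zero.2 hD.out.ne)]
  set u : ℤ := ∏ p ∈ S.filter (fun p : ℕ => (p : ℤ) ∣ f.m ∧ ¬ (p : ℤ) ∣ f.C), (p : ℤ)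
  set v : ℤ := ∏ p ∈ S.filter (fun p : ℕ => ¬ (p : ℤ) ∣ f.m), (p : ℤ)
  have hdvd {p : ℕ} (hp : p.Prime) (q : ℕ → Prop) [DecidablePred q] :
      (p : ℤ) ∣ ∏ r ∈ S.filter q, (r : ℤ) ↔ p ∈ S ∧ q p := by
    rw [(Nat.prime_iff_prime_int.1 hp).dvd_finsetProd_iff]
    constructor
    · rintro ⟨r, hr, h⟩
      rw [Finset.mem_filter] at hr
      obtain rfl := (Nat.prime_dvd_prime_iff_eq hp (hmem.1 hr.1).1).1 (by exact_mod_cast h)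
      exact hr
    · exact fun h => ⟨p, Finset.mem_filter.2 h, dvd_rfl⟩
  have hval (p : ℕ) (hp : p.Prime) (hpD : (p : ℤ) ∣ σ ^ 2 + 4 * A) : ¬ (p : ℤ) ∣ f.val u v := by
    have hpS : p ∈ S := hmem.2 ⟨hp, hpD⟩
    have hpp := Nat.prime_iff_prime_int.1 hp
    have hpu : (p : ℤ) ∣ u ↔ _ := hdvd hp _
    have hpv : (p : ℤ) ∣ v ↔ _ := hdvd hp _
    simp only [hpS, true_and] at hpu hpv
    simp only [Frm.val]
    by_cases hm : (p : ℤ) ∣ f.m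
    · have hv' : ¬ (p : ℤ) ∣ v := fun h => hpv.1 h hm
      rw [add_assoc, dvd_add_right (hm.mul_right _)]
      by_cases hC : (p : ℤ) ∣ f.C
      · rw [dvd_add_left (hC.mul_right _), hpp.dvd_mul, hpp.dvd_mul, not_or, not_or]
        refine ⟨⟨fun h => ?_, fun h => (hpu.1 h).2 hC⟩, hv'⟩
        obtain ⟨x, y, z, hxyz⟩ := f.prim
        refine hpp.not_dvd_one (hxyz ▸ ?_)
        exact dvd_add (dvd_add (hm.mul_left _) (h.mul_left _)) (hC.mul_left _)
      · rw [dvd_add_right (((hpu.2 ⟨hm, hC⟩).mul_left _).mul_right _), hpp.dvd_mul, not_or]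
        exact ⟨hC, fun h => hv' (hpp.dvd_of_dvd_pow h)⟩
    · rw [dvd_add_left ((dvd_pow (hpv.2 hm) two_ne_zero).mul_left _),
        dvd_add_left ((hpv.2 hm).mul_left _), hpp.dvd_mul, or_iff_right hm]
      intro h
      exact hm (hpu.1 (hpp.dvd_of_dvd_pow h)).1
  have h0 : f.val u v ≠ 0 := by
    obtain ⟨p, hp, hpD⟩ := exists_prime_dvd_disc A σ
    exact fun h => hval p hp hpD (h ▸ dvd_zero _)
  obtain ⟨g, hg, hdv⟩ := f.exists_m_dvd_val h0
  exact ⟨g, hg, fun p hp hpD h => hval p hp hpD (h.trans hdv)⟩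

end Coprime

section Residue

variable (A σ : ℤ) [hD : Fact (σ ^ 2 + 4 * A < 0)]
local notation "𝓡" => QuadraticAlgebra ℤ A σ

/-- The absolute value of the discriminant. -/
def absD : ℕ := (σ ^ 2 + 4 * A).natAbs

/-- The common residue at `s = 1` of the partial zeta functions, prime to the discriminant. -/
noncomputable def kap : ℝ :=
  2 * π / √(absD A σ : ℝ) * (∏ q ∈ (absD A σ).primeFactors, (1 - (q : ℝ)⁻¹)) / Nat.card 𝓡ˣ

variable {A σ}

lemma cast_absD : ((absD A σ : ℕ) : ℤ) = -(σ ^ 2 + 4 * A) := by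
  have := hD.out
  simp only [absD]
  omega

lemma absD_pos : 0 < absD A σ := by
  have := hD.out
  simp only [absD]
  omega

lemma mem_primeFactors_absD {p : ℕ} :
    p ∈ (absD A σ).primeFactors ↔ p.Prime ∧ (p : ℤ) ∣ σ ^ 2 + 4 * A := by
  rw [Nat.mem_primeFactors, ← Int.natCast_dvd_natCast, cast_absD, dvd_neg,
    and_iff_left absD_pos.ne']

lemma kap_pos : 0 < kap A σ := by
  have h1 : (0 : ℝ) < Nat.card 𝓡ˣ := by exact_mod_cast card_units_pos
  have h2 : (0 : ℝ) < absD A σ := by exact_mod_cast absD_pos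
  have h3 : 0 < ∏ q ∈ (absD A σ).primeFactors, (1 - (q : ℝ)⁻¹) :=
    Finset.prod_pos fun q hq => sub_pos.2
      (inv_lt_one_of_one_lt₀ (by exact_mod_cast (Nat.prime_of_mem_primeFactors hq).one_lt))
  have := Real.pi_pos
  unfold kap
  positivity

lemma Frm.tendsto_card_val (f : Frm A σ)
    (hf : ∀ p : ℕ, p.Prime → (p : ℤ) ∣ σ ^ 2 + 4 * A → ¬ (p : ℤ) ∣ f.m) :
    Tendsto (fun x : ℝ => (Set.ncard {p : ℤ × ℤ | (f.val p.1 p.2 : ℝ) ≤ x ∧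
        ∀ q ∈ (absD A σ).primeFactors, ¬ (q : ℤ) ∣ f.val p.1 p.2} : ℝ) / x) atTop
      (𝓝 (kap A σ * Nat.card 𝓡ˣ)) := by
  obtain ⟨τ, hτ⟩ := f.exists_dvd_val_iff
  have hdisc : (2 * f.t + σ) ^ 2 - 4 * f.m * f.C = σ ^ 2 + 4 * A := by
    linarith [f.four_mul]
  have h := tendsto_card_qf_sieve (b := 2 * f.t + σ) (c := f.C) f.pos (by rw [hdisc]; exact hD.out)
    τ (absD A σ).primeFactors one_ne_zero
    (by rw [Nat.cast_one]; exact isCoprime_one_right) fun p hp => by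
      obtain ⟨hp, hpD⟩ := mem_primeFactors_absD.1 hp
      refine ⟨hp, hp.not_dvd_one, ?_⟩
      exact ((Nat.prime_iff_prime_int.1 hp).coprime_iff_not_dvd.2 (hf p hp hpD)).symm
  have hw : (Nat.card 𝓡ˣ : ℝ) ≠ 0 := by exact_mod_cast card_units_pos.ne'
  have h1 : 4 * f.m * f.C - (2 * f.t + σ) ^ 2 = absD A σ := by rw [cast_absD]; linarith
  convert! h using 2 with x
  · congr 3
    ext p
    simp only [Nat.cast_one, one_dvd, true_and, Set.mem_ofPred_eq]
    refine and_congr Iff.rfl (forall₂_congr fun q hq => not_congr ?_)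
    obtain ⟨hq, hqD⟩ := mem_primeFactors_absD.1 hq
    exact hτ q hq hqD (hf q hq hqD) _ _
  · rw [h1, kap, div_mul_cancel₀ _ hw]
    simp

lemma tval_coprime {c : Cl A σ} {T : ℕ × ℕ × ℕ} (hT : T ∈ Trip A σ c) {p : ℕ} (hp : p.Prime)
    (hpD : (p : ℤ) ∣ σ ^ 2 + 4 * A) : ¬ p ∣ tval T := by
  obtain ⟨h1, h2, h3, -⟩ := hT
  unfold tval
  rw [hp.dvd_mul, hp.dvd_mul]
  rintro ((h | h) | h)
  · exact (h1.2 p hp h).2.1 hpD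
  · exact (h2.2 p hp h).2.1 hpD
  · exact (h3.2 p hp (hp.dvd_of_dvd_pow h)).2.1 hpD

lemma tval_ne_zero {c : Cl A σ} {T : ℕ × ℕ × ℕ} (hT : T ∈ Trip A σ c) : tval T ≠ 0 := by
  obtain ⟨h1, h2, h3, -⟩ := hT
  exact mul_ne_zero (mul_ne_zero h1.1 h2.1) (pow_ne_zero _ h3.1)

/-- The number of triples of class `c` with a given value. -/
noncomputable def tripCount (c : Cl A σ) (n : ℕ) : ℝ :=
  Nat.card {T : ℕ × ℕ × ℕ // T ∈ Trip A σ c ∧ tval T = n}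

lemma Frm.ncard_val_le (f : Frm A σ) (n : ℕ) :
    (Set.ncard {p : ℤ × ℤ | (f.val p.1 p.2 : ℝ) ≤ n ∧
        ∀ q ∈ (absD A σ).primeFactors, ¬ (q : ℤ) ∣ f.val p.1 p.2} : ℝ) =
      Nat.card 𝓡ˣ * ∑ k ∈ Finset.Icc 1 n, tripCount f.cl⁻¹ k := by
  classical
  have hdisc : (2 * f.t + σ) ^ 2 - 4 * f.m * f.C = σ ^ 2 + 4 * A := by
    linarith [f.four_mul]
  have hfin : {p : ℤ × ℤ | (f.val p.1 p.2 : ℝ) ≤ n ∧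
      ∀ q ∈ (absD A σ).primeFactors, ¬ (q : ℤ) ∣ f.val p.1 p.2}.Finite :=
    (finite_qf_le f.pos (by rw [hdisc]; exact hD.out) (n : ℝ)).subset fun p hp => hp.1
  have hnonneg (p : ℤ × ℤ) : 0 ≤ f.val p.1 p.2 := by
    have h1 := f.norm_elt p.1 p.2
    have h2 := norm_nonneg' (f.elt p.1 p.2)
    rw [h1] at h2
    exact nonneg_of_mul_nonneg_right h2 f.pos
  obtain ⟨p₀, hp₀, hp₀D⟩ := exists_prime_dvd_disc A σ
  rw [Set.ncard_eq_toFinset_card _ hfin, Finset.card_eq_sum_card_fiberwise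
    (f := fun p : ℤ × ℤ => (f.val p.1 p.2).toNat) (t := Finset.Icc 1 n), Finset.mul_sum]
  · rw [Nat.cast_sum]
    refine Finset.sum_congr rfl fun k hk => ?_
    rw [Finset.mem_Icc] at hk
    unfold tripCount
    by_cases hkD : ∀ p : ℕ, p.Prime → (p : ℤ) ∣ σ ^ 2 + 4 * A → ¬ p ∣ k
    · rw [← Nat.cast_mul, ← f.card_rep (by omega) hkD, ← Nat.card_eq_finsetCard]
      congr 1
      refine Nat.card_congr (Equiv.subtypeEquivRight fun p => ?_)
      have := hnonneg p
      simp only [Finset.mem_filter, Set.Finite.mem_toFinset, Set.mem_ofPred_eq]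
      refine ⟨fun ⟨_, h⟩ => by omega, ?_⟩
      · intro h
        refine ⟨⟨?_, fun q hq h' => ?_⟩, by omega⟩
        · rw [h]; exact_mod_cast hk.2
        · rw [h, Int.natCast_dvd_natCast] at h'
          obtain ⟨hq, hqD⟩ := mem_primeFactors_absD.1 hq
          exact hkD q hq hqD h'
    · push Not at hkD
      obtain ⟨p, hp, hpD, hpk⟩ := hkD
      have h1 : IsEmpty {T : ℕ × ℕ × ℕ // T ∈ Trip A σ f.cl⁻¹ ∧ tval T = k} :=
        ⟨fun T => tval_coprime T.2.1 hp hpD (by rw [T.2.2]; exact hpk)⟩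
      rw [@Nat.card_of_isEmpty _ h1, Nat.cast_zero, mul_zero, Nat.cast_eq_zero, Finset.card_eq_zero,
        Finset.filter_eq_empty_iff]
      intro q hq h
      rw [Set.Finite.mem_toFinset] at hq
      refine hq.2 p (mem_primeFactors_absD.2 ⟨hp, hpD⟩) ?_
      rw [← Int.toNat_of_nonneg (hnonneg q), h]
      exact_mod_cast hpk
  · intro p hp
    rw [Finset.mem_coe, Set.Finite.mem_toFinset] at hp
    have h1 := hnonneg p
    have h2 : f.val p.1 p.2 ≤ n := by exact_mod_cast hp.1
    have h3 : f.val p.1 p.2 ≠ 0 := fun h =>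
      hp.2 p₀ (mem_primeFactors_absD.2 ⟨hp₀, hp₀D⟩) (h ▸ dvd_zero _)
    simp only [Finset.mem_coe, Finset.mem_Icc]
    omega

lemma tendsto_tsum_tripSet (c : Cl A σ) :
    Tendsto (fun s : ℝ => (s - 1) * ∑' T : tripSet (SplitP A σ) (InertP A σ) (gam A σ) c,
      (tval T.1 : ℝ) ^ (-s)) (𝓝[>] 1) (𝓝 (kap A σ)) := by
  obtain ⟨f, hfc, hf⟩ := exists_frm_cl_coprime c⁻¹
  have hw : (Nat.card 𝓡ˣ : ℝ) ≠ 0 := by exact_mod_cast card_units_pos.ne'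
  have h1 : Tendsto (fun n : ℕ => (∑ k ∈ Finset.Icc 1 n, tripCount c k) / n) atTop
      (𝓝 (kap A σ)) := by
    have := ((f.tendsto_card_val hf).comp tendsto_natCast_atTop_atTop).div_const (Nat.card 𝓡ˣ : ℝ)
    rw [mul_div_cancel_right₀ _ hw] at this
    refine this.congr fun n => ?_
    simp only [Function.comp_apply]
    rw [f.ncard_val_le, hfc, inv_inv]
    field_simp
  have h2 := LSeries_tendsto_sub_mul_nhds_one_of_tendsto_sum_div_and_nonneg _ h1
    fun n => by unfold tripCount; positivity
  have h3 := (Complex.continuous_re.tendsto _).comp h2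
  refine h3.congr' ?_
  filter_upwards [eventually_one_lt] with s hs
  have : Fintype (Cl A σ) := Fintype.ofFinite _
  have hsum := (hasSum_tripSet (P := SplitP A σ) (Q := InertP A σ) (γ := gam A σ) c hs).summable
  have h4 := (hsum.hasSum.tsum_fiberwise fun T => tval T.1).tsum_eq
  rw [← h4]
  have h5 : LSeries (fun n => (tripCount c n : ℂ)) s =
      ((∑' n : ℕ, tripCount c n * (n : ℝ) ^ (-s) : ℝ) : ℂ) := by
    rw [LSeries, Complex.ofReal_tsum]
    refine tsum_congr fun n => ?_
    rcases eq_or_ne n 0 with rfl | hn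
    · rw [LSeries.term_zero, Nat.cast_zero, Real.zero_rpow (by linarith), mul_zero,
        Complex.ofReal_zero]
    · rw [LSeries.term_of_ne_zero hn, Real.rpow_neg (Nat.cast_nonneg _), Complex.ofReal_mul,
        Complex.ofReal_inv, Complex.ofReal_cpow (Nat.cast_nonneg _), div_eq_mul_inv,
        Complex.ofReal_natCast]
  simp only [Function.comp_apply]
  rw [h5, ← Complex.ofReal_one, ← Complex.ofReal_sub, ← Complex.ofReal_mul, Complex.ofReal_re]
  congr 1
  refine tsum_congr fun n => ?_
  have h6 : ∀ T : ((fun T : tripSet (SplitP A σ) (InertP A σ) (gam A σ) c => tval T.1) ⁻¹' {n} :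
      Set _), (tval T.1.1 : ℝ) ^ (-s) = (n : ℝ) ^ (-s) := fun T => by
    rw [show tval T.1.1 = n from T.2]
  rw [tsum_congr h6, tsum_const, nsmul_eq_mul]
  congr 1
  refine congrArg Nat.cast ?_
  exact Nat.card_congr (Equiv.subtypeSubtypeEquivSubtypeInter (· ∈ Trip A σ c)
    fun T => tval T = n).symm

/-- The classes of triples are equidistributed. -/
theorem equi : Equi (SplitP A σ) (InertP A σ) (gam A σ) (kap A σ) where
  primeP _ hp := hp.1
  disj _ hp hq := hq.2.2 hp.2.2
  mul _ _ hm hn := gam_mul hm hn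
  pos := kap_pos
  res := tendsto_tsum_tripSet

end Residue

section Ramified

variable {A σ : ℤ} [hD : Fact (σ ^ 2 + 4 * A < 0)]

variable (A σ) in
/-- The primes dividing the discriminant but not the conductor. -/
noncomputable def ramT : Finset ℕ :=
  @Finset.filter ℕ (fun p : ℕ => ¬ ∃ e : ℤ, σ ^ 2 + 4 * A = p ^ 2 * e ∧ (e % 4 = 0 ∨ e % 4 = 1))
    (Classical.decPred _) (absD A σ).primeFactors

lemma mem_ramT {p : ℕ} : p ∈ ramT A σ ↔ (p.Prime ∧ (p : ℤ) ∣ σ ^ 2 + 4 * A) ∧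
    ¬ ∃ e : ℤ, σ ^ 2 + 4 * A = p ^ 2 * e ∧ (e % 4 = 0 ∨ e % 4 = 1) := by
  simp only [ramT, Finset.mem_filter, mem_primeFactors_absD]

lemma Frm.exists_mul_val_of_dvd (f : Frm A σ) {p : ℕ} (hp : p ∈ ramT A σ) (hC : (p : ℤ) ∣ f.C) :
    ∃ f' : Frm A σ, ∀ u v, ∃ u' v', f.val u' v' = p * f'.val u v := by
  obtain ⟨⟨hp, hpD⟩, hpT⟩ := mem_ramT.1 hp
  have hpp := Nat.prime_iff_prime_int.1 hp
  have h4 := f.four_mul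
  have hB : (p : ℤ) ∣ 2 * f.t + σ := by
    refine hpp.dvd_of_dvd_pow (n := 2) ?_
    rw [show (2 * f.t + σ) ^ 2 = 4 * (f.m * f.C) + (σ ^ 2 + 4 * A) by linarith]
    exact dvd_add ((hC.mul_left _).mul_left _) hpD
  obtain ⟨C', hC'⟩ := hC
  obtain ⟨B', hB'⟩ := hB
  have hcop : IsCoprime (p : ℤ) C' := by
    refine (Prime.coprime_iff_not_dvd hpp).2 ?_
    rintro ⟨C₂, rfl⟩
    refine hpT ⟨B' ^ 2 - 4 * (f.m * C₂), ?_, ?_⟩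
    · rw [hB', hC'] at h4
      linear_combination h4
    · rcases Int.even_or_odd' B' with ⟨k, rfl | rfl⟩
      · left; ring_nf; omega
      · right; ring_nf; omega
  obtain ⟨a, b, hab⟩ := hcop
  refine ⟨⟨p * f.m, f.t, C', mul_pos (by exact_mod_cast hp.pos) f.pos, ?_, ?_⟩, fun u v =>
    ⟨p * u, v, ?_⟩⟩
  · rw [← f.eq, hC']; ring
  · obtain ⟨x, y, z, h⟩ := f.prim
    refine ⟨a * x, a * y * p, a * z * p ^ 2 + b, ?_⟩
    rw [hC'] at h
    linear_combination (a * p) * h + hab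
  · simp only [Frm.val, hC']
    ring

lemma Frm.shift_val (f : Frm A σ) (j u v : ℤ) : (f.shift j).val u v = f.val (u + j * v) v := by
  simp only [Frm.val, Frm.shift]; ring

lemma Frm.swap_val (f : Frm A σ) (u v : ℤ) : f.swap.val u v = f.val (-v) u := by
  simp only [Frm.val, Frm.swap]; ring

lemma Frm.exists_mul_val (f : Frm A σ) {p : ℕ} (hp : p ∈ ramT A σ) :
    ∃ f' : Frm A σ, ∀ u v, ∃ u' v', f.val u' v' = p * f'.val u v := by
  obtain ⟨⟨hp', hpD⟩, -⟩ := mem_ramT.1 hp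
  by_cases hm : (p : ℤ) ∣ f.m
  · obtain ⟨f', h⟩ := f.swap.exists_mul_val_of_dvd hp hm
    refine ⟨f', fun u v => ?_⟩
    obtain ⟨u', v', h⟩ := h u v
    exact ⟨_, _, f.swap_val u' v' ▸ h⟩
  · obtain ⟨τ, hτ⟩ := f.exists_dvd_val_iff
    obtain ⟨a, b, hab⟩ := ((Prime.coprime_iff_not_dvd (Nat.prime_iff_prime_int.1 hp')).2 hm)
    have h1 : (p : ℤ) ∣ f.val (-(b * τ)) 1 := by
      rw [hτ p hp' hpD hm]
      exact ⟨a * τ, by linear_combination (-τ) * hab⟩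
    have h2 : (p : ℤ) ∣ (f.shift (-(b * τ))).C := by
      have : (f.shift (-(b * τ))).C = f.val (-(b * τ)) 1 := by
        simp only [Frm.val, Frm.shift]; ring
      rwa [this]
    obtain ⟨f', h⟩ := (f.shift _).exists_mul_val_of_dvd hp h2
    refine ⟨f', fun u v => ?_⟩
    obtain ⟨u', v', h⟩ := h u v
    exact ⟨_, _, f.shift_val _ u' v' ▸ h⟩

lemma Frm.exists_mul_val_of_factored (f : Frm A σ) {d : ℕ}
    (hd : d ∈ Nat.factoredNumbers (ramT A σ)) :
    ∃ f' : Frm A σ, ∀ u v, ∃ u' v', f.val u' v' = d * f'.val u v := by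
  induction d using Nat.recOnMul generalizing f with
  | zero => exact absurd rfl (Nat.ne_zero_of_mem_factoredNumbers hd)
  | one => exact ⟨f, fun u v => ⟨u, v, by simp⟩⟩
  | prime p hp =>
    exact f.exists_mul_val (Nat.mem_factoredNumbers.1 hd |>.2 p (by simp [Nat.primeFactorsList_prime hp]))
  | mul a b iha ihb =>
    have hab := Nat.ne_zero_of_mem_factoredNumbers hd
    obtain ⟨f₁, h₁⟩ := iha f (Nat.mem_factoredNumbers_of_dvd hd (dvd_mul_right a b))
    obtain ⟨f₂, h₂⟩ := ihb f₁ (Nat.mem_factoredNumbers_of_dvd hd (dvd_mul_left b a))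
    refine ⟨f₂, fun u v => ?_⟩
    obtain ⟨u₁, v₁, e₁⟩ := h₂ u v
    obtain ⟨u₂, v₂, e₂⟩ := h₁ u₁ v₁
    exact ⟨u₂, v₂, by rw [e₂, e₁]; push_cast; ring⟩

/-- The positive integers represented by a form. -/
def Frm.rep (f : Frm A σ) : Set ℕ := {n | n ≠ 0 ∧ ∃ u v, f.val u v = n}

lemma Frm.le_dm_rep (f : Frm A σ) (F : Finset ℕ) (hF : ∀ d ∈ F, d ∈ Nat.factoredNumbers (ramT A σ))
    {δ : ℝ} (hδ : δ < √(kap A σ / Nat.card {c : Cl A σ // c ^ 2 = 1})) :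
    ∀ᶠ s in 𝓝[>] (1 : ℝ), (∑ d ∈ F, (d : ℝ) ^ (-s)) * δ ≤ √(s - 1) * dm s f.rep := by
  have : Fintype (Cl A σ) := Fintype.ofFinite _
  have H (d : F) := f.exists_mul_val_of_factored (hF d d.2)
  choose g hg using H
  let S (d : F) : Set ℕ := tval '' Trip A σ (g d).cl⁻¹
  have hS : ∀ d : F, ∀ᶠ s in 𝓝[>] (1 : ℝ), δ ≤ √(s - 1) * dm s (S d) := fun d =>
    (equi (A := A) (σ := σ)).eventually_le' _ hδ
  have hd0 (d : F) : (d : ℕ) ≠ 0 := Nat.ne_zero_of_mem_factoredNumbers (hF d d.2)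
  have hcop (d e : F) {n : ℕ} (hn : n ∈ S d) : Nat.Coprime n e := by
    obtain ⟨T, hT, rfl⟩ := hn
    refine Nat.Coprime.symm (Nat.coprime_of_dvd fun p hp hpe => ?_)
    have : p ∈ ramT A σ := (Nat.mem_factoredNumbers.1 (hF e e.2)).2 p
      ((Nat.mem_primeFactorsList (hd0 e)).2 ⟨hp, hpe⟩)
    exact tval_coprime hT hp (mem_ramT.1 this).1.2
  have hdisj : Pairwise (Function.onFun Disjoint fun d : F => ((d : ℕ) * ·) '' S d) := by
    intro d e hde
    refine Set.disjoint_left.2 ?_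
    rintro _ ⟨m, hm, rfl⟩ ⟨n, hn, h⟩
    simp only at h
    refine hde (Subtype.ext (Nat.dvd_antisymm ?_ ?_))
    · exact (hcop e d hn).symm.dvd_of_dvd_mul_right (Dvd.intro _ h.symm)
    · exact (hcop d e hm).symm.dvd_of_dvd_mul_right (Dvd.intro _ h)
  filter_upwards [eventually_all.2 hS, eventually_one_lt] with s hs h1
  have hsub : ⋃ d ∈ (Finset.univ : Finset F), ((d : ℕ) * ·) '' S d ⊆ f.rep := by
    intro n hn
    simp only [Finset.mem_univ, Set.iUnion_true, Set.mem_iUnion] at hn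
    obtain ⟨d, _, ⟨T, hT, rfl⟩, rfl⟩ := hn
    obtain ⟨u, v, h⟩ := (g d).exists_val_of_trip hT
    obtain ⟨u', v', h'⟩ := hg d u v
    exact ⟨mul_ne_zero (hd0 d) (tval_ne_zero hT), u', v', by rw [h', h]; push_cast; rfl⟩
  calc (∑ d ∈ F, (d : ℝ) ^ (-s)) * δ = ∑ d : F, ((d : ℕ) : ℝ) ^ (-s) * δ := by
        rw [← Finset.sum_coe_sort F fun d : ℕ => (d : ℝ) ^ (-s), Finset.sum_mul]
    _ ≤ ∑ d : F, ((d : ℕ) : ℝ) ^ (-s) * (√(s - 1) * dm s (S d)) :=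
        Finset.sum_le_sum fun d _ => mul_le_mul_of_nonneg_left (hs d) (by positivity)
    _ = √(s - 1) * dm s (⋃ d ∈ (Finset.univ : Finset F), ((d : ℕ) * ·) '' S d) := by
        rw [dm_biUnion h1 _ hdisj, Finset.mul_sum]
        exact Finset.sum_congr rfl fun d _ => by rw [dm_image_mul (hd0 d)]; ring
    _ ≤ _ := mul_le_mul_of_nonneg_left (dm_mono h1 hsub) (Real.sqrt_nonneg _)

lemma Frm.sum_mul_le (f : Frm A σ) {C : ℝ}
    (hC : Tendsto (fun x : ℝ => (Set.ncard {n : ℕ | n ∈ f.rep ∧ (n : ℝ) ≤ x} : ℝ) *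
      √(Real.log x) / x) atTop (𝓝 C))
    (F : Finset ℕ) (hF : ∀ d ∈ F, d ∈ Nat.factoredNumbers (ramT A σ)) :
    (∑ d ∈ F, (d : ℝ)⁻¹) * √(kap A σ / Nat.card {c : Cl A σ // c ^ 2 = 1}) ≤ C * √π := by
  set L := √(kap A σ / Nat.card {c : Cl A σ // c ^ 2 = 1})
  refine le_of_forall_lt_imp_le_of_dense fun y hy => ?_
  have h1 : Tendsto (fun δ => (∑ d ∈ F, (d : ℝ)⁻¹) * δ) (𝓝[<] L) (𝓝 ((∑ d ∈ F, (d : ℝ)⁻¹) * L)) :=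
    tendsto_const_nhds.mul (tendsto_id.mono_left nhdsWithin_le_nhds)
  obtain ⟨δ, hyδ, hδ⟩ := ((h1.eventually (lt_mem_nhds hy)).and self_mem_nhdsWithin).exists
  have h2 : Tendsto (fun s : ℝ => (∑ d ∈ F, (d : ℝ) ^ (-s)) * δ) (𝓝[>] 1)
      (𝓝 ((∑ d ∈ F, (d : ℝ)⁻¹) * δ)) :=
    (tendsto_finsetSum _ fun d hd => tendsto_rpow_neg_one
      (Nat.ne_zero_of_mem_factoredNumbers (hF d hd))).mul_const δ
  refine le_of_eventually_le_dm (fun n hn => hn.1) hC ?_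
  filter_upwards [h2.eventually (lt_mem_nhds hyδ), f.le_dm_rep F hF hδ] with s h3 h4
  exact h3.le.trans h4

/-- The lower bound for the density constant. -/
theorem Frm.prod_mul_le (f : Frm A σ) {C : ℝ}
    (hC : Tendsto (fun x : ℝ => (Set.ncard {n : ℕ | n ∈ f.rep ∧ (n : ℝ) ≤ x} : ℝ) *
      √(Real.log x) / x) atTop (𝓝 C)) :
    (∏ p ∈ ramT A σ, (1 - (p : ℝ)⁻¹)⁻¹) * √(kap A σ / Nat.card {c : Cl A σ // c ^ 2 = 1}) ≤
      C * √π := by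
  let φ : ℕ →* ℝ := ⟨⟨fun n => (n : ℝ)⁻¹, by simp⟩, fun m n => by push_cast; rw [mul_inv]⟩
  have h := (EulerProduct.summable_and_hasSum_factoredNumbers_prod_filter_prime_geometric
    (f := φ) (fun {p} hp => by
      change ‖((p : ℝ)⁻¹)‖ < 1
      rw [norm_inv, RCLike.norm_natCast]
      exact inv_lt_one_of_one_lt₀ (by exact_mod_cast hp.one_lt)) (ramT A σ)).2
  rw [Finset.filter_true_of_mem fun p hp => (mem_ramT.1 hp).1.1] at h
  have h' := h.mul_right √(kap A σ / Nat.card {c : Cl A σ // c ^ 2 = 1})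
  refine hasSum_le_of_sum_le h' fun s => ?_
  rw [← Finset.sum_mul]
  have := f.sum_mul_le hC (s.map (Function.Embedding.subtype _)) fun d hd => by
    obtain ⟨e, -, rfl⟩ := Finset.mem_map.1 hd
    exact e.2
  rwa [Finset.sum_map] at this

end Ramified

section Bound

variable {A σ : ℤ} [hD : Fact (σ ^ 2 + 4 * A < 0)]
local notation "𝓡" => QuadraticAlgebra ℤ A σ

variable (A σ) in
/-- The square of the contribution of the prime `p` to the lower bound. -/
noncomputable def locFactor (p : ℕ) : ℝ :=
  (p : ℝ) ^ (absD A σ).factorization p * (1 - (p : ℝ)⁻¹) ^ 2 *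
    if p ∈ ramT A σ then ((1 - (p : ℝ)⁻¹)⁻¹) ^ 4 else 1

lemma ramT_subset : ramT A σ ⊆ (absD A σ).primeFactors := fun _ hp =>
  mem_primeFactors_absD.2 (mem_ramT.1 hp).1

lemma prod_locFactor : ∏ p ∈ (absD A σ).primeFactors, locFactor A σ p =
    absD A σ * (∏ p ∈ (absD A σ).primeFactors, (1 - (p : ℝ)⁻¹)) ^ 2 *
      (∏ p ∈ ramT A σ, (1 - (p : ℝ)⁻¹)⁻¹) ^ 4 := by
  simp only [locFactor, Finset.prod_mul_distrib, Finset.prod_ite_mem,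
    Finset.inter_eq_right.2 ramT_subset, Finset.prod_pow]
  congr 2
  have h := Nat.prod_factorization_pow_eq_self (absD_pos (A := A) (σ := σ)).ne'
  rw [Finsupp.prod, Nat.support_factorization] at h
  exact_mod_cast h

lemma le_locFactor {p : ℕ} (hp : p.Prime) :
    (p : ℝ) ^ (absD A σ).factorization p * (1 - (p : ℝ)⁻¹) ^ 2 ≤ locFactor A σ p := by
  have h1 : 0 < 1 - (p : ℝ)⁻¹ := sub_pos.2 (inv_lt_one_of_one_lt₀ (by exact_mod_cast hp.one_lt))
  refine le_mul_of_one_le_right (by positivity) ?_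
  split_ifs
  · refine one_le_pow₀ ((one_le_inv₀ h1).2 ?_)
    have : 0 ≤ (p : ℝ)⁻¹ := by positivity
    linarith
  · exact le_rfl

lemma locFactor_eq {p : ℕ} (hp : p ∈ ramT A σ) : locFactor A σ p =
    (p : ℝ) ^ (absD A σ).factorization p * ((1 - (p : ℝ)⁻¹)⁻¹) ^ 2 := by
  have hp' := (mem_ramT.1 hp).1.1
  have h1 : 1 - (p : ℝ)⁻¹ ≠ 0 :=
    (sub_pos.2 (inv_lt_one_of_one_lt₀ (by exact_mod_cast hp'.one_lt))).ne'
  rw [locFactor, if_pos hp]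
  field_simp

lemma four_le_locFactor {p : ℕ} (hp : p ∈ (absD A σ).primeFactors) (h2 : p ≠ 2) :
    4 ≤ locFactor A σ p := by
  obtain ⟨hpp, hpD⟩ := mem_primeFactors_absD.1 hp
  have hp3 : 3 ≤ p := by have := hpp.two_le; omega
  have hp3' : (3 : ℝ) ≤ p := by exact_mod_cast hp3
  have hk : 1 ≤ (absD A σ).factorization p :=
    hpp.factorization_pos_of_dvd absD_pos.ne' (Nat.dvd_of_mem_primeFactors hp)
  rcases hk.eq_or_lt with hk | hk
  · have hT : p ∈ ramT A σ := by
      refine mem_ramT.2 ⟨⟨hpp, hpD⟩, ?_⟩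
      rintro ⟨e, he, -⟩
      have : p ^ 2 ∣ absD A σ := by
        rw [← Int.natCast_dvd_natCast, cast_absD, he]
        push_cast
        exact (Dvd.intro _ rfl).neg_right
      have := (hpp.pow_dvd_iff_le_factorization absD_pos.ne').1 this
      omega
    rw [locFactor_eq hT, ← hk, pow_one, inv_pow, ← div_eq_mul_inv, le_div_iff₀]
    · rcases hp3.eq_or_lt with rfl | h4
      · norm_num
      · have : (4 : ℝ) ≤ p := by exact_mod_cast h4
        have h5 : 0 < (p : ℝ)⁻¹ := by positivity
        have h6 : (p : ℝ)⁻¹ ≤ 1 := inv_le_one_of_one_le₀ (by linarith)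
        nlinarith
    · have : (p : ℝ)⁻¹ < 1 := inv_lt_one_of_one_lt₀ (by linarith)
      have : 0 < 1 - (p : ℝ)⁻¹ := by linarith
      positivity
  · refine le_trans ?_ (le_locFactor hpp)
    calc (4 : ℝ) ≤ ((p : ℝ) - 1) ^ 2 := by nlinarith
      _ = (p : ℝ) ^ 2 * (1 - (p : ℝ)⁻¹) ^ 2 := by field_simp
      _ ≤ _ := mul_le_mul_of_nonneg_right (pow_le_pow_right₀ (by linarith) hk) (sq_nonneg _)

lemma prod_locFactor_ge (s : Finset ℕ) (hs : s ⊆ (absD A σ).primeFactors) (h2 : 2 ∉ s) :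
    (2 ^ s.card : ℝ) ^ 2 ≤ ∏ p ∈ s, locFactor A σ p := by
  rw [← pow_mul, mul_comm, pow_mul, ← Finset.prod_const]
  exact Finset.prod_le_prod (fun _ _ => by norm_num) fun p hp => by
    have := four_le_locFactor (A := A) (σ := σ) (hs hp) (fun h => h2 (h ▸ hp))
    linarith

lemma locFactor_two {n : ℕ} (hn : σ ^ 2 + 4 * A = -(4 * n)) :
    ((if 2 ∣ n then 2 else 1) * (if n % 4 = 1 ∨ 8 ∣ n then 2 else 1) : ℝ) ^ 2 ≤
      2 * locFactor A σ 2 := by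
  have hN : absD A σ = 4 * n := by
    have := cast_absD (A := A) (σ := σ)
    rw [hn] at this; omega
  have hn0 : n ≠ 0 := by
    rintro rfl; have := absD_pos (A := A) (σ := σ); omega
  have hT : n % 4 ≠ 0 → n % 4 ≠ 3 → 2 ∈ ramT A σ := fun h0 h3 => by
    refine mem_ramT.2 ⟨⟨Nat.prime_two, ⟨-(2 * n), by rw [hn]; push_cast; ring⟩⟩, ?_⟩
    rintro ⟨e, he, h⟩
    rw [hn] at he
    push_cast at he
    omega
  have hk (k : ℕ) (h : 2 ^ k ∣ 4 * n) :
      (2 : ℝ) ^ k ≤ (2 : ℝ) ^ (absD A σ).factorization 2 := by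
    refine pow_le_pow_right₀ (by norm_num) ?_
    rw [← Nat.prime_two.pow_dvd_iff_le_factorization absD_pos.ne', hN]
    exact h
  have hle := le_locFactor (A := A) (σ := σ) Nat.prime_two
  by_cases h4 : n % 4 = 0
  · by_cases h8 : 8 ∣ n
    · have := hk 5 (by omega)
      simp only [show 2 ∣ n by omega, h8, or_true, if_true]
      norm_num at hle this ⊢
      linarith
    · have := hk 4 (by omega)
      simp only [show 2 ∣ n by omega, h8, show ¬ n % 4 = 1 by omega, or_false, if_true, if_false]
      norm_num at hle this ⊢
      linarith
  · have h8 : ¬ 8 ∣ n := by omega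
    by_cases h3 : n % 4 = 3
    · have := hk 2 (by omega)
      simp only [show ¬ 2 ∣ n by omega, h8, show ¬ n % 4 = 1 by omega, or_false, if_false]
      norm_num at hle this ⊢
      linarith
    · have := hk 2 (by omega)
      rw [locFactor_eq (hT h4 h3)]
      split_ifs <;> norm_num at this ⊢ <;> linarith

lemma card_two_torsion_pos : 0 < Nat.card {c : Cl A σ // c ^ 2 = 1} := by
  have : Nonempty {c : Cl A σ // c ^ 2 = 1} := ⟨⟨1, one_pow 2⟩⟩
  exact Nat.card_pos

lemma sq_le_prod_locFactor (h4 : σ ^ 2 + 4 * A ≤ -4) :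
    ((Nat.card 𝓡ˣ * Nat.card {c : Cl A σ // c ^ 2 = 1} : ℕ) : ℝ) ^ 2 ≤
      2 * ∏ p ∈ (absD A σ).primeFactors, locFactor A σ p := by
  rcases h4.eq_or_lt with h4 | h4
  · have hN : absD A σ = 4 := by simp [absD, h4]
    have h2 := locFactor_two (A := A) (σ := σ) (n := 1) (by rw [h4]; norm_num)
    have h1 : Nat.card 𝓡ˣ * Nat.card {c : Cl A σ // c ^ 2 = 1} ≤ 4 * 1 :=
      Nat.mul_le_mul (card_units_le_four h4) (card_two_torsion_of_neg_four h4)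
    have h1' : ((Nat.card 𝓡ˣ * Nat.card {c : Cl A σ // c ^ 2 = 1} : ℕ) : ℝ) ≤ 4 := by
      exact_mod_cast h1
    have hT : 2 ∈ ramT A σ := by
      refine mem_ramT.2 ⟨⟨Nat.prime_two, by rw [h4]; norm_num⟩, ?_⟩
      rintro ⟨e, he, h⟩
      rw [h4] at he
      push_cast at he
      omega
    have hpf : (4 : ℕ).primeFactors = {2} := by
      rw [show 4 = 2 ^ 2 by norm_num, Nat.primeFactors_prime_pow two_ne_zero Nat.prime_two]
    have hfac : (4 : ℕ).factorization 2 = 2 := by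
      rw [show 4 = 2 ^ 2 by norm_num, Nat.prime_two.factorization_pow]; simp
    rw [hN, hpf, Finset.prod_singleton, locFactor_eq hT, hN, hfac]
    norm_num
    push_cast at h1'
    have h0 : (0 : ℝ) ≤ Nat.card 𝓡ˣ * Nat.card {c : Cl A σ // c ^ 2 = 1} := by positivity
    nlinarith
  · have hw : Nat.card 𝓡ˣ * Nat.card {c : Cl A σ // c ^ 2 = 1} ≤
        2 * Nat.card {c : Cl A σ // c ^ 2 = 1} := Nat.mul_le_mul_right _ (card_units_le_two h4)
    by_cases h2 : 2 ∣ absD A σ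
    · obtain ⟨n, hn⟩ : ∃ n : ℕ, σ ^ 2 + 4 * A = -(4 * n) := by
        refine ⟨absD A σ / 4, ?_⟩
        have hc := cast_absD (A := A) (σ := σ)
        rcases Int.even_or_odd' σ with ⟨s, hs | hs⟩
        · have : σ ^ 2 + 4 * A = 4 * (s ^ 2 + A) := by rw [hs]; ring
          omega
        · have : σ ^ 2 + 4 * A = 4 * (s ^ 2 + s + A) + 1 := by rw [hs]; ring
          omega
      have hN : absD A σ = 4 * n := by
        have := cast_absD (A := A) (σ := σ)
        rw [hn] at this; omega
      have hn0 : n ≠ 0 := by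
        rintro rfl; have := absD_pos (A := A) (σ := σ); omega
      obtain ⟨hfin, hcard⟩ := amb_even hn
      have hle := hw.trans ((two_mul_card_le h4 hfin).trans hcard)
      have hpf : (absD A σ).primeFactors = insert 2 (n.primeFactors.erase 2) := by
        ext q
        rw [hN]
        by_cases hq : q = 2
        · simp [hq, Nat.prime_two, hn0]; omega
        · simp only [Nat.mem_primeFactors, Finset.mem_insert, Finset.mem_erase, hq, false_or, ne_eq,
            not_false_eq_true, true_and]
          refine and_congr_right fun hqp => and_congr ?_ (by omega)
          rw [hqp.dvd_mul, or_iff_right]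
          rw [show 4 = 2 ^ 2 by norm_num]
          exact fun h => hq ((Nat.prime_dvd_prime_iff_eq hqp Nat.prime_two).1 (hqp.dvd_of_dvd_pow h))
      have hc2 : n.primeFactors.card =
          (n.primeFactors.erase 2).card + if 2 ∣ n then 1 else 0 := by
        by_cases hd : 2 ∣ n
        · rw [if_pos hd, Finset.card_erase_add_one (Nat.mem_primeFactors.2 ⟨Nat.prime_two, hd, hn0⟩)]
        · rw [if_neg hd, Finset.erase_eq_of_notMem fun h => hd (Nat.dvd_of_mem_primeFactors h),
            add_zero]
      have hprod := prod_locFactor_ge (A := A) (σ := σ) (n.primeFactors.erase 2)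
        (hpf ▸ Finset.subset_insert _ _) (Finset.notMem_erase _ _)
      have hloc := locFactor_two (A := A) (σ := σ) hn
      rw [hpf, Finset.prod_insert (Finset.notMem_erase _ _)]
      calc ((Nat.card 𝓡ˣ * Nat.card {c : Cl A σ // c ^ 2 = 1} : ℕ) : ℝ) ^ 2
          ≤ ((2 ^ n.primeFactors.card * if n % 4 = 1 ∨ 8 ∣ n then 2 else 1 : ℕ) : ℝ) ^ 2 := by
            gcongr
        _ = ((if 2 ∣ n then 2 else 1) * (if n % 4 = 1 ∨ 8 ∣ n then 2 else 1) : ℝ) ^ 2 *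
            (2 ^ (n.primeFactors.erase 2).card : ℝ) ^ 2 := by
            rw [hc2]
            split_ifs <;> push_cast <;> ring
        _ ≤ (2 * locFactor A σ 2) * ∏ p ∈ n.primeFactors.erase 2, locFactor A σ p :=
            mul_le_mul hloc hprod (sq_nonneg _) ((sq_nonneg _).trans hloc)
        _ = _ := by ring
    · obtain ⟨hfin, hcard⟩ := amb_odd (A := A) (σ := σ) (N := absD A σ)
        (by rw [cast_absD]; ring) h2
      have hle := hw.trans ((two_mul_card_le h4 hfin).trans hcard)
      have hprod := prod_locFactor_ge (A := A) (σ := σ) _ subset_rfl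
        fun h => h2 (Nat.dvd_of_mem_primeFactors h)
      calc ((Nat.card 𝓡ˣ * Nat.card {c : Cl A σ // c ^ 2 = 1} : ℕ) : ℝ) ^ 2
          ≤ ((2 ^ (absD A σ).primeFactors.card : ℕ) : ℝ) ^ 2 := by gcongr
        _ ≤ _ := by
          push_cast
          nlinarith [sq_nonneg ((2 : ℝ) ^ (absD A σ).primeFactors.card)]

theorem Frm.two_le_pow_four (h4 : σ ^ 2 + 4 * A ≤ -4) (f : Frm A σ) {C : ℝ}
    (hC : Tendsto (fun x : ℝ => (Set.ncard {n : ℕ | n ∈ f.rep ∧ (n : ℝ) ≤ x} : ℝ) *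
      √(Real.log x) / x) atTop (𝓝 C)) :
    0 ≤ C ∧ 2 ≤ (√(absD A σ : ℝ) * C) ^ 4 := by
  have h := f.prod_mul_le hC
  have hE : 0 ≤ ∏ p ∈ ramT A σ, (1 - (p : ℝ)⁻¹)⁻¹ := Finset.prod_nonneg fun p hp =>
    inv_nonneg.2 (sub_nonneg.2 (inv_le_one_of_one_le₀
      (by exact_mod_cast (mem_ramT.1 hp).1.1.one_lt.le)))
  have hπ := Real.pi_pos
  have hC0 : 0 ≤ C := by
    have : 0 ≤ C * √π := le_trans (by positivity) h
    exact nonneg_of_mul_nonneg_left this (Real.sqrt_pos.2 hπ)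
  refine ⟨hC0, ?_⟩
  have hb := sq_le_prod_locFactor h4
  rw [prod_locFactor] at hb
  have hkap := kap_pos (A := A) (σ := σ)
  have hw : (0 : ℝ) < Nat.card 𝓡ˣ := by exact_mod_cast card_units_pos
  have ht : (0 : ℝ) < Nat.card {c : Cl A σ // c ^ 2 = 1} := by exact_mod_cast card_two_torsion_pos
  have hN : (0 : ℝ) < absD A σ := by exact_mod_cast absD_pos
  have h' := pow_le_pow_left₀ (by positivity) h 4
  have e1 : √(kap A σ / Nat.card {c : Cl A σ // c ^ 2 = 1}) ^ 4 =
      (kap A σ / Nat.card {c : Cl A σ // c ^ 2 = 1}) ^ 2 := by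
    rw [show 4 = 2 * 2 by norm_num, pow_mul, Real.sq_sqrt (by positivity)]
  have e2 : √π ^ 4 = π ^ 2 := by
    rw [show 4 = 2 * 2 by norm_num, pow_mul, Real.sq_sqrt hπ.le]
  have e3 : √(absD A σ : ℝ) ^ 4 = (absD A σ : ℝ) ^ 2 := by
    rw [show 4 = 2 * 2 by norm_num, pow_mul, Real.sq_sqrt hN.le]
  have e4 : √(absD A σ : ℝ) ^ 2 = (absD A σ : ℝ) := Real.sq_sqrt hN.le
  rw [mul_pow, mul_pow, e1, e2, kap] at h'
  simp only [div_pow, mul_pow, e4] at h'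
  rw [mul_pow, e3]
  push_cast at hb
  set E := ∏ p ∈ ramT A σ, (1 - (p : ℝ)⁻¹)⁻¹
  set P := ∏ p ∈ (absD A σ).primeFactors, (1 - (p : ℝ)⁻¹)
  set w := (Nat.card 𝓡ˣ : ℝ)
  set t := (Nat.card {c : Cl A σ // c ^ 2 = 1} : ℝ)
  set N := (absD A σ : ℝ)
  have e5 : E ^ 4 * (2 ^ 2 * π ^ 2 / N * P ^ 2 / w ^ 2 / t ^ 2) =
      (4 * (N * P ^ 2 * E ^ 4) / (N ^ 2 * (w * t) ^ 2)) * π ^ 2 := by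
    field_simp
    ring
  rw [e5] at h'
  have h'' := le_of_mul_le_mul_right h' (by positivity)
  rw [div_le_iff₀ (by positivity)] at h''
  have hwt : 0 < (w * t) ^ 2 := by positivity
  refine le_of_mul_le_mul_right (a := (w * t) ^ 2) ?_ hwt
  linarith

end Bound

section HexProduct

lemma prod_sq_div_le (M : ℕ) :
    ∏ n ∈ Finset.range (11 + M), (if n = 2 ∨ n = 5 ∨ 11 ≤ n then (1 - ((n : ℝ) ^ 2)⁻¹)⁻¹ else 1) =
      55 / 36 * ((10 + M) / (11 + M)) := by
  induction M with
  | zero => norm_num [Finset.prod_range_succ]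
  | succ M ih =>
    rw [← add_assoc, Finset.prod_range_succ, ih, if_pos (by omega)]
    have : (11 + (M : ℝ)) ^ 2 - 1 ≠ 0 := by
      have : (0 : ℝ) ≤ M := by positivity
      nlinarith
    have : (1 - ((11 + (M : ℝ)) ^ 2)⁻¹)⁻¹ = (11 + (M : ℝ)) ^ 2 / ((10 + M) * (12 + M)) := by
      rw [inv_eq_iff_eq_inv]
      field_simp
      ring
    push_cast
    rw [this]
    field_simp
    ring

lemma prod_inv_one_sub_sq_le (S : Finset ℕ) (hS : ∀ p ∈ S, p.Prime ∧ p % 3 = 2) :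
    ∏ p ∈ S, (1 - ((p : ℝ) ^ 2)⁻¹)⁻¹ ≤ 55 / 36 := by
  have hψ (n : ℕ) : 1 ≤ (if n = 2 ∨ n = 5 ∨ 11 ≤ n then (1 - ((n : ℝ) ^ 2)⁻¹)⁻¹ else 1) := by
    split_ifs with h
    · have h2 : (2 : ℝ) ≤ n := by exact_mod_cast (by omega : 2 ≤ n)
      have h3 : ((n : ℝ) ^ 2)⁻¹ < 1 := inv_lt_one_of_one_lt₀ (by nlinarith)
      have h4 : 0 < ((n : ℝ) ^ 2)⁻¹ := by positivity
      exact (one_le_inv₀ (by linarith)).2 (by linarith)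
    · exact le_rfl
  obtain ⟨M, hM⟩ : ∃ M, S ⊆ Finset.range (11 + M) := by
    obtain ⟨M, hM⟩ := S.exists_nat_subset_range
    exact ⟨M, hM.trans (Finset.range_subset_range.2 (by omega))⟩
  calc ∏ p ∈ S, (1 - ((p : ℝ) ^ 2)⁻¹)⁻¹
      = ∏ n ∈ S, (if n = 2 ∨ n = 5 ∨ 11 ≤ n then (1 - ((n : ℝ) ^ 2)⁻¹)⁻¹ else 1) := by
        refine Finset.prod_congr rfl fun p hp => (if_pos ?_).symm
        obtain ⟨hpp, h3⟩ := hS p hp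
        by_contra! h
        obtain ⟨h2, h5, h11⟩ := h
        have : p = 8 := by omega
        subst this
        norm_num at hpp
    _ ≤ ∏ n ∈ Finset.range (11 + M),
          (if n = 2 ∨ n = 5 ∨ 11 ≤ n then (1 - ((n : ℝ) ^ 2)⁻¹)⁻¹ else 1) := by
        rw [← Finset.prod_sdiff hM]
        refine le_mul_of_one_le_left
          (Finset.prod_nonneg fun n _ => zero_le_one.trans (hψ n)) ?_
        calc (1 : ℝ) = ∏ n ∈ Finset.range (11 + M) \ S, 1 := by simp
          _ ≤ _ := Finset.prod_le_prod (fun _ _ => zero_le_one) fun n _ => hψ n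
    _ = 55 / 36 * ((10 + M) / (11 + M)) := prod_sq_div_le M
    _ ≤ 55 / 36 := by
        refine mul_le_of_le_one_right (by norm_num) ((div_le_one (by positivity)).2 (by linarith))

lemma tprod_hex_le :
    ∏' p : {p : ℕ // p.Prime ∧ p % 3 = 2}, (1 - (p.1 : ℝ) ^ (-(2 : ℝ))) ^ (-(1 : ℝ) / 2) ≤
      √(55 / 36) := by
  by_cases hm : Multipliable fun p : {p : ℕ // p.Prime ∧ p % 3 = 2} =>
      (1 - (p.1 : ℝ) ^ (-(2 : ℝ))) ^ (-(1 : ℝ) / 2)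
  · refine hm.tprod_le_of_prod_le fun s => Real.le_sqrt_of_sq_le ?_
    rw [← Finset.prod_pow]
    have h := prod_inv_one_sub_sq_le (s.map (Function.Embedding.subtype _)) fun p hp => by
      obtain ⟨q, -, rfl⟩ := Finset.mem_map.1 hp
      exact q.2
    rw [Finset.prod_map] at h
    refine le_trans (le_of_eq (Finset.prod_congr rfl fun p _ => ?_)) h
    have h1 : (1 : ℝ) ≤ p.1 := by exact_mod_cast p.2.1.one_lt.le
    have h2 : (p.1 : ℝ) ^ (-(2 : ℝ)) = ((p.1 : ℝ) ^ 2)⁻¹ := by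
      rw [Real.rpow_neg (by linarith), Real.rpow_two]
    have h3 : ((p.1 : ℝ) ^ 2)⁻¹ ≤ 1 := inv_le_one_of_one_le₀ (one_le_pow₀ h1)
    rw [h2, ← Real.rpow_natCast, ← Real.rpow_mul (by linarith)]
    norm_num [Real.rpow_neg_one]
  · rw [tprod_eq_one_of_not_multipliable hm, Real.one_le_sqrt]
    norm_num

end HexProduct

end QuadOrder

end

lemma hexErdos_nonneg : 0 ≤ hexErdos := by
  refine mul_nonneg (by positivity) ?_
  by_cases hm : Multipliable fun p : {p : ℕ // p.Prime ∧ p % 3 = 2} =>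
      (1 - (p.1 : ℝ) ^ (-(2 : ℝ))) ^ (-(1 : ℝ) / 2)
  · refine ge_of_tendsto' hm.hasProd fun s => Finset.prod_nonneg fun p _ => Real.rpow_nonneg ?_ _
    exact sub_nonneg.2 (Real.rpow_le_one_of_one_le_of_nonpos
      (by exact_mod_cast p.2.1.one_lt.le) (by norm_num))
  · rw [tprod_eq_one_of_not_multipliable hm]
    exact zero_le_one

lemma hexErdos_pow_four_lt : hexErdos ^ 4 < 1 / 8 := by
  have h1 : ((2 : ℝ) ^ (-(3 : ℝ) / 2) * 3 ^ ((1 : ℝ) / 4)) ^ 4 = 3 / 64 := by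
    rw [mul_pow, ← Real.rpow_natCast, ← Real.rpow_natCast, ← Real.rpow_mul (by norm_num),
      ← Real.rpow_mul (by norm_num),
      show -(3 : ℝ) / 2 * (4 : ℕ) = ((-6 : ℤ) : ℝ) by norm_num, Real.rpow_intCast]
    norm_num
  have h2 : hexErdos ≤ 2 ^ (-(3 : ℝ) / 2) * 3 ^ ((1 : ℝ) / 4) * √(55 / 36) :=
    mul_le_mul_of_nonneg_left QuadOrder.tprod_hex_le (by positivity)
  have h3 := pow_le_pow_left₀ hexErdos_nonneg h2 4
  rw [mul_pow, h1, show √(55 / 36 : ℝ) ^ 4 = (√(55 / 36) ^ 2) ^ 2 by ring,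
    Real.sq_sqrt (by norm_num)] at h3
  norm_num at h3
  linarith

theorem stmt0 (a b c : ℤ) (ha : 0 < a) (hprim : Int.gcd (Int.gcd a b) c = 1)
    (hD : b ^ 2 - 4 * a * c ≤ -4) (C : ℝ)
    (hC : Tendsto (fun x : ℝ => (Bcount a b c x : ℝ) * Real.sqrt (Real.log x) / x)
      atTop (nhds C)) :
    Real.sqrt |((b ^ 2 - 4 * a * c : ℤ) : ℝ)| / 2 * C > hexErdos := by
  have hdisc : b ^ 2 + 4 * -(a * c) = b ^ 2 - 4 * a * c := by ring
  have : Fact (b ^ 2 + 4 * -(a * c) < 0) := ⟨by omega⟩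
  let f : QuadOrder.Frm (-(a * c)) b :=
    { m := a
      t := 0
      C := c
      pos := ha
      eq := by ring
      prim := by simpa using QuadOrder.exists_bezout_of_gcd hprim }
  have hB (x : ℝ) : Bcount a b c x = Set.ncard {n : ℕ | n ∈ f.rep ∧ (n : ℝ) ≤ x} := by
    refine congrArg Set.ncard ?_
    ext n
    have hval (u v : ℤ) : f.val u v = a * u ^ 2 + b * u * v + c * v ^ 2 := by
      simp only [QuadOrder.Frm.val, f]; ring
    simp only [Set.mem_ofPred_eq, QuadOrder.Frm.rep, hval, Nat.pos_iff_ne_zero, eq_comm (a := (n : ℤ))]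
    tauto
  simp only [hB] at hC
  obtain ⟨hC0, h⟩ := f.two_le_pow_four (by omega) hC
  have hN : |((b ^ 2 - 4 * a * c : ℤ) : ℝ)| = (QuadOrder.absD (-(a * c)) b : ℝ) := by
    rw [← hdisc, QuadOrder.absD, Nat.cast_natAbs, Int.cast_abs]
  rw [hN]
  refine lt_of_pow_lt_pow_left₀ 4 (by positivity) (hexErdos_pow_four_lt.trans_le ?_)
  calc (1 / 8 : ℝ) ≤ (√(QuadOrder.absD (-(a * c)) b : ℝ) * C) ^ 4 / 2 ^ 4 := by linarith
    _ = _ := by ring
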